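/- arXiv:2505.05902 — 2 statements merged into one kernel-verified Lean document; each statement's English description precedes it below -/
import Mathlib

section
/- Let p be a prime, F a field of characteristic p, G a finite p-group which can be generated by two elements and whose derived subgroup G' is cyclic, and H a finite group. If the group algebras F[G] and F[H] are isomorphic as F-algebras, then the quotient groups G/℧(G') and H/℧(H') are isomorphic, where ℧(G') denotes the subgroup of G generated by the p-th powers of the elements of G' (a normal subgroup of G), and similarly for H. -/
/-- `℧(P)`: the subgroup of `G` generated by the `p`-th powers of the elements of the
subgroup `P` of `G`. -/
def agemo (p : ℕ) {G : Type*} [Group G] (P : Subgroup G) : Subgroup G :=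
  Subgroup.closure {x | ∃ g ∈ P, x = g ^ p}

/-- `℧(G')` is a normal subgroup of `G`. -/
instance agemo_commutator_normal (p : ℕ) (G : Type*) [Group G] :
    (agemo p (commutator G)).Normal := by
  have h : ∀ g x : G, x ∈ {x : G | ∃ g' ∈ commutator G, x = g' ^ p} →
      g * x * g⁻¹ ∈ {x : G | ∃ g' ∈ commutator G, x = g' ^ p} := by
    rintro g x ⟨h', hh', rfl⟩
    exact ⟨g * h' * g⁻¹, Subgroup.Normal.conj_mem inferInstance h' hh' g, (conj_pow ..).symm⟩
  constructor
  intro x hx g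
  unfold agemo at hx ⊢
  induction hx using Subgroup.closure_induction with
  | mem y hy => exact Subgroup.subset_closure (h g y hy)
  | one => simpa using Subgroup.one_mem _
  | mul y z _ _ ihy ihz =>
      have e : g * (y * z) * g⁻¹ = (g * y * g⁻¹) * (g * z * g⁻¹) := by group
      rw [e]; exact Subgroup.mul_mem _ ihy ihz
  | inv y _ ihy =>
      have e : g * y⁻¹ * g⁻¹ = (g * y * g⁻¹)⁻¹ := by group
      rw [e]; exact Subgroup.inv_mem _ ihy

/-- The elements `x, y` generate `Γ`, their commutator `c` is central, and `Γ` is given by a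
power-commutator presentation with parameters `m, n, e, i, j`. -/
structure IsPCPresented (p m n e i j : ℕ) {Γ : Type*} [Group Γ] (x y c : Γ) : Prop where
  gen : Subgroup.closure {x, y} = ⊤
  comm : x * y = y * x * c
  comm_x : Commute c x
  comm_y : Commute c y
  c_pow : c ^ p ^ e = 1
  x_pow : x ^ p ^ m = c ^ i
  y_pow : y ^ p ^ n = c ^ j
  card : Nat.card Γ = p ^ (m + n + e)

section Collect

variable {Γ : Type*} [Group Γ] {x y c : Γ}

theorem pow_mul_comm_of_comm (h : x * y = y * x * c) (hx : Commute c x) (hy : Commute c y)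
    (a b : ℕ) : x ^ a * y ^ b = y ^ b * x ^ a * c ^ (a * b) := by
  have h1 : ∀ b : ℕ, x * y ^ b = y ^ b * x * c ^ b := by
    intro b
    induction b with
    | zero => simp
    | succ b ih =>
      calc x * y ^ (b + 1) = (x * y ^ b) * y := by rw [pow_succ, mul_assoc]
        _ = y ^ b * (x * (c ^ b * y)) := by rw [ih]; simp only [mul_assoc]
        _ = y ^ b * (x * y) * c ^ b := by rw [(hy.pow_left b).eq]; simp only [mul_assoc]
        _ = _ := by rw [h, pow_succ, pow_succ']; simp only [mul_assoc]
  induction a with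
  | zero => simp
  | succ a ih =>
    calc x ^ (a + 1) * y ^ b = x ^ a * (x * y ^ b) := by rw [pow_succ, mul_assoc]
      _ = (x ^ a * y ^ b) * x * c ^ b := by rw [h1]; simp only [mul_assoc]
      _ = y ^ b * x ^ a * (c ^ (a * b) * x) * c ^ b := by rw [ih]; simp only [mul_assoc]
      _ = _ := by
        rw [(hx.pow_left _).eq, pow_succ, add_mul, one_mul, pow_add]; simp only [mul_assoc]

theorem collected_mul (h : x * y = y * x * c) (hx : Commute c x) (hy : Commute c y)
    (b a k b' a' k' : ℕ) :
    (y ^ b * x ^ a * c ^ k) * (y ^ b' * x ^ a' * c ^ k') =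
      y ^ (b + b') * x ^ (a + a') * c ^ (k + k' + a * b') := by
  have hk : Commute (c ^ k) (y ^ b' * x ^ a') :=
    ((hy.pow_pow k b').mul_right (hx.pow_pow k a'))
  calc (y ^ b * x ^ a * c ^ k) * (y ^ b' * x ^ a' * c ^ k')
      = y ^ b * x ^ a * (c ^ k * (y ^ b' * x ^ a')) * c ^ k' := by simp only [mul_assoc]
    _ = y ^ b * (x ^ a * y ^ b') * x ^ a' * c ^ k * c ^ k' := by
        rw [hk.eq]; simp only [mul_assoc]
    _ = y ^ b * y ^ b' * x ^ a * (c ^ (a * b') * x ^ a') * c ^ k * c ^ k' := by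
        rw [pow_mul_comm_of_comm h hx hy]; simp only [mul_assoc]
    _ = y ^ b * y ^ b' * (x ^ a * x ^ a') * (c ^ k * c ^ k' * c ^ (a * b')) := by
        rw [(hx.pow_pow _ _).eq, (Commute.refl c).pow_pow k k' |>.eq]
        have : c ^ k' * c ^ k * c ^ (a * b') = c ^ (a * b') * c ^ k * c ^ k' := by
          simp only [← pow_add]; congr 1; ring
        rw [this]; simp only [mul_assoc]
    _ = _ := by simp only [← pow_add]

theorem collected_pow (h : x * y = y * x * c) (hx : Commute c x) (hy : Commute c y)
    (b a k N : ℕ) :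
    (y ^ b * x ^ a * c ^ k) ^ N =
      y ^ (N * b) * x ^ (N * a) * c ^ (N * k + N.choose 2 * (a * b)) := by
  induction N with
  | zero => simp
  | succ N ih =>
    rw [pow_succ, ih, collected_mul h hx hy]
    have : (N + 1).choose 2 = N + N.choose 2 := by
      rw [Nat.choose_succ_succ' N 1, Nat.choose_one_right]
    rw [this]
    congr 1
    · congr 2 <;> ring
    · congr 1; ring

theorem exists_collected [Finite Γ] (hg : Subgroup.closure {x, y} = ⊤) (h : x * y = y * x * c)
    (hx : Commute c x) (hy : Commute c y) (g : Γ) :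
    ∃ b a k : ℕ, g = y ^ b * x ^ a * c ^ k := by
  have hmem : g ∈ Subgroup.closure {x, y} := hg ▸ Subgroup.mem_top g
  induction hmem using Subgroup.closure_induction with
  | mem z hz =>
    rcases hz with rfl | rfl
    · exact ⟨0, 1, 0, by simp⟩
    · exact ⟨1, 0, 0, by simp⟩
  | one => exact ⟨0, 0, 0, by simp⟩
  | mul u v _ _ hu hv =>
    obtain ⟨b, a, k, rfl⟩ := hu
    obtain ⟨b', a', k', rfl⟩ := hv
    exact ⟨_, _, _, collected_mul h hx hy ..⟩
  | inv u _ hu =>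
    obtain ⟨b, a, k, rfl⟩ := hu
    set g := y ^ b * x ^ a * c ^ k with hg'
    have hi : g⁻¹ = g ^ (orderOf g - 1) := by
      refine inv_eq_of_mul_eq_one_left ?_
      rw [← pow_succ, Nat.sub_add_cancel (orderOf_pos _), pow_orderOf_eq_one]
    rw [hi, hg', collected_pow h hx hy]
    exact ⟨_, _, _, rfl⟩

theorem exists_reduced [Finite Γ] {p m n e i j : ℕ} (hp : 0 < p)
    (hg : Subgroup.closure {x, y} = ⊤) (h : x * y = y * x * c)
    (hx : Commute c x) (hy : Commute c y) (hc : c ^ p ^ e = 1) (hxm : x ^ p ^ m = c ^ i)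
    (hyn : y ^ p ^ n = c ^ j) :
    Function.Surjective fun t : Fin (p ^ n) × Fin (p ^ m) × Fin (p ^ e) ↦
      y ^ (t.1 : ℕ) * x ^ (t.2.1 : ℕ) * c ^ (t.2.2 : ℕ) := by
  intro g
  obtain ⟨b, a, k, rfl⟩ := exists_collected hg h hx hy g
  refine ⟨⟨⟨b % p ^ n, Nat.mod_lt _ (by positivity)⟩, ⟨a % p ^ m, Nat.mod_lt _ (by positivity)⟩,
    ⟨(k + i * (a / p ^ m) + j * (b / p ^ n)) % p ^ e, Nat.mod_lt _ (by positivity)⟩⟩, ?_⟩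
  simp only
  rw [← pow_eq_pow_mod _ hc]
  have hb : y ^ b = y ^ (b % p ^ n) * c ^ (j * (b / p ^ n)) := by
    conv_lhs => rw [← Nat.mod_add_div b (p ^ n)]
    rw [pow_add, pow_mul y, hyn, ← pow_mul]
  have ha : x ^ a = x ^ (a % p ^ m) * c ^ (i * (a / p ^ m)) := by
    conv_lhs => rw [← Nat.mod_add_div a (p ^ m)]
    rw [pow_add, pow_mul x, hxm, ← pow_mul]
  have h2 := (hx.pow_pow (j * (b / p ^ n)) (a % p ^ m)).eq
  calc y ^ (b % p ^ n) * x ^ (a % p ^ m) * c ^ (k + i * (a / p ^ m) + j * (b / p ^ n))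
      = y ^ (b % p ^ n) * (x ^ (a % p ^ m) * c ^ (j * (b / p ^ n))) * c ^ (i * (a / p ^ m)) *
          c ^ k := by
        simp only [mul_assoc, ← pow_add]; congr 3; ring
    _ = _ := by rw [← h2, hb, ha]; simp only [mul_assoc]

theorem bijective_of_generators {K : Type*} [Group K] [Finite K] [Finite Γ] (f : Γ →* K)
    (hf : Subgroup.closure {f x, f y} = ⊤) (hK : Nat.card Γ ≤ Nat.card K) :
    Function.Bijective f := by
  have hs : Function.Surjective f := by
    rw [← MonoidHom.range_eq_top, eq_top_iff, ← hf, Subgroup.closure_le]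
    rintro _ (rfl | rfl) <;> simp
  exact (Nat.bijective_iff_surjective_and_card f).2
    ⟨hs, le_antisymm hK (Nat.card_le_card_of_surjective f hs)⟩

end Collect

namespace IsPCPresented

variable {p m n e i j : ℕ} {Γ : Type*} [Group Γ] {x y c : Γ}

theorem finite (hp : 0 < p) (h : IsPCPresented p m n e i j x y c) : Finite Γ :=
  Nat.finite_of_card_ne_zero (by rw [h.card]; positivity)

theorem reduced_bijective (hp : 0 < p) (h : IsPCPresented p m n e i j x y c) :
    Function.Bijective fun t : Fin (p ^ n) × Fin (p ^ m) × Fin (p ^ e) ↦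
      y ^ (t.1 : ℕ) * x ^ (t.2.1 : ℕ) * c ^ (t.2.2 : ℕ) := by
  have := h.finite hp
  refine (Nat.bijective_iff_surjective_and_card _).2
    ⟨exists_reduced hp h.gen h.comm h.comm_x h.comm_y h.c_pow h.x_pow h.y_pow, ?_⟩
  rw [h.card]
  simp only [Nat.card_prod, Nat.card_fin, pow_add]; ring

/-- Groups with the same presentation are isomorphic. -/
theorem nonempty_mulEquiv {Δ : Type*} [Group Δ] {x' y' c' : Δ} (hp : 0 < p)
    (h : IsPCPresented p m n e i j x y c) (h' : IsPCPresented p m n e i j x' y' c') :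
    Nonempty (Γ ≃* Δ) := by
  have := h.finite hp
  have := h'.finite hp
  let D : Subgroup (Γ × Δ) := Subgroup.closure {(x, x'), (y, y')}
  let X : D := ⟨(x, x'), Subgroup.subset_closure (by simp)⟩
  let Y : D := ⟨(y, y'), Subgroup.subset_closure (by simp)⟩
  have hC : (c, c') ∈ D := by
    have : (c, c') = ((Y * X)⁻¹ * (X * Y) : D) := by
      simp [X, Y, h.comm, h'.comm, mul_assoc]
    rw [this]; exact Subtype.prop _
  let C : D := ⟨(c, c'), hC⟩
  have hgen : Subgroup.closure {X, Y} = ⊤ := by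
    have := Subgroup.closure_closure_coe_preimage (k := {(x, x'), (y, y')})
    convert this using 2
    ext ⟨d, hd⟩
    simp [X, Y, Subtype.ext_iff]
  have hcard : Nat.card D ≤ p ^ (m + n + e) := by
    have := Nat.card_le_card_of_surjective _ (exists_reduced (c := C) (i := i) (j := j) (m := m)
      (n := n) (e := e) hp hgen
      (by ext <;> simp [X, Y, C, h.comm, h'.comm])
      (by ext <;> simp [X, C, h.comm_x.eq, h'.comm_x.eq])
      (by ext <;> simp [Y, C, h.comm_y.eq, h'.comm_y.eq])
      (by ext <;> simp [C, h.c_pow, h'.c_pow])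
      (by ext <;> simp [X, C, h.x_pow, h'.x_pow])
      (by ext <;> simp [Y, C, h.y_pow, h'.y_pow]))
    refine this.trans_eq ?_
    simp only [Nat.card_prod, Nat.card_fin, pow_add]; ring
  exact ⟨(MulEquiv.ofBijective ((MonoidHom.fst Γ Δ).comp D.subtype) 
    (bijective_of_generators (x := X) (y := Y) _ h.gen (hcard.trans_eq h.card.symm))).symm.trans
    (MulEquiv.ofBijective ((MonoidHom.snd Γ Δ).comp D.subtype) 
    (bijective_of_generators (x := X) (y := Y) _ h'.gen (hcard.trans_eq h'.card.symm)))⟩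

end IsPCPresented

theorem exists_cyclic_complement {p : ℕ} [Fact p.Prime] {Q : Type*} [CommGroup Q] [Finite Q]
    (hQ : IsPGroup p Q) {u v : Q} (hg : Subgroup.closure {u, v} = ⊤)
    (huv : orderOf v ∣ orderOf u) :
    ∃ m n s : ℕ, n ≤ m ∧ u ^ p ^ m = 1 ∧ (v * u ^ s) ^ p ^ n = 1 ∧
      Nat.card Q = p ^ (m + n) := by
  have hp : p.Prime := Fact.out
  obtain ⟨m, hm⟩ := IsPGroup.iff_orderOf.1 hQ u
  obtain ⟨n, hn⟩ := IsPGroup.iff_orderOf.1 (hQ.to_quotient (Subgroup.zpowers u))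
    (v : Q ⧸ Subgroup.zpowers u)
  have hnm : n ≤ m := by
    rw [← Nat.pow_dvd_pow_iff_le_right hp.one_lt, ← hn, ← hm]
    exact (orderOf_map_dvd (QuotientGroup.mk' (Subgroup.zpowers u)) v).trans huv
  have hv : v ^ p ^ n ∈ Subgroup.zpowers u := by
    rw [← QuotientGroup.eq_one_iff, QuotientGroup.mk_pow, ← hn, pow_orderOf_eq_one]
  obtain ⟨k, hk⟩ := (mem_powers_iff_mem_zpowers.2 hv)
  simp only at hk
  have hkn : p ^ n ∣ k := by
    have h1 : u ^ (k * p ^ (m - n)) = 1 := by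
      rw [pow_mul, hk, ← pow_mul, ← pow_add, Nat.add_sub_cancel' hnm, ← hm]
      exact orderOf_dvd_iff_pow_eq_one.1 huv
    have h2 := orderOf_dvd_of_pow_eq_one h1
    rw [hm, ← Nat.add_sub_cancel' hnm, pow_add, Nat.add_sub_cancel' hnm] at h2
    exact Nat.dvd_of_mul_dvd_mul_right (by have := hp.pos; positivity) h2
  obtain ⟨k', rfl⟩ := hkn
  refine ⟨m, n, k' * (p ^ m - 1), hnm, hm ▸ pow_orderOf_eq_one u, ?_, ?_⟩
  · rw [mul_pow, ← hk, ← pow_mul, ← pow_add]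
    have : p ^ n * k' + k' * (p ^ m - 1) * p ^ n = p ^ m * (k' * p ^ n) := by
      obtain ⟨w, hw⟩ := Nat.exists_eq_add_of_lt (Nat.pow_pos (n := m) hp.pos)
      rw [hw]; simp; ring
    rw [this, pow_mul, ← hm, pow_orderOf_eq_one, one_pow]
  · have htop : Subgroup.zpowers (v : Q ⧸ Subgroup.zpowers u) = ⊤ := by
      have := congrArg (Subgroup.map (QuotientGroup.mk' (Subgroup.zpowers u))) hg
      rw [MonoidHom.map_closure, Subgroup.map_top_of_surjective _
        (QuotientGroup.mk'_surjective _), Set.image_pair, eq_comm] at this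
      rw [eq_top_iff, this, Subgroup.closure_le]
      rintro _ (rfl | rfl)
      · rw [(QuotientGroup.eq_one_iff (N := Subgroup.zpowers u) u).2
          (Subgroup.mem_zpowers u) |> fun h ↦ (h : QuotientGroup.mk' (Subgroup.zpowers u) u = 1)]
        exact one_mem _
      · exact Subgroup.mem_zpowers _
    rw [Subgroup.card_eq_card_quotient_mul_card_subgroup (Subgroup.zpowers u),
      Nat.card_zpowers, hm, ← Nat.card_congr (Subgroup.topEquiv).toEquiv, ← htop,
      Nat.card_zpowers, hn, pow_add, mul_comm]

section

variable {p : ℕ} [Fact p.Prime] {Γ : Type*} [Group Γ]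

theorem closure_pair_eq_top_of_mem {x y u v : Γ} (h : Subgroup.closure {u, v} = ⊤)
    (hu : u ∈ Subgroup.closure {x, y}) (hv : v ∈ Subgroup.closure {x, y}) :
    Subgroup.closure {x, y} = ⊤ := by
  rw [eq_top_iff, ← h, Subgroup.closure_le]
  rintro _ (rfl | rfl) <;> assumption

theorem commute_of_closure_pair {c u v : Γ} (h : Subgroup.closure {u, v} = ⊤)
    (hu : Commute c u) (hv : Commute c v) (g : Γ) : Commute c g := by
  have hg : g ∈ Subgroup.closure {u, v} := h ▸ Subgroup.mem_top g
  have : Subgroup.closure {u, v} ≤ Subgroup.centralizer {c} := by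
    rw [Subgroup.closure_le]
    rintro _ (rfl | rfl)
    · exact Subgroup.mem_centralizer_singleton_iff.2 hu.eq.symm
    · exact Subgroup.mem_centralizer_singleton_iff.2 hv.eq.symm
  exact (Subgroup.mem_centralizer_singleton_iff.1 (this hg)).symm

theorem exists_isPCPresented_of_dvd [Finite Γ] (hΓ : IsPGroup p Γ) {u v c : Γ}
    (hg : Subgroup.closure {u, v} = ⊤) (h : u * v = v * u * c) (hu : Commute c u)
    (hv : Commute c v) (hc : c ^ p = 1) [hN : (Subgroup.zpowers c).Normal]
    (huv : orderOf (v : Γ ⧸ Subgroup.zpowers c) ∣ orderOf (u : Γ ⧸ Subgroup.zpowers c)) :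
    ∃ m n e i j : ℕ, ∃ x y c : Γ, n ≤ m ∧ e ≤ 1 ∧ IsPCPresented p m n e i j x y c := by
  have hp : p.Prime := Fact.out
  let Q := Γ ⧸ Subgroup.zpowers c
  let q : Γ →* Q := QuotientGroup.mk' (Subgroup.zpowers c)
  have hq : ∀ g, q g = 1 ↔ g ∈ Subgroup.zpowers c := QuotientGroup.eq_one_iff
  have hgQ : Subgroup.closure {q u, q v} = ⊤ := by
    have := congrArg (Subgroup.map q) hg
    rwa [MonoidHom.map_closure, Subgroup.map_top_of_surjective _
        (QuotientGroup.mk'_surjective _), Set.image_pair] at this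
  have hcomm : ∀ a b : Q, a * b = b * a := by
    have huvQ : Commute (q u) (q v) := by
      have := congrArg q h
      rwa [map_mul, map_mul, map_mul, (hq c).2 (Subgroup.mem_zpowers c), mul_one] at this
    intro a b
    refine commute_of_closure_pair hgQ ?_ ?_ b
    · exact (commute_of_closure_pair hgQ (.refl _) huvQ a).symm
    · exact (commute_of_closure_pair hgQ huvQ.symm (.refl _) a).symm
  let _ : CommGroup Q := { (inferInstance : Group Q) with mul_comm := hcomm }
  obtain ⟨m, n, s, hnm, hm, hn, hcard⟩ :=
    exists_cyclic_complement (p := p) (Q := Q) (hΓ.to_quotient _) hgQ huv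
  have hpow : ∀ g : Γ, q g = 1 → ∃ i : ℕ, g = c ^ i := fun g hgc ↦ by
    obtain ⟨i, hi⟩ := mem_powers_iff_mem_zpowers.2 ((hq g).1 hgc)
    exact ⟨i, hi.symm⟩
  obtain ⟨i, hi⟩ := hpow (u ^ p ^ m) (by rw [map_pow]; exact hm)
  obtain ⟨j, hj⟩ := hpow ((v * u ^ s) ^ p ^ n) (by rw [map_pow, map_mul, map_pow]; exact hn)
  obtain ⟨e, he, hce⟩ := (Nat.dvd_prime_pow hp (m := 1)).1
    ((pow_one p).symm ▸ orderOf_dvd_of_pow_eq_one hc)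
  refine ⟨m, n, e, i, j, u, v * u ^ s, c, hnm, he, ?_, ?_, hu, hv.mul_right (hu.pow_right s),
    hce ▸ pow_orderOf_eq_one c, hi, hj, ?_⟩
  · have hu' : u ∈ Subgroup.closure {u, v * u ^ s} := Subgroup.subset_closure (by simp)
    refine closure_pair_eq_top_of_mem hg hu' ?_
    exact (Subgroup.mul_mem_cancel_right _ (pow_mem hu' s)).1 (Subgroup.subset_closure (by simp))
  · rw [← mul_assoc, h, mul_assoc, (hu.pow_right s).eq]
    simp only [mul_assoc]
    rw [← mul_assoc u, ← mul_assoc (u ^ s), ← pow_succ', ← pow_succ]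
  · rw [Subgroup.card_eq_card_quotient_mul_card_subgroup (Subgroup.zpowers c), hcard,
      Nat.card_zpowers, hce, pow_add (p : ℕ) (m + n)]

theorem exists_isPCPresented [Finite Γ] (hΓ : IsPGroup p Γ) {u v c : Γ}
    (hg : Subgroup.closure {u, v} = ⊤) (h : u * v = v * u * c) (hu : Commute c u)
    (hv : Commute c v) (hc : c ^ p = 1) :
    ∃ m n e i j : ℕ, ∃ x y c : Γ, n ≤ m ∧ e ≤ 1 ∧ IsPCPresented p m n e i j x y c := by
  have hp : p.Prime := Fact.out
  have hN : (Subgroup.zpowers c).Normal := by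
    refine ⟨fun n hn g ↦ ?_⟩
    obtain ⟨k, rfl⟩ := Subgroup.mem_zpowers_iff.1 hn
    rw [← ((commute_of_closure_pair hg hu hv g).zpow_left k).eq, mul_inv_cancel_right]
    exact hn
  obtain ⟨a, ha⟩ := IsPGroup.iff_orderOf.1 (hΓ.to_quotient (Subgroup.zpowers c))
    (u : Γ ⧸ Subgroup.zpowers c)
  obtain ⟨b, hb⟩ := IsPGroup.iff_orderOf.1 (hΓ.to_quotient (Subgroup.zpowers c))
    (v : Γ ⧸ Subgroup.zpowers c)
  rcases le_total b a with hab | hab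
  · exact exists_isPCPresented_of_dvd hΓ hg h hu hv hc (by rw [ha, hb]; exact pow_dvd_pow p hab)
  · have hz : Subgroup.zpowers c⁻¹ = Subgroup.zpowers c := Subgroup.zpowers_inv
    have hN' : (Subgroup.zpowers c⁻¹).Normal := hz ▸ hN
    refine exists_isPCPresented_of_dvd (u := v) (v := u) (c := c⁻¹) hΓ (Set.pair_comm u v ▸ hg)
      ?_ hv.inv_left hu.inv_left (by simp [hc]) ?_
    · rw [h, mul_inv_cancel_right]
    · have key : ∀ (K : Subgroup Γ) [K.Normal], K = Subgroup.zpowers c →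
          orderOf (u : Γ ⧸ K) ∣ orderOf (v : Γ ⧸ K) := by
        rintro K _ rfl
        rw [ha, hb]; exact pow_dvd_pow p hab
      exact key _ hz

end

namespace IsPCPresented

variable {p m n e i j : ℕ} {Γ : Type*} [Group Γ] {x y c : Γ}

theorem congr_exponents (h : IsPCPresented p m n e i j x y c) {i' j' : ℕ} (hi : c ^ i = c ^ i')
    (hj : c ^ j = c ^ j') : IsPCPresented p m n e i' j' x y c :=
  { h with x_pow := h.x_pow.trans hi, y_pow := h.y_pow.trans hj }

theorem swap (hp : p.Prime) (h : IsPCPresented p m m e i j x y c) (he : e = 1) :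
    IsPCPresented p m m e ((p - 1) * j) ((p - 1) * i) y x c⁻¹ where
  gen := Set.pair_comm x y ▸ h.gen
  comm := by rw [h.comm, mul_inv_cancel_right]
  comm_x := h.comm_y.inv_left
  comm_y := h.comm_x.inv_left
  c_pow := by rw [inv_pow, h.c_pow, inv_one]
  x_pow := by
    have hc := h.c_pow
    rw [he, pow_one] at hc
    rw [h.y_pow, pow_mul, inv_pow, eq_comm]
    congr 1
    rw [inv_eq_iff_mul_eq_one, ← pow_succ, Nat.sub_add_cancel hp.one_le, hc]
  y_pow := by
    have hc := h.c_pow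
    rw [he, pow_one] at hc
    rw [h.x_pow, pow_mul, inv_pow, eq_comm]
    congr 1
    rw [inv_eq_iff_mul_eq_one, ← pow_succ, Nat.sub_add_cancel hp.one_le, hc]
  card := h.card

theorem isPGroup (hp : p.Prime) (h : IsPCPresented p m n e i j x y c) : IsPGroup p Γ :=
  have := Fact.mk hp
  IsPGroup.of_card h.card

theorem mem_zpowers_pow (hp : p.Prime) (h : IsPCPresented p m n e i j x y c) {t : ℕ}
    (ht : p.Coprime t) (g : Γ) : g ∈ Subgroup.zpowers (g ^ t) := by
  have := Fact.mk hp
  obtain ⟨k, hk⟩ := IsPGroup.iff_orderOf.1 (h.isPGroup hp) g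
  obtain ⟨w, hw⟩ := exists_pow_eq_self_of_coprime (x := g) (n := t)
    (by rw [hk]; exact (Nat.Coprime.pow_left k ht).symm)
  exact Subgroup.mem_zpowers_iff.2 ⟨w, by exact_mod_cast hw⟩

theorem rescale_right (hp : p.Prime) (h : IsPCPresented p m n e i j x y c) (hi : p.Coprime i) :
    IsPCPresented p m n e 1 j x (y ^ i) (c ^ i) where
  gen := closure_pair_eq_top_of_mem h.gen (Subgroup.subset_closure (by simp)) <|
    (Subgroup.zpowers_le.2 (Subgroup.subset_closure (by simp))) (h.mem_zpowers_pow hp hi y)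
  comm := by
    have := pow_mul_comm_of_comm h.comm h.comm_x h.comm_y 1 i
    simpa using this
  comm_x := h.comm_x.pow_left i
  comm_y := h.comm_y.pow_pow i i
  c_pow := by rw [← pow_mul, mul_comm, pow_mul, h.c_pow, one_pow]
  x_pow := by rw [h.x_pow, pow_one]
  y_pow := by rw [← pow_mul, mul_comm, pow_mul, h.y_pow, ← pow_mul, ← pow_mul, mul_comm]
  card := h.card

theorem rescale_left (hp : p.Prime) (h : IsPCPresented p m n e i j x y c) (hj : p.Coprime j) :
    IsPCPresented p m n e i 1 (x ^ j) y (c ^ j) where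
  gen := closure_pair_eq_top_of_mem h.gen
    ((Subgroup.zpowers_le.2 (Subgroup.subset_closure (by simp))) (h.mem_zpowers_pow hp hj x))
    (Subgroup.subset_closure (by simp))
  comm := by
    have := pow_mul_comm_of_comm h.comm h.comm_x h.comm_y j 1
    simpa using this
  comm_x := h.comm_x.pow_pow j j
  comm_y := h.comm_y.pow_left j
  c_pow := by rw [← pow_mul, mul_comm, pow_mul, h.c_pow, one_pow]
  x_pow := by rw [← pow_mul, mul_comm, pow_mul, h.x_pow, ← pow_mul, ← pow_mul, mul_comm]
  y_pow := by rw [h.y_pow, pow_one]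
  card := h.card

theorem shear (h : IsPCPresented p m n 1 1 j x y c) (hp : p.Prime) (hnm : n ≤ m)
    (hd : p ∣ (p ^ n).choose 2 * p ^ (m - n)) :
    ∃ y', IsPCPresented p m n 1 1 0 x y' c := by
  have hc := h.c_pow
  rw [pow_one] at hc
  set s := (p - 1) * j * p ^ (m - n)
  have hx : x ∈ Subgroup.closure {x, y * x ^ s} := Subgroup.subset_closure (by simp)
  refine ⟨y * x ^ s, ?_, ?_, h.comm_x, h.comm_y.mul_right (h.comm_x.pow_right s), h.c_pow,
    h.x_pow, ?_, h.card⟩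
  · refine closure_pair_eq_top_of_mem h.gen hx ?_
    exact (Subgroup.mul_mem_cancel_right _ (pow_mem hx s)).1 (Subgroup.subset_closure (by simp))
  · rw [← mul_assoc, h.comm, mul_assoc, (h.comm_x.pow_right s).eq]
    simp only [mul_assoc]
    rw [← mul_assoc x, ← mul_assoc (x ^ s), ← pow_succ', ← pow_succ]
  · have := collected_pow h.comm h.comm_x h.comm_y 1 s 0 (p ^ n)
    simp only [pow_one, pow_zero, mul_one, mul_zero, zero_add] at this
    obtain ⟨w, hw⟩ := hd
    have h1 : (p ^ n).choose 2 * s = p * (w * ((p - 1) * j)) := by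
      calc _ = ((p ^ n).choose 2 * p ^ (m - n)) * ((p - 1) * j) := by simp only [s]; ring
        _ = _ := by rw [hw]; ring
    have h2 : p ^ n * s = p ^ m * ((p - 1) * j) := by
      conv_rhs => rw [← Nat.add_sub_cancel' hnm, pow_add]
      simp only [s]; ring
    rw [this, h1, pow_mul c, hc, one_pow, mul_one, h.y_pow, h2, pow_mul x, h.x_pow, pow_one,
      ← pow_add, pow_zero]
    have : j + (p - 1) * j = p * j := by
      obtain ⟨w, rfl⟩ := Nat.exists_eq_add_of_le hp.one_le
      simp; ring
    rw [this, pow_mul, hc, one_pow]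

theorem c_ne_one (hp : p.Prime) (h : IsPCPresented p m n 1 i j x y c) : c ≠ 1 := by
  intro hc
  have := h.finite hp.pos
  have h1 := Nat.card_le_card_of_surjective _ (exists_reduced (e := 0) hp.pos h.gen h.comm
    h.comm_x h.comm_y (by simp [hc]) h.x_pow h.y_pow)
  rw [h.card] at h1
  simp only [Nat.card_prod, Nat.card_fin, pow_zero, mul_one, ← pow_add] at h1
  have := (Nat.pow_le_pow_iff_right hp.one_lt).1 h1
  omega

theorem n_pos (hp : p.Prime) (h : IsPCPresented p m n 1 i j x y c) : 0 < n := by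
  rcases Nat.eq_zero_or_pos n with rfl | hn
  · refine absurd ?_ (h.c_ne_one hp)
    have hy := h.y_pow
    rw [pow_zero, pow_one] at hy
    have h1 := h.comm
    have h2 : x * y = y * x := by rw [hy]; exact (h.comm_x.pow_left j).eq.symm
    rw [h2] at h1
    exact mul_eq_left.1 h1.symm
  · exact hn

end IsPCPresented

/-- The parameters of a normalized presentation. -/
def IsNormalized (p m n e i j : ℕ) : Prop :=
  n ≤ m ∧ (e = 0 ∧ i = 0 ∧ j = 0 ∨ e = 1 ∧ 0 < n ∧ (i = 0 ∧ j = 0 ∨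
    i = 1 ∧ j = 0 ∧ ¬(p = 2 ∧ m = 1) ∨ i = 0 ∧ j = 1 ∧ n < m ∨
    i = 1 ∧ j = 1 ∧ p = 2 ∧ m = 1 ∧ n = 1))

theorem dvd_choose_two_of {p n : ℕ} (hp : p.Prime) (hn : 0 < n) (h : ¬(p = 2 ∧ n = 1)) :
    p ∣ (p ^ n).choose 2 := by
  by_cases h2 : p = 2
  · subst h2
    obtain ⟨k, rfl⟩ : ∃ k, n = k + 2 := ⟨n - 2, by omega⟩
    rw [Nat.choose_two_right, pow_succ, mul_comm _ 2, mul_assoc,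
      Nat.mul_div_cancel_left _ (by norm_num), pow_succ, mul_assoc]
    exact (dvd_mul_right 2 _).mul_left _
  · have h1 := hp.odd_of_ne_two h2
    have h3 : 2 * (p ^ n).choose 2 = p ^ n * (p ^ n - 1) := by
      rw [Nat.choose_two_right, Nat.mul_div_cancel' (Nat.even_mul_pred_self _).two_dvd]
    have h4 : p ∣ 2 * (p ^ n).choose 2 := h3 ▸ (dvd_pow_self p hn.ne').mul_right _
    exact ((Nat.coprime_primes hp Nat.prime_two).2 h2).dvd_of_dvd_mul_left h4

theorem IsPCPresented.exists_isNormalized {p m n e i j : ℕ} {Γ : Type*} [Group Γ] {x y c : Γ}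
    (hp : p.Prime) (hnm : n ≤ m) (he : e ≤ 1) (h : IsPCPresented p m n e i j x y c) :
    ∃ i' j' x' y' c', IsNormalized p m n e i' j' ∧
      IsPCPresented (Γ := Γ) p m n e i' j' x' y' c' := by
  obtain rfl | rfl : e = 0 ∨ e = 1 := by omega
  · have hc := h.c_pow
    rw [pow_zero, pow_one] at hc
    exact ⟨0, 0, x, y, c, ⟨hnm, .inl ⟨rfl, rfl, rfl⟩⟩, h.congr_exponents (by simp [hc])
      (by simp [hc])⟩
  have hc := h.c_pow
  rw [pow_one] at hc
  have hn := h.n_pos hp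
  have hzero : ∀ {k : ℕ}, ¬ p.Coprime k → ∀ {c : Γ}, c ^ p = 1 → c ^ k = c ^ 0 := by
    intro k hk c hc
    obtain ⟨w, rfl⟩ := (not_not.1 (mt hp.coprime_iff_not_dvd.2 hk))
    rw [pow_mul, hc, one_pow, pow_zero]
  -- the case of nontrivial `i`
  have main : ∀ {i j : ℕ} {x y c : Γ}, p.Coprime i → IsPCPresented p m n 1 i j x y c →
      ∃ i' j' x' y' c', IsNormalized p m n 1 i' j' ∧
        IsPCPresented (Γ := Γ) p m n 1 i' j' x' y' c' := by
    intro i j x y c hi h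
    have h := h.rescale_right hp hi
    by_cases h2 : p = 2 ∧ m = 1
    · obtain ⟨rfl, rfl⟩ := h2
      obtain rfl : n = 1 := by omega
      by_cases hj : Nat.Coprime 2 j
      · exact ⟨1, 1, _, _, _, ⟨hnm, .inr ⟨rfl, hn, .inr (.inr (.inr (by simp)))⟩⟩,
          h.rescale_left hp hj⟩
      · have hc := h.c_pow
        rw [pow_one] at hc
        have h := h.congr_exponents rfl (hzero hj hc)
        generalize y ^ i = y at *
        generalize c ^ i = c at *
        refine ⟨0, 0, x * y, y, c, ⟨hnm, .inr ⟨rfl, hn, .inl ⟨rfl, rfl⟩⟩⟩, ?_, ?_,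
          h.comm_x.mul_right h.comm_y, h.comm_y, h.c_pow, ?_, h.y_pow, h.card⟩
        · have hy : y ∈ Subgroup.closure {x * y, y} := Subgroup.subset_closure (by simp)
          refine closure_pair_eq_top_of_mem h.gen ?_ hy
          exact (Subgroup.mul_mem_cancel_right _ (hy)).1 (Subgroup.subset_closure (by simp))
        · rw [h.comm, mul_assoc, h.comm_y.eq, ← mul_assoc, mul_assoc y x y, h.comm]
        · have h1 := collected_pow h.comm h.comm_x h.comm_y 1 1 1 2
          have h2 := h.x_pow
          have h3 := h.y_pow
          simp only [pow_one, pow_zero] at h1 h2 h3 ⊢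
          rw [h.comm, h1]
          simp only [mul_one, h3, h2, Nat.choose_self, one_mul, ← pow_succ']
          rw [show 2 + 1 + 1 = 2 * 2 from rfl, pow_mul, hc, one_pow]
    · obtain ⟨y', h'⟩ := h.shear hp hnm (by
        rcases hnm.lt_or_eq with hlt | rfl
        · exact (dvd_pow_self p (by omega)).mul_left _
        · exact (dvd_choose_two_of hp hn h2).mul_right _)
      exact ⟨1, 0, _, _, _, ⟨hnm, .inr ⟨rfl, hn, .inr (.inl ⟨rfl, rfl, h2⟩)⟩⟩, h'⟩
  by_cases hi : p.Coprime i
  · exact main hi h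
  have h := h.congr_exponents (hzero hi hc) rfl
  by_cases hj : p.Coprime j
  · rcases hnm.lt_or_eq with hlt | rfl
    · exact ⟨0, 1, _, _, _, ⟨hnm, .inr ⟨rfl, hn, .inr (.inr (.inl ⟨rfl, rfl, hlt⟩))⟩⟩,
        h.rescale_left hp hj⟩
    · refine main ?_ (h.swap hp rfl)
      refine Nat.Coprime.mul_right ?_ hj
      exact (Nat.coprime_self_sub_right hp.one_le).2 (Nat.coprime_one_right p)
  · exact ⟨0, 0, x, y, c, ⟨hnm, .inr ⟨rfl, hn, .inl ⟨rfl, rfl⟩⟩⟩,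
      h.congr_exponents rfl (hzero hj hc)⟩

section FrobeniusAdditivity

variable {R : Type*} [Ring R]

theorem mul_pow_of_commutator_central {x y k : R} (hk : y * x = x * y + k)
    (hc : ∀ z, Commute k z) (hkk : k * k = 0) (n : ℕ) :
    (x * y) ^ (n + 1) = x ^ (n + 1) * y ^ (n + 1) + ((n + 1).choose 2 : R) * k * x ^ n * y ^ n := by
  have h1 : ∀ n : ℕ, y ^ (n + 1) * x = x * y ^ (n + 1) + ((n + 1 : ℕ) : R) * k * y ^ n := by
    intro n
    induction n with
    | zero => simp [hk]
    | succ n ih =>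
      calc y ^ (n + 1 + 1) * x = y * (y ^ (n + 1) * x) := by rw [pow_succ' y (n + 1), mul_assoc]
        _ = (y * x) * y ^ (n + 1) + ((n + 1 : ℕ) : R) * (y * k) * y ^ n := by
          rw [ih, mul_add, ← mul_assoc, ← mul_assoc, ← mul_assoc, ← (Nat.cast_commute _ y).eq]
          simp only [mul_assoc]
        _ = _ := by
          rw [hk, (hc y).eq.symm, mul_assoc _ (k * y), mul_assoc k y, ← pow_succ' y n]
          push_cast
          rw [pow_succ' y (n + 1)]
          noncomm_ring
  induction n with
  | zero => simp
  | succ n ih =>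
    have e : (n + 1 + 1).choose 2 = (n + 1) + (n + 1).choose 2 := by
      rw [Nat.choose_succ_succ' (n + 1) 1, Nat.choose_one_right]
    have h2 : k * (y ^ n * x) = k * (x * y ^ n) := by
      cases n with
      | zero => simp
      | succ n =>
        rw [h1, mul_add, ← mul_assoc k (_ * k), ← mul_assoc k _ k, ← (Nat.cast_commute _ k).eq,
          mul_assoc _ k k, hkk]
        simp
    have h3 : ((n + 1).choose 2 : R) * k * x ^ n * y ^ n * (x * y)
        = ((n + 1).choose 2 : R) * k * x ^ (n + 1) * y ^ (n + 1) := by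
      have : k * x ^ n * (y ^ n * x) = k * x ^ n * (x * y ^ n) := by
        rw [((hc (x ^ n)).eq), mul_assoc, h2, ← mul_assoc]
      calc _ = ((n + 1).choose 2 : R) * (k * x ^ n * (y ^ n * x)) * y := by simp only [mul_assoc]
        _ = _ := by rw [this, pow_succ, pow_succ]; simp only [mul_assoc]
    rw [pow_succ (x * y), ih, add_mul, h3, e]
    have h4 : x ^ (n + 1) * y ^ (n + 1) * (x * y) = x ^ (n + 1 + 1) * y ^ (n + 1 + 1)
        + ((n + 1 : ℕ) : R) * k * x ^ (n + 1) * y ^ (n + 1) := by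
      calc _ = x ^ (n + 1) * (y ^ (n + 1) * x) * y := by simp only [mul_assoc]
        _ = x ^ (n + 1) * x * (y ^ (n + 1) * y)
            + x ^ (n + 1) * (((n + 1 : ℕ) : R) * k) * (y ^ n * y) := by
          rw [h1, mul_add, add_mul]; simp only [mul_assoc]
        _ = _ := by
          rw [← pow_succ, ← pow_succ, ← pow_succ,
            ((Nat.cast_commute (n + 1) (x ^ (n + 1))).mul_left (hc _)).eq]
    rw [h4]
    push_cast
    simp only [add_mul]
    abel

/-- If commutators are multiples of a central element of square zero, then the `p ^ k`-th power
map is additive on sums with a unit summand, provided that `p` divides `(p ^ k).choose 2`. -/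
theorem add_unit_pow_of_sq_zero (p k : ℕ) [Fact p.Prime] [CharP R p] {v : R}
    (hv : ∀ z, Commute v z) (hvv : v * v = 0) (hcomm : ∀ a b : R, ∃ d, a * b - b * a = v * d)
    (hp : p ∣ (p ^ k).choose 2) (a : R) (b : Rˣ) :
    (a + b) ^ p ^ k = a ^ p ^ k + (b : R) ^ p ^ k := by
  have hmul : ∀ x y : R, (x * y) ^ p ^ k = x ^ p ^ k * y ^ p ^ k := by
    intro x y
    obtain ⟨d, hd⟩ := hcomm y x
    have hz : ∀ z, Commute (v * d) z := by
      intro z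
      obtain ⟨f, hf⟩ := hcomm d z
      rw [Commute, SemiconjBy, ← sub_eq_zero]
      calc v * d * z - z * (v * d) = v * (d * z - z * d) := by
            rw [← mul_assoc z, ← (hv z).eq]; noncomm_ring
        _ = 0 := by rw [hf, ← mul_assoc, hvv, zero_mul]
    have hkk : (v * d) * (v * d) = 0 := by
      rw [← mul_assoc, mul_assoc v, ← (hv d).eq, ← mul_assoc, hvv, zero_mul, zero_mul]
    obtain ⟨N, hN⟩ := Nat.exists_eq_succ_of_ne_zero (pow_ne_zero k (Fact.out : p.Prime).ne_zero)
    have := mul_pow_of_commutator_central (x := x) (y := y) (k := v * d)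
      (by rw [← hd]; abel) hz hkk N
    rw [Nat.succ_eq_add_one] at hN
    rw [← hN, (CharP.cast_eq_zero_iff R p _).2 hp] at this
    simpa using this
  have h1 : a + b = (a * ↑b⁻¹ + 1) * b := by simp [add_mul]
  rw [h1, hmul, add_pow_char_pow_of_commute p k (Commute.one_right _), one_pow, add_mul, one_mul,
    ← hmul, Units.inv_mul_cancel_right]

end FrobeniusAdditivity

section Functional

variable {F : Type*} [Field F] {Γ : Type*} [Group Γ]

/-- The augmentation of a group algebra. -/
noncomputable def augmentation (F Γ : Type*) [Field F] [Group Γ] : MonoidAlgebra F Γ →ₐ[F] F :=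
  MonoidAlgebra.lift F F Γ 1

@[simp] theorem augmentation_single (g : Γ) (r : F) :
    augmentation F Γ (MonoidAlgebra.single g r) = r := by
  simp [augmentation, MonoidAlgebra.lift_single]

/-- The linear functional on a group algebra extending a function on the group. -/
noncomputable def functional (W : Γ → F) : MonoidAlgebra F Γ →ₗ[F] F :=
  (MonoidAlgebra.basis Γ F).constr F W

@[simp] theorem functional_single (W : Γ → F) (g : Γ) (r : F) :
    functional W (MonoidAlgebra.single g r) = r * W g := by
  have h : MonoidAlgebra.single g r = r • MonoidAlgebra.basis Γ F g := by simp
  rw [h, map_smul, functional, Module.Basis.constr_basis, smul_eq_mul]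

theorem eq_of_add_single {M : Type*} [AddCommMonoid M] {P : MonoidAlgebra F Γ → M}
    (Q : MonoidAlgebra F Γ →+ M) (h0 : P 0 = 0)
    (hadd : ∀ a g r, r ≠ 0 → P (a + MonoidAlgebra.single g r) = P a + P (MonoidAlgebra.single g r))
    (hs : ∀ g r, P (MonoidAlgebra.single g r) = Q (MonoidAlgebra.single g r))
    (a : MonoidAlgebra F Γ) : P a = Q a := by
  induction a using MonoidAlgebra.induction with
  | zero => simp [h0]
  | single_add g r a _ hr ih => rw [add_comm, hadd a g r hr, map_add, ih, hs]

end Functional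

section CentralElement

variable {A : Type*} [Ring A] (p : ℕ) [Fact p.Prime] [CharP A p] {u : A}

theorem isTwoSided_span_of_central (hu : ∀ z, Commute u z) : (Ideal.span {u}).IsTwoSided := by
  refine ⟨fun {a} b ha ↦ ?_⟩
  obtain ⟨d, rfl⟩ := Ideal.mem_span_singleton'.1 ha
  exact Ideal.mem_span_singleton'.2 ⟨d * b, by rw [mul_assoc, mul_assoc, (hu b).eq]⟩

theorem charP_quotient_of_ne_top {I : Ideal A} [I.IsTwoSided] (hI : I ≠ ⊤) : CharP (A ⧸ I) p := by
  have : Nontrivial (A ⧸ I) := Ideal.Quotient.nontrivial_iff.2 hI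
  refine (CharP.charP_iff_prime_eq_zero Fact.out).2 ?_
  rw [← map_natCast (Ideal.Quotient.mk I), CharP.cast_eq_zero, map_zero]

theorem add_pow_sub_mem_span (hu : ∀ z, Commute u z)
    (hcomm : ∀ a b : A, ∃ d, a * b - b * a = u * d) (k : ℕ) (a b : A) :
    (a + b) ^ p ^ k - (a ^ p ^ k + b ^ p ^ k) ∈ Ideal.span {u} := by
  have := isTwoSided_span_of_central hu
  by_cases hI : Ideal.span {u} = ⊤
  · simp [hI]
  have := charP_quotient_of_ne_top p hI
  rw [← Ideal.Quotient.eq]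
  simp only [map_add, map_pow]
  refine add_pow_char_pow_of_commute p k ?_
  rw [Commute, SemiconjBy, ← map_mul, ← map_mul, Ideal.Quotient.eq]
  obtain ⟨d, hd⟩ := hcomm a b
  exact Ideal.mem_span_singleton'.2 ⟨d, by rw [hd, (hu d).eq]⟩

theorem add_unit_pow_sub_mem_span_sq (hu : ∀ z, Commute u z)
    (hcomm : ∀ a b : A, ∃ d, a * b - b * a = u * d) {k : ℕ} (hp : p ∣ (p ^ k).choose 2)
    (a : A) (b : Aˣ) :
    (a + b) ^ p ^ k - (a ^ p ^ k + (b : A) ^ p ^ k) ∈ Ideal.span {u ^ 2} := by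
  have := isTwoSided_span_of_central fun z ↦ (hu z).pow_left 2
  by_cases hI : Ideal.span {u ^ 2} = ⊤
  · simp [hI]
  have := charP_quotient_of_ne_top p hI
  rw [← Ideal.Quotient.eq]
  set q := Ideal.Quotient.mk (Ideal.span {u ^ 2})
  have := add_unit_pow_of_sq_zero p k (v := q u)
    (fun z ↦ by
      obtain ⟨z, rfl⟩ := Ideal.Quotient.mk_surjective z
      exact (hu z).map q)
    (by
      rw [← map_mul, ← pow_two]
      exact Ideal.Quotient.eq_zero_iff_mem.2 (Ideal.mem_span_singleton_self _))
    (fun a b ↦ by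
      obtain ⟨a, rfl⟩ := Ideal.Quotient.mk_surjective a
      obtain ⟨b, rfl⟩ := Ideal.Quotient.mk_surjective b
      obtain ⟨d, hd⟩ := hcomm a b
      exact ⟨q d, by simp only [q, ← map_mul, ← map_sub, hd]⟩)
    hp (q a) (Units.map q b)
  simpa using this

end CentralElement

namespace IsPCPresented

variable {p m n e i j : ℕ} {Γ : Type*} [Group Γ] {x y c : Γ}

theorem exists_normalForm (hp : 0 < p) (h : IsPCPresented p m n e i j x y c) :
    ∃ R S T : Γ → ℕ, (∀ g, g = y ^ S g * x ^ R g * c ^ T g) ∧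
      ∀ b a k, R (y ^ b * x ^ a * c ^ k) = a % p ^ m ∧ S (y ^ b * x ^ a * c ^ k) = b % p ^ n ∧
        T (y ^ b * x ^ a * c ^ k) = (k + i * (a / p ^ m) + j * (b / p ^ n)) % p ^ e := by
  set f := Equiv.ofBijective _ (h.reduced_bijective hp)
  refine ⟨fun g ↦ (f.symm g).2.1, fun g ↦ (f.symm g).1, fun g ↦ (f.symm g).2.2,
    fun g ↦ (f.apply_symm_apply g).symm, fun b a k ↦ ?_⟩
  have key : y ^ b * x ^ a * c ^ k = f (⟨b % p ^ n, Nat.mod_lt _ (pow_pos hp n)⟩,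
      ⟨a % p ^ m, Nat.mod_lt _ (pow_pos hp m)⟩,
      ⟨(k + i * (a / p ^ m) + j * (b / p ^ n)) % p ^ e, Nat.mod_lt _ (pow_pos hp e)⟩) := by
    change _ = y ^ (b % p ^ n) * x ^ (a % p ^ m)
      * c ^ ((k + i * (a / p ^ m) + j * (b / p ^ n)) % p ^ e)
    conv_lhs => rw [← Nat.mod_add_div a (p ^ m), ← Nat.mod_add_div b (p ^ n)]
    rw [pow_add x, pow_add y, pow_mul x, pow_mul y, h.x_pow, h.y_pow, ← pow_eq_pow_mod _ h.c_pow,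
      ← pow_mul, ← pow_mul]
    rw [mul_assoc (y ^ _) (c ^ _), ← mul_assoc (c ^ _),
      ((h.comm_x.pow_pow (j * (b / p ^ n)) (a % p ^ m))).eq, pow_add, pow_add]
    simp only [mul_assoc]
    congr 2
    simp only [← pow_add]
    congr 1
    ring
  rw [key]
  simp only [Equiv.symm_apply_apply]
  simp

theorem commute_c (h : IsPCPresented p m n e i j x y c) (g : Γ) : Commute c g :=
  commute_of_closure_pair h.gen h.comm_x h.comm_y g

theorem c_pow_p (h : IsPCPresented p m n e i j x y c) (he : e ≤ 1) : c ^ p = 1 := by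
  have := h.c_pow
  interval_cases e <;> simp_all

theorem exists_commutator (hp : 0 < p) (h : IsPCPresented p m n e i j x y c) (g k : Γ) :
    ∃ l : ℕ, g * k = c ^ l * (k * g) := by
  have := h.finite hp
  obtain ⟨b, a, t, rfl⟩ := exists_collected h.gen h.comm h.comm_x h.comm_y g
  obtain ⟨b', a', t', rfl⟩ := exists_collected h.gen h.comm h.comm_x h.comm_y k
  refine ⟨a * b' + (p ^ e - 1) * (a' * b), ?_⟩
  rw [((h.commute_c _).pow_left _).eq, collected_mul h.comm h.comm_x h.comm_y,
    collected_mul h.comm h.comm_x h.comm_y, add_comm b b', add_comm a a', mul_assoc (_ * _) (c ^ _)]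
  congr 1
  rw [← pow_add]
  obtain ⟨N, hN⟩ := Nat.exists_eq_succ_of_ne_zero (pow_pos hp e).ne'
  have : t' + t + a' * b + (a * b' + (p ^ e - 1) * (a' * b))
      = (t + t' + a * b') + p ^ e * (a' * b) := by
    rw [hN]; simp; ring
  rw [this, pow_add c _ (p ^ e * _), pow_mul, h.c_pow, one_pow, mul_one]

end IsPCPresented

/-- The element `c - 1` of a group algebra. -/
noncomputable def subOne (F : Type*) [Field F] {Γ : Type*} [Group Γ] (c : Γ) : MonoidAlgebra F Γ :=
  MonoidAlgebra.single c 1 - 1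

section SubOne

variable {F : Type*} [Field F] {Γ : Type*} [Group Γ] {c : Γ}

theorem subOne_commute (hc : ∀ g, Commute c g) (a : MonoidAlgebra F Γ) :
    Commute (subOne F c) a := by
  refine Commute.sub_left ?_ (Commute.one_left a)
  induction a using MonoidAlgebra.induction_linear with
  | zero => exact Commute.zero_right _
  | add a b ha hb => exact ha.add_right hb
  | single g r => simp [Commute, SemiconjBy, MonoidAlgebra.single_mul_single, (hc g).eq]

theorem charP_monoidAlgebra (p : ℕ) [CharP F p] : CharP (MonoidAlgebra F Γ) p :=
  charP_of_injective_algebraMap (algebraMap F (MonoidAlgebra F Γ)).injective p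

theorem subOne_pow (p : ℕ) [Fact p.Prime] [CharP F p] (k : ℕ) :
    (subOne F c) ^ p ^ k = subOne F (c ^ p ^ k) := by
  have : CharP (MonoidAlgebra F Γ) p := charP_monoidAlgebra p
  rw [subOne, subOne, sub_pow_char_pow_of_commute p k (Commute.one_right _), one_pow,
    MonoidAlgebra.single_pow, one_pow]

theorem exists_subOne_pow (l : ℕ) :
    ∃ d, subOne F (c ^ l) = subOne F c * d := by
  have : subOne F (c ^ l) = MonoidAlgebra.single c 1 ^ l - 1 ^ l := by
    simp [subOne, MonoidAlgebra.single_pow]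
  rw [this]
  exact ⟨_, ((Commute.one_right _).mul_geom_sum₂ l).symm⟩

theorem exists_sub_eq_subOne_mul
    (h : ∀ g k, ∃ l : ℕ, g * k = c ^ l * (k * g)) (a b : MonoidAlgebra F Γ) :
    ∃ d, a * b - b * a = subOne F c * d := by
  induction a using MonoidAlgebra.induction_linear with
  | zero => exact ⟨0, by simp⟩
  | add a a' ha ha' =>
    obtain ⟨d, hd⟩ := ha
    obtain ⟨d', hd'⟩ := ha'
    exact ⟨d + d', by rw [mul_add (subOne F c), ← hd, ← hd']; noncomm_ring⟩
  | single g r =>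
    induction b using MonoidAlgebra.induction_linear with
    | zero => exact ⟨0, by simp⟩
    | add a a' ha ha' =>
      obtain ⟨d, hd⟩ := ha
      obtain ⟨d', hd'⟩ := ha'
      exact ⟨d + d', by rw [mul_add (subOne F c), ← hd, ← hd']; noncomm_ring⟩
    | single k s =>
      obtain ⟨l, hl⟩ := h g k
      obtain ⟨d, hd⟩ := exists_subOne_pow (F := F) (c := c) l
      refine ⟨d * MonoidAlgebra.single (k * g) (s * r), ?_⟩
      rw [← mul_assoc, ← hd, subOne, sub_mul, one_mul, MonoidAlgebra.single_mul_single,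
        MonoidAlgebra.single_mul_single, MonoidAlgebra.single_mul_single, hl, one_mul, mul_comm r]

end SubOne

section Frobenius

variable {F : Type*} [Field F] {Γ : Type*} [Group Γ] {c : Γ}

theorem augmentation_subOne (g : Γ) : augmentation F Γ (subOne F g) = 0 := by simp [subOne]

theorem functional_mul_subOne (W : Γ → F) (d : MonoidAlgebra F Γ) :
    functional W (d * subOne F c) = functional (fun g ↦ W (g * c) - W g) d := by
  induction d using MonoidAlgebra.induction_linear with
  | zero => simp
  | add a b ha hb => rw [add_mul, map_add, map_add, ha, hb]
  | single g r => simp [subOne, mul_sub, MonoidAlgebra.single_mul_single]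

theorem functional_eq_zero_of_mem_span {W : Γ → F} (hW : ∀ g, W (g * c) = W g)
    {a : MonoidAlgebra F Γ} (ha : a ∈ Ideal.span {subOne F c}) : functional W a = 0 := by
  obtain ⟨d, rfl⟩ := Ideal.mem_span_singleton'.1 ha
  rw [functional_mul_subOne]
  simp only [hW, sub_self]
  exact congrArg (· d) ((MonoidAlgebra.basis Γ F).ext fun g ↦ by simp : functional 0 = 0)

theorem functional_eq_zero_of_mem_span_sq {W : Γ → F}
    (hW : ∀ g, W (g * c * c) - W (g * c) = W (g * c) - W g)
    {a : MonoidAlgebra F Γ} (ha : a ∈ Ideal.span {subOne F c ^ 2}) : functional W a = 0 := by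
  obtain ⟨d, rfl⟩ := Ideal.mem_span_singleton'.1 ha
  rw [pow_two, ← mul_assoc, functional_mul_subOne]
  exact functional_eq_zero_of_mem_span hW (Ideal.mem_span_singleton'.2 ⟨d, rfl⟩)

theorem functional_pow (p k : ℕ) [Fact p.Prime] [CharP F p] {I : Ideal (MonoidAlgebra F Γ)}
    (hI : ∀ a g r, r ≠ 0 → (a + MonoidAlgebra.single g r) ^ p ^ k
      - (a ^ p ^ k + MonoidAlgebra.single g r ^ p ^ k) ∈ I)
    {W μ : Γ → F} (hW : ∀ a ∈ I, functional W a = 0) (hμ : ∀ g, W (g ^ p ^ k) = μ g ^ p ^ k)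
    (a : MonoidAlgebra F Γ) : functional W (a ^ p ^ k) = functional μ a ^ p ^ k := by
  have hp : p ^ k ≠ 0 := pow_ne_zero k (Fact.out : p.Prime).ne_zero
  refine eq_of_add_single (P := fun a ↦ functional W (a ^ p ^ k))
    ((iterateFrobenius F p k).toAddMonoidHom.comp (functional μ).toAddMonoidHom)
    (by rw [zero_pow hp, map_zero]) (fun a g r hr ↦ ?_) (fun g r ↦ ?_) a
  · simpa [sub_eq_zero] using hW _ (hI a g r hr)
  · simp [MonoidAlgebra.single_pow, hμ, iterateFrobenius_def, mul_pow]

theorem pow_sub_algebraMap_mem (p k : ℕ) [Fact p.Prime] [CharP F p]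
    {I : Ideal (MonoidAlgebra F Γ)}
    (hI : ∀ a g r, r ≠ 0 → (a + MonoidAlgebra.single g r) ^ p ^ k
      - (a ^ p ^ k + MonoidAlgebra.single g r ^ p ^ k) ∈ I)
    (hg : ∀ g : Γ, MonoidAlgebra.single (g ^ p ^ k) 1 - 1 ∈ I) (a : MonoidAlgebra F Γ) :
    a ^ p ^ k - algebraMap F _ (augmentation F Γ a ^ p ^ k) ∈ I := by
  have hp : p ^ k ≠ 0 := pow_ne_zero k (Fact.out : p.Prime).ne_zero
  induction a using MonoidAlgebra.induction with
  | zero => simp only [map_zero, zero_pow hp, sub_zero, I.zero_mem]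
  | single_add g r a _ hr ih =>
    have h := I.mul_mem_left (algebraMap F _ (r ^ p ^ k)) (hg g)
    have h' := I.add_mem (I.add_mem (hI a g r hr) ih) h
    convert h' using 1
    have e : algebraMap F (MonoidAlgebra F Γ) (r ^ p ^ k) * MonoidAlgebra.single (g ^ p ^ k) 1
        = MonoidAlgebra.single g r ^ p ^ k := by
      rw [MonoidAlgebra.single_pow, ← Algebra.smul_def, MonoidAlgebra.smul_single, smul_eq_mul,
        mul_one]
    rw [map_add, augmentation_single, add_pow_char_pow, map_add, mul_sub, e, mul_one,
      add_comm (MonoidAlgebra.single g r)]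
    abel

theorem exists_units_single (g : Γ) {r : F} (hr : r ≠ 0) :
    ∃ b : (MonoidAlgebra F Γ)ˣ, (b : MonoidAlgebra F Γ) = MonoidAlgebra.single g r :=
  ⟨⟨MonoidAlgebra.single g r, MonoidAlgebra.single g⁻¹ r⁻¹,
    by simp [MonoidAlgebra.single_mul_single, hr, MonoidAlgebra.one_def],
    by simp [MonoidAlgebra.single_mul_single, hr, MonoidAlgebra.one_def]⟩, rfl⟩

end Frobenius

/-- `a ^ (p ^ k)` is a multiple of `u ^ s` for every `a` in the augmentation ideal, where
`u = c - 1`. -/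
def AugmentationPowMem (p : ℕ) (F : Type*) [Field F] {Γ : Type*} [Group Γ] (c : Γ) (k s : ℕ) :
    Prop :=
  ∀ a : MonoidAlgebra F Γ, augmentation F Γ a = 0 → a ^ p ^ k ∈ Ideal.span {subOne F c ^ s}

/-- Every `a` in the augmentation ideal for which `a ^ (p ^ k)` is a multiple of `(c - 1) ^ 2`
is killed by all derivations into the trivial module. -/
def PowMemImpDerivationZero (p : ℕ) (F : Type*) [Field F] {Γ : Type*} [Group Γ] (c : Γ) (k : ℕ) :
    Prop :=
  ∀ a : MonoidAlgebra F Γ, augmentation F Γ a = 0 → a ^ p ^ k ∈ Ideal.span {subOne F c ^ 2} →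
    ∀ D : MonoidAlgebra F Γ →ₗ[F] F,
      (∀ a b, D (a * b) = augmentation F Γ a * D b + D a * augmentation F Γ b) → D a = 0

namespace IsPCPresented

variable {p m n e i j : ℕ} {Γ : Type*} [Group Γ] {x y c : Γ}

theorem collected_pow (h : IsPCPresented p m n e i j x y c) (b a t N : ℕ) :
    (y ^ b * x ^ a * c ^ t) ^ N
      = y ^ (N * b) * x ^ (N * a) * c ^ (N * t + N.choose 2 * (a * b)) :=
  _root_.collected_pow h.comm h.comm_x h.comm_y b a t N

theorem collected_mul (h : IsPCPresented p m n e i j x y c) (b a k b' a' k' : ℕ) :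
    (y ^ b * x ^ a * c ^ k) * (y ^ b' * x ^ a' * c ^ k')
      = y ^ (b + b') * x ^ (a + a') * c ^ (k + k' + a * b') :=
  _root_.collected_mul h.comm h.comm_x h.comm_y b a k b' a' k'

variable [hp : Fact p.Prime] {F : Type*} [Field F]

theorem eq_collected (h : IsPCPresented p m n e i j x y c) (g : Γ) :
    ∃ b a t, g = y ^ b * x ^ a * c ^ t :=
  have := h.finite hp.out.pos
  exists_collected h.gen h.comm h.comm_x h.comm_y g

theorem exists_sub_eq (h : IsPCPresented p m n e i j x y c) (a b : MonoidAlgebra F Γ) :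
    ∃ d, a * b - b * a = subOne F c * d :=
  exists_sub_eq_subOne_mul (h.exists_commutator hp.out.pos) a b

variable [CharP F p]

theorem add_pow_sub_mem (h : IsPCPresented p m n e i j x y c) (k : ℕ) (a b : MonoidAlgebra F Γ) :
    (a + b) ^ p ^ k - (a ^ p ^ k + b ^ p ^ k) ∈ Ideal.span {subOne F c} := by
  have : CharP (MonoidAlgebra F Γ) p := charP_monoidAlgebra p
  exact add_pow_sub_mem_span p (subOne_commute h.commute_c) h.exists_sub_eq k a b

theorem add_single_pow_sub_mem (h : IsPCPresented p m n e i j x y c) {k : ℕ}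
    (hk : p ∣ (p ^ k).choose 2) (a : MonoidAlgebra F Γ) (g : Γ) (r : F) (hr : r ≠ 0) :
    (a + MonoidAlgebra.single g r) ^ p ^ k - (a ^ p ^ k + MonoidAlgebra.single g r ^ p ^ k)
      ∈ Ideal.span {subOne F c ^ 2} := by
  have : CharP (MonoidAlgebra F Γ) p := charP_monoidAlgebra p
  obtain ⟨b, hb⟩ := exists_units_single (F := F) g hr
  rw [← hb]
  exact add_unit_pow_sub_mem_span_sq p (subOne_commute h.commute_c) h.exists_sub_eq hk a b

theorem augmentationPowMem_one (h : IsPCPresented p m n e i j x y c) (hnm : n ≤ m) :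
    AugmentationPowMem p F c m 1 := by
  intro a ha
  have := pow_sub_algebraMap_mem p m (I := Ideal.span {subOne F c})
    (fun a g r _ ↦ h.add_pow_sub_mem m a _) (fun g ↦ ?_) a
  · simpa [ha, hp.out.ne_zero] using this
  · obtain ⟨b, a, t, rfl⟩ := h.eq_collected g
    obtain ⟨l, rfl⟩ := Nat.exists_eq_add_of_le hnm
    rw [h.collected_pow, pow_mul x, h.x_pow, pow_add p n l, mul_assoc (p ^ n) _ b, pow_mul y,
      h.y_pow, ← pow_mul, ← pow_mul, ← pow_add, ← pow_add]
    obtain ⟨d, hd⟩ := exists_subOne_pow (F := F) (c := c)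
      (j * (p ^ l * b) + i * a + (p ^ n * p ^ l * t + (p ^ n * p ^ l).choose 2 * (a * b)))
    rw [← subOne, hd]
    exact Ideal.mem_span_singleton'.2 ⟨d, (subOne_commute h.commute_c d).eq.symm⟩

theorem not_augmentationPowMem_one (h : IsPCPresented p m n e i j x y c) {k : ℕ} (hk : k < m) :
    ¬ AugmentationPowMem p F c k 1 := by
  intro H
  obtain ⟨R, S, T, -, hR⟩ := h.exists_normalForm hp.out.pos
  have h1 := H (subOne F x) (augmentation_subOne x)
  rw [pow_one] at h1
  have h2 := functional_eq_zero_of_mem_span (W := fun g ↦ if R g = 0 then (1 : F) else 0)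
    (fun g ↦ ?_) h1
  · have e1 : R (x ^ p ^ k) = p ^ k := by
      have := (hR 0 (p ^ k) 0).1
      rw [Nat.mod_eq_of_lt (Nat.pow_lt_pow_right hp.out.one_lt hk)] at this
      simpa using this
    have e2 : R 1 = 0 := by simpa using (hR 0 0 0).1
    rw [subOne_pow, subOne, map_sub, MonoidAlgebra.one_def] at h2
    simp [e1, e2, hp.out.ne_zero] at h2
  · obtain ⟨b, a, t, rfl⟩ := h.eq_collected g
    rw [mul_assoc _ _ c, ← pow_succ, (hR _ _ _).1, (hR _ _ _).1]

end IsPCPresented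

theorem subOne_one {F : Type*} [Field F] {Γ : Type*} [Group Γ] : subOne F (1 : Γ) = 0 := by
  rw [subOne, MonoidAlgebra.one_def, sub_self]

theorem Nat.cast_mod_charP {p : ℕ} {F : Type*} [Field F] [CharP F p] (k : ℕ) :
    ((k % p : ℕ) : F) = k := (CharP.cast_eq_mod F p k).symm

namespace IsPCPresented

variable {p m n e i j : ℕ} {Γ : Type*} [Group Γ] {x y c : Γ}
  {F : Type*} [Field F]

theorem derivation_eq (h : IsPCPresented p m n e i j x y c) {R S T : Γ → ℕ}
    (hg : ∀ g, g = y ^ S g * x ^ R g * c ^ T g) {D : MonoidAlgebra F Γ →ₗ[F] F}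
    (hD : ∀ a b, D (a * b) = augmentation F Γ a * D b + D a * augmentation F Γ b)
    (a : MonoidAlgebra F Γ) :
    D a = functional (fun g ↦ (S g : F)) a * D (MonoidAlgebra.single y 1)
      + functional (fun g ↦ (R g : F)) a * D (MonoidAlgebra.single x 1) := by
  have hmul : ∀ g k : Γ, D (MonoidAlgebra.single (g * k) 1)
      = D (MonoidAlgebra.single g 1) + D (MonoidAlgebra.single k 1) := by
    intro g k
    have := hD (MonoidAlgebra.single g 1) (MonoidAlgebra.single k 1)
    rw [MonoidAlgebra.single_mul_single, mul_one, augmentation_single, augmentation_single] at this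
    rw [this]; ring
  have hone : D (MonoidAlgebra.single 1 1) = 0 := by
    have := hmul 1 1
    rw [mul_one] at this
    simpa using this
  have hpow : ∀ (g : Γ) (k : ℕ), D (MonoidAlgebra.single (g ^ k) 1)
      = k * D (MonoidAlgebra.single g 1) := by
    intro g k
    induction k with
    | zero => simp [hone]
    | succ k ih => rw [pow_succ, hmul, ih]; push_cast; ring
  have hc : D (MonoidAlgebra.single c 1) = 0 := by
    have := hmul x y
    rw [h.comm, hmul, hmul] at this
    linear_combination this
  induction a using MonoidAlgebra.induction_linear with
  | zero => simp
  | add a b ha hb => rw [map_add, map_add, map_add, ha, hb]; ring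
  | single g r =>
    have e1 : MonoidAlgebra.single g r = r • (MonoidAlgebra.single g 1 : MonoidAlgebra F Γ) := by
      simp
    have e2 : D (MonoidAlgebra.single g 1)
        = S g * D (MonoidAlgebra.single y 1) + R g * D (MonoidAlgebra.single x 1) := by
      conv_lhs => rw [hg g]
      rw [hmul, hmul, hpow, hpow, hpow, hc]; ring
    rw [functional_single, functional_single, e1, map_smul, e2, smul_eq_mul]; ring

variable [CharP F p] [hp : Fact p.Prime]

theorem pow_pow_eq_one (h : IsPCPresented p m n e 0 j x y c) (he : e ≤ 1) (hm : 0 < m)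
    (hn : n ≤ m) (hj : j = 0 ∨ n < m) (hk : p ∣ (p ^ m).choose 2) (g : Γ) : g ^ p ^ m = 1 := by
  obtain ⟨b, a, t, rfl⟩ := h.eq_collected g
  have hc : ∀ l, p ∣ l → c ^ l = 1 := by
    rintro _ ⟨l, rfl⟩
    rw [pow_mul, h.c_pow_p he, one_pow]
  have hy : y ^ p ^ m = 1 := by
    obtain ⟨l, rfl⟩ := Nat.exists_eq_add_of_le hn
    rw [pow_add, pow_mul, h.y_pow, ← pow_mul]
    rcases hj with rfl | hl
    · simp
    · exact hc _ (dvd_mul_of_dvd_right (dvd_pow_self p (by omega)) _)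
  rw [h.collected_pow, pow_mul, pow_mul, hy, h.x_pow, pow_zero, one_pow, one_pow, one_mul, one_mul]
  exact hc _ (dvd_add (dvd_mul_of_dvd_left (dvd_pow_self p hm.ne') _) (dvd_mul_of_dvd_left hk _))

theorem augmentationPowMem_two (h : IsPCPresented p m n e 0 j x y c) (he : e ≤ 1) (hm : 0 < m)
    (hn : n ≤ m) (hj : j = 0 ∨ n < m) (hk : p ∣ (p ^ m).choose 2) :
    AugmentationPowMem p F c m 2 := by
  intro a ha
  have := pow_sub_algebraMap_mem p m (h.add_single_pow_sub_mem (F := F) hk)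
    (fun g ↦ by simp [h.pow_pow_eq_one he hm hn hj hk g, MonoidAlgebra.one_def]) a
  simpa [ha, hp.out.ne_zero] using this

theorem cast_mul_c (h : IsPCPresented p m n 1 i j x y c) {T : Γ → ℕ}
    (hT : ∀ b a k, T (y ^ b * x ^ a * c ^ k) = (k + i * (a / p ^ m) + j * (b / p ^ n)) % p ^ 1)
    (g : Γ) : (T (g * c) : F) = T g + 1 := by
  obtain ⟨b, a, t, rfl⟩ := h.eq_collected g
  rw [mul_assoc _ _ c, ← pow_succ, hT, hT, pow_one, Nat.cast_mod_charP, Nat.cast_mod_charP]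
  push_cast
  ring

theorem not_augmentationPowMem_two (h : IsPCPresented p m n 1 1 j x y c) :
    ¬ AugmentationPowMem p F c m 2 := by
  intro H
  obtain ⟨R, S, T, -, hT⟩ := h.exists_normalForm hp.out.pos
  have hc := h.cast_mul_c (F := F) fun b a k ↦ (hT b a k).2.2
  have h1 := H (subOne F x) (augmentation_subOne x)
  have h2 := functional_eq_zero_of_mem_span_sq (W := fun g ↦ (T g : F))
    (fun g ↦ by rw [hc, hc]; ring) h1
  rw [subOne_pow, h.x_pow, subOne, map_sub, MonoidAlgebra.one_def, pow_one] at h2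
  have := hc 1
  rw [one_mul] at this
  simp [this] at h2

theorem not_powMemImpDerivationZero (h : IsPCPresented p m n 1 i 0 x y c) :
    ¬ PowMemImpDerivationZero p F c n := by
  intro H
  obtain ⟨R, S, T, -, hS⟩ := h.exists_normalForm hp.out.pos
  have hn := h.n_pos hp.out
  have hdvd : p ∣ p ^ n := dvd_pow_self p hn.ne'
  have hScast : ∀ b a k : ℕ, (S (y ^ b * x ^ a * c ^ k) : F) = b := fun b a k ↦ by
    rw [(hS b a k).2.1, ← Nat.cast_mod_charP (F := F) (p := p) (b % p ^ n), Nat.mod_mod_of_dvd _ hdvd,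
      Nat.cast_mod_charP]
  have hmul : ∀ g k : Γ, (S (g * k) : F) = S g + S k := by
    intro g k
    obtain ⟨b, a, t, rfl⟩ := h.eq_collected g
    obtain ⟨b', a', t', rfl⟩ := h.eq_collected k
    rw [h.collected_mul, hScast, hScast, hScast]
    push_cast; rfl
  have h1 := H (subOne F y) (augmentation_subOne y)
    (by rw [subOne_pow, h.y_pow, pow_zero, subOne_one]; exact Ideal.zero_mem _)
    (functional fun g ↦ (S g : F)) fun a b ↦ by
      induction a using MonoidAlgebra.induction_linear with
      | zero => simp
      | add a a' ha ha' => rw [add_mul, map_add, map_add, map_add, ha, ha']; ring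
      | single g r =>
        induction b using MonoidAlgebra.induction_linear with
        | zero => simp
        | add a a' ha ha' => rw [mul_add, map_add, map_add, map_add, ha, ha']; ring
        | single k s =>
          rw [MonoidAlgebra.single_mul_single]
          simp only [functional_single, augmentation_single, hmul]
          ring
  have e1 : (S y : F) = 1 := by simpa using hScast 1 0 0
  have e2 : (S 1 : F) = 0 := by simpa using hScast 0 0 0
  rw [subOne, map_sub, MonoidAlgebra.one_def] at h1
  simp [e1, e2] at h1

end IsPCPresented

theorem functional_mul_eq_sum {F : Type*} [Field F] {Γ : Type*} [Group Γ] {l : ℕ} {W : Γ → F}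
    {U V : Fin l → Γ → F} (h : ∀ g k, W (g * k) = ∑ t, U t g * V t k) (a b : MonoidAlgebra F Γ) :
    functional W (a * b) = ∑ t, functional (U t) a * functional (V t) b := by
  induction a using MonoidAlgebra.induction_linear with
  | zero => simp
  | add a a' ha ha' =>
    simp only [add_mul, map_add, ha, ha', Finset.sum_add_distrib]
  | single g r =>
    induction b using MonoidAlgebra.induction_linear with
    | zero => simp
    | add a a' ha ha' =>
      simp only [mul_add, map_add, ha, ha', Finset.sum_add_distrib]
    | single k s =>
      rw [MonoidAlgebra.single_mul_single]
      simp only [functional_single, h, Finset.mul_sum]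
      exact Finset.sum_congr rfl fun t _ ↦ by ring

theorem functional_one {F : Type*} [Field F] {Γ : Type*} [Group Γ] (a : MonoidAlgebra F Γ) :
    functional (fun _ ↦ (1 : F)) a = augmentation F Γ a := by
  induction a using MonoidAlgebra.induction_linear with
  | zero => simp
  | add a b ha hb => rw [map_add, map_add, ha, hb]
  | single g r => simp

namespace IsPCPresented

variable {p m n e i j : ℕ} {Γ : Type*} [Group Γ] {x y c : Γ}
  {F : Type*} [Field F] [CharP F p] [hp : Fact p.Prime]

theorem functional_right_eq_zero (h : IsPCPresented p m n e 0 j x y c) (hnm : n < m)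
    {R : Γ → ℕ} (hR : ∀ b a k, R (y ^ b * x ^ a * c ^ k) = a % p ^ m) {a : MonoidAlgebra F Γ}
    (ha : a ^ p ^ n ∈ Ideal.span {subOne F c ^ 2}) : functional (fun g ↦ (R g : F)) a = 0 := by
  obtain ⟨l, rfl⟩ := Nat.exists_eq_add_of_le hnm.le
  have hl : p ∣ p ^ l := dvd_pow_self p (by omega)
  have hpn : 0 < p ^ n := pow_pos hp.out.pos n
  have ha' : a ^ p ^ n ∈ Ideal.span {subOne F c} := by
    obtain ⟨d, hd⟩ := Ideal.mem_span_singleton'.1 ha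
    exact Ideal.mem_span_singleton'.2 ⟨d * subOne F c, by rw [← hd, mul_assoc, pow_two]⟩
  have key := functional_pow p n (I := Ideal.span {subOne F c})
    (W := fun g ↦ ((R g / p ^ n : ℕ) : F)) (μ := fun g ↦ (R g : F))
    (fun a g r _ ↦ h.add_pow_sub_mem n a _)
    (fun a ha ↦ functional_eq_zero_of_mem_span (fun g ↦ ?_) ha) (fun g ↦ ?_) a
  · rw [functional_eq_zero_of_mem_span (fun g ↦ ?_) ha'] at key
    · exact pow_eq_zero_iff hpn.ne' |>.1 key.symm
    · obtain ⟨b, a, t, rfl⟩ := h.eq_collected g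
      rw [mul_assoc _ _ c, ← pow_succ, hR, hR]
  · obtain ⟨b, a, t, rfl⟩ := h.eq_collected g
    rw [mul_assoc _ _ c, ← pow_succ, hR, hR]
  · obtain ⟨b, a, t, rfl⟩ := h.eq_collected g
    rw [h.collected_pow, hR, hR, pow_add, Nat.mul_mod_mul_left, Nat.mul_div_cancel_left _ hpn,
      ← iterateFrobenius_def, map_natCast, ← Nat.cast_mod_charP (p := p) (a % p ^ l),
      Nat.mod_mod_of_dvd _ hl, ← Nat.cast_mod_charP (p := p) (a % (p ^ n * p ^ l)),
      Nat.mod_mod_of_dvd _ (dvd_mul_of_dvd_right hl _)]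

theorem powMemImpDerivationZero_of_dvd (h : IsPCPresented p m n 1 0 1 x y c) (hnm : n < m)
    (hk : p ∣ (p ^ n).choose 2) : PowMemImpDerivationZero p F c n := by
  intro a _ ha D hD
  obtain ⟨R, S, T, hg, hRST⟩ := h.exists_normalForm hp.out.pos
  have hn := h.n_pos hp.out
  have hc := h.cast_mul_c (F := F) fun b a k ↦ (hRST b a k).2.2
  have hW : ∀ a ∈ Ideal.span {subOne F c ^ 2}, functional (fun g ↦ (T g : F)) a = 0 :=
    fun a ha ↦ functional_eq_zero_of_mem_span_sq (fun g ↦ by rw [hc, hc]; ring) ha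
  have key := functional_pow p n (I := Ideal.span {subOne F c ^ 2}) (W := fun g ↦ (T g : F))
    (μ := fun g ↦ (S g : F)) (h.add_single_pow_sub_mem hk) hW (fun g ↦ ?_) a
  · rw [hW _ ha] at key
    have hS := pow_eq_zero_iff (pow_ne_zero n hp.out.ne_zero) |>.1 key.symm
    rw [h.derivation_eq hg hD, hS,
      h.functional_right_eq_zero hnm (fun b a k ↦ (hRST b a k).1) ha]
    ring
  · obtain ⟨b, a, t, rfl⟩ := h.eq_collected g
    have hpn : ((p ^ n : ℕ) : F) = 0 :=
      (CharP.cast_eq_zero_iff F p _).2 (dvd_pow_self p hn.ne')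
    have hch : (((p ^ n).choose 2 : ℕ) : F) = 0 := (CharP.cast_eq_zero_iff F p _).2 hk
    rw [h.collected_pow, (hRST _ _ _).2.2, (hRST _ _ _).2.1, pow_one, Nat.cast_mod_charP,
      Nat.mul_div_cancel_left _ (pow_pos hp.out.pos n), ← iterateFrobenius_def, map_natCast,
      ← Nat.cast_mod_charP (p := p) (b % p ^ n), Nat.mod_mod_of_dvd _ (dvd_pow_self p hn.ne'),
      Nat.cast_mod_charP]
    simp only [Nat.cast_add, Nat.cast_mul, hpn, hch]
    simp

end IsPCPresented

namespace IsPCPresented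

variable {m i j : ℕ} {Γ : Type*} [Group Γ] {x y c : Γ} {F : Type*} [Field F] [CharP F 2]

theorem sq_eq_zero_of_mem (h : IsPCPresented 2 m 1 1 i j x y c) {a : MonoidAlgebra F Γ}
    (ha : a ^ 2 ^ 1 ∈ Ideal.span {subOne F c ^ 2}) : a * a = 0 := by
  have := subOne_pow (F := F) (c := c) 2 1
  rw [h.c_pow, pow_one, subOne_one] at this
  rw [this, Ideal.mem_span_singleton', pow_one, pow_two] at ha
  obtain ⟨_, h0⟩ := ha
  rw [← h0, mul_zero]

theorem powMemImpDerivationZero_two (h : IsPCPresented 2 m 1 1 0 1 x y c) (hm : 1 < m) :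
    PowMemImpDerivationZero 2 F c 1 := by
  intro a hε ha D hD
  obtain ⟨R, S, T, hg, hRST⟩ := h.exists_normalForm two_pos
  have hR := h.functional_right_eq_zero hm (fun b a k ↦ (hRST b a k).1) ha
  have hS2 : ∀ g, S g < 2 := fun g ↦ by
    rw [hg g, (hRST _ _ _).2.1]; exact Nat.mod_lt _ two_pos
  have hT : ∀ g k, (T (g * k) : F)
      = ∑ t, (![fun g ↦ (T g : F), fun _ ↦ 1, fun g ↦ (R g : F), fun g ↦ (S g : F)] t) g
        * (![fun _ ↦ 1, fun g ↦ (T g : F), fun g ↦ (S g : F), fun g ↦ (S g : F)] t) k := by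
    intro g k
    have e : (S g + S k) / 2 = S g * S k := by
      have := hS2 g; have := hS2 k
      interval_cases S g <;> interval_cases S k <;> rfl
    conv_lhs => rw [hg g, hg k]
    rw [h.collected_mul, (hRST _ _ _).2.2, pow_one, e, Nat.cast_mod_charP]
    simp [Fin.sum_univ_succ]
    ring
  have key := functional_mul_eq_sum (W := fun g ↦ (T g : F)) hT a a
  rw [h.sq_eq_zero_of_mem ha] at key
  simp [Fin.sum_univ_succ, functional_one, hε, hR] at key
  rw [h.derivation_eq hg hD, hR, key]
  ring

theorem powMemImpDerivationZero_quaternion (h : IsPCPresented 2 1 1 1 1 1 x y c) :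
    PowMemImpDerivationZero 2 F c 1 := by
  intro a hε ha D hD
  obtain ⟨R, S, T, hg, hRST⟩ := h.exists_normalForm two_pos
  have hS2 : ∀ g, S g < 2 := fun g ↦ by
    rw [hg g, (hRST _ _ _).2.1]; exact Nat.mod_lt _ two_pos
  have hR2 : ∀ g, R g < 2 := fun g ↦ by
    rw [hg g, (hRST _ _ _).1]; exact Nat.mod_lt _ two_pos
  have hSS : ∀ g, (S g * S g : F) = S g := fun g ↦ by
    have := hS2 g
    interval_cases S g <;> simp
  have hRR : ∀ g, (R g * R g : F) = R g := fun g ↦ by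
    have := hR2 g
    interval_cases R g <;> simp
  have hRmul : ∀ g k, (R (g * k) : F) = R g + R k := fun g k ↦ by
    conv_lhs => rw [hg g, hg k]
    rw [h.collected_mul, (hRST _ _ _).1, pow_one, Nat.cast_mod_charP, Nat.cast_add]
  have hSmul : ∀ g k, (S (g * k) : F) = S g + S k := fun g k ↦ by
    conv_lhs => rw [hg g, hg k]
    rw [h.collected_mul, (hRST _ _ _).2.1, pow_one, Nat.cast_mod_charP, Nat.cast_add]
  have hTmul : ∀ g k, (T (g * k) : F) = T g + T k + R g * S k + S g * S k + R g * R k := by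
    intro g k
    have e : (S g + S k) / 2 = S g * S k := by
      have := hS2 g; have := hS2 k
      interval_cases S g <;> interval_cases S k <;> rfl
    have e' : (R g + R k) / 2 = R g * R k := by
      have := hR2 g; have := hR2 k
      interval_cases R g <;> interval_cases R k <;> rfl
    conv_lhs => rw [hg g, hg k]
    rw [h.collected_mul, (hRST _ _ _).2.2, pow_one, e, e', Nat.cast_mod_charP]
    push_cast
    ring
  set r : Γ → F := fun g ↦ R g with hr
  set s : Γ → F := fun g ↦ S g with hs
  set t : Γ → F := fun g ↦ T g with ht
  have two : (2 : F) = 0 := CharTwo.two_eq_zero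
  have key1 := functional_mul_eq_sum (W := t) (U := ![t, fun _ ↦ 1, r, s, r])
    (V := ![fun _ ↦ 1, t, s, s, r]) (fun g k ↦ by
      simp only [Fin.sum_univ_five]
      simp [hTmul, ht, hr, hs]) a a
  have key2 := functional_mul_eq_sum (W := fun g ↦ t g * r g)
    (U := ![fun g ↦ t g * r g, fun _ ↦ 1, t, r, r, r, fun g ↦ r g * s g, s])
    (V := ![fun _ ↦ 1, fun g ↦ t g * r g, r, t, s, fun g ↦ r g * s g, s, fun g ↦ r g * s g])
    (fun g k ↦ by
      simp only [Fin.sum_univ_eight]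
      simp [hTmul, hRmul, ht, hr, hs]
      linear_combination (S k + R k : F) * hRR g + (R g : F) * hRR k + R g * R k * two) a a
  have key3 := functional_mul_eq_sum (W := fun g ↦ t g * s g)
    (U := ![fun g ↦ t g * s g, fun _ ↦ 1, t, s, r, fun g ↦ r g * s g, fun g ↦ r g * s g, r])
    (V := ![fun _ ↦ 1, fun g ↦ t g * s g, s, t, s, s, r, fun g ↦ r g * s g])
    (fun g k ↦ by
      simp only [Fin.sum_univ_eight]
      simp [hTmul, hSmul, ht, hr, hs]
      linear_combination (S k : F) * hSS g + (S g + R g: F) * hSS k + S g * S k * two) a a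
  rw [h.sq_eq_zero_of_mem ha, map_zero] at key1 key2 key3
  simp only [Fin.sum_univ_five] at key1
  simp only [Fin.sum_univ_eight] at key2 key3
  simp [functional_one, hε] at key1 key2 key3
  rw [h.derivation_eq hg hD]
  change functional s a * _ + functional r a * _ = 0
  generalize functional (fun g ↦ r g * s g) a = q at *
  generalize functional (fun g ↦ t g * r g) a = q' at *
  generalize functional r a = ρ at *
  generalize functional s a = σ at *
  generalize functional t a = τ at *
  have h2 : ρ * (σ + q) = 0 := by linear_combination -key2 - (τ * ρ + q * σ) * two
  have h3 : σ * (ρ + q) = 0 := by linear_combination -key3 - (τ * σ + q * ρ) * two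
  have hρ : ρ = 0 := by
    by_contra hρ
    have h4 : σ + q = 0 := (mul_eq_zero.1 h2).resolve_left hρ
    exact hρ (mul_self_eq_zero.1 (by linear_combination -key1 - h3 + σ * h4 - σ * σ * two))
  have hσ : σ = 0 := mul_self_eq_zero.1 (by rw [hρ] at key1; linear_combination -key1)
  rw [hρ, hσ]
  ring

end IsPCPresented

section Transport

variable {F : Type*} [Field F] {Γ Δ : Type*} [Group Γ] [Group Δ]

theorem algHom_eq_augmentation {p : ℕ} [Fact p.Prime] [CharP F p] (hΓ : IsPGroup p Γ)
    (ψ : MonoidAlgebra F Γ →ₐ[F] F) : ψ = augmentation F Γ := by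
  refine MonoidAlgebra.algHom_ext (fun g ↦ ?_) (by ext)
  obtain ⟨k, hk⟩ := hΓ g
  have h1 : ψ (MonoidAlgebra.single g 1) ^ p ^ k = 1 := by
    rw [← map_pow, MonoidAlgebra.single_pow, hk, one_pow, ← MonoidAlgebra.one_def, map_one]
  have h2 : (ψ (MonoidAlgebra.single g 1) - 1) ^ p ^ k = 0 := by
    rw [sub_pow_char_pow, h1, one_pow, sub_self]
  rw [augmentation_single]
  exact sub_eq_zero.1 (pow_eq_zero_iff (pow_ne_zero k (Fact.out : p.Prime).ne_zero) |>.1 h2)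

theorem augmentation_algEquiv {p : ℕ} [Fact p.Prime] [CharP F p] (hΓ : IsPGroup p Γ)
    (φ : MonoidAlgebra F Γ ≃ₐ[F] MonoidAlgebra F Δ) (a : MonoidAlgebra F Γ) :
    augmentation F Δ (φ a) = augmentation F Γ a :=
  DFunLike.congr_fun (algHom_eq_augmentation hΓ ((augmentation F Δ).comp φ.toAlgHom)) a

theorem subOne_eq_zero_iff {g : Γ} : subOne F g = 0 ↔ g = 1 := by
  rw [subOne, sub_eq_zero, MonoidAlgebra.one_def]
  exact ⟨fun h ↦ MonoidAlgebra.of_injective (R := F) h, fun h ↦ by rw [h]⟩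

theorem card_eq_of_algEquiv [Finite Γ] [Finite Δ]
    (φ : MonoidAlgebra F Γ ≃ₐ[F] MonoidAlgebra F Δ) : Nat.card Γ = Nat.card Δ := by
  have := φ.toLinearEquiv.finrank_eq
  rwa [Module.finrank_eq_nat_card_basis (MonoidAlgebra.basis Γ F),
    Module.finrank_eq_nat_card_basis (MonoidAlgebra.basis Δ F)] at this

variable {p m n e i j m' n' e' i' j' : ℕ} {x y c : Γ} {x' y' c' : Δ} [hp : Fact p.Prime]

theorem IsPCPresented.map_mem_span (h : IsPCPresented p m n e i j x y c)
    (h' : IsPCPresented p m' n' e' i' j' x' y' c')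
    (φ : MonoidAlgebra F Γ ≃ₐ[F] MonoidAlgebra F Δ) (s : ℕ) {a : MonoidAlgebra F Γ}
    (ha : a ∈ Ideal.span {subOne F c ^ s}) : φ a ∈ Ideal.span {subOne F c' ^ s} := by
  obtain ⟨d, rfl⟩ := Ideal.mem_span_singleton'.1 ha
  have hu : subOne F c = MonoidAlgebra.single (y * x)⁻¹ 1 *
      (MonoidAlgebra.single x 1 * MonoidAlgebra.single y 1
        - MonoidAlgebra.single y 1 * MonoidAlgebra.single x 1) := by
    simp only [MonoidAlgebra.single_mul_single, mul_sub, mul_one, h.comm, inv_mul_cancel_left,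
      inv_mul_cancel]
    rfl
  obtain ⟨f, hf⟩ := h'.exists_sub_eq (φ (MonoidAlgebra.single x 1)) (φ (MonoidAlgebra.single y 1))
  have hφ : φ (subOne F c) = φ (MonoidAlgebra.single (y * x)⁻¹ 1) * f * subOne F c' := by
    rw [hu, map_mul, map_sub, map_mul, map_mul, hf, (subOne_commute h'.commute_c f).eq, mul_assoc]
  rw [map_mul, map_pow, hφ, (subOne_commute h'.commute_c _).symm.mul_pow, ← mul_assoc]
  exact Ideal.mem_span_singleton'.2 ⟨_, rfl⟩

theorem IsPCPresented.le_exponent_of_algEquiv (h : IsPCPresented p m n e i j x y c)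
    (h' : IsPCPresented p m' n' e' i' j' x' y' c') (he' : e' ≤ 1)
    (φ : MonoidAlgebra F Γ ≃ₐ[F] MonoidAlgebra F Δ) : e' ≤ e := by
  by_contra! he
  obtain rfl : e' = 1 := by omega
  obtain rfl : e = 0 := by omega
  have hc : c = 1 := by simpa using h.c_pow
  have h1 := h'.map_mem_span h φ.symm 1 (Ideal.mem_span_singleton_self _)
  rw [hc, subOne_one, pow_one, pow_one, Ideal.mem_span_singleton'] at h1
  obtain ⟨d, hd⟩ := h1
  rw [mul_zero, eq_comm, map_eq_zero_iff _ φ.symm.injective, subOne_eq_zero_iff] at hd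
  exact h'.c_ne_one hp.out hd

variable [CharP F p]

theorem AugmentationPowMem.map (h : IsPCPresented p m n e i j x y c)
    (h' : IsPCPresented p m' n' e' i' j' x' y' c')
    (φ : MonoidAlgebra F Γ ≃ₐ[F] MonoidAlgebra F Δ) {k s : ℕ}
    (H : AugmentationPowMem p F c k s) : AugmentationPowMem p F c' k s := by
  intro a ha
  have := h.map_mem_span h' φ s (H (φ.symm a)
    (by rw [augmentation_algEquiv (h'.isPGroup hp.out) φ.symm, ha]))
  rwa [map_pow, AlgEquiv.apply_symm_apply] at this

theorem PowMemImpDerivationZero.map (h : IsPCPresented p m n e i j x y c)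
    (h' : IsPCPresented p m' n' e' i' j' x' y' c')
    (φ : MonoidAlgebra F Γ ≃ₐ[F] MonoidAlgebra F Δ) {k : ℕ}
    (H : PowMemImpDerivationZero p F c k) : PowMemImpDerivationZero p F c' k := by
  intro a ha hk D hD
  have h1 := h'.map_mem_span h φ.symm 2 hk
  rw [map_pow] at h1
  have := H (φ.symm a) (by rw [augmentation_algEquiv (h'.isPGroup hp.out) φ.symm, ha]) h1
    (D ∘ₗ φ.toLinearMap) (fun a b ↦ by
      simpa [augmentation_algEquiv (h.isPGroup hp.out) φ] using hD (φ a) (φ b))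
  simpa using this

theorem IsPCPresented.le_of_algEquiv (h : IsPCPresented p m n e i j x y c) (hnm : n ≤ m)
    (h' : IsPCPresented p m' n' e' i' j' x' y' c')
    (φ : MonoidAlgebra F Γ ≃ₐ[F] MonoidAlgebra F Δ) : m' ≤ m := by
  by_contra! hm
  exact h'.not_augmentationPowMem_one hm ((h.augmentationPowMem_one hnm).map h h' φ)

theorem IsPCPresented.augmentationPowMem_two_iff (h : IsPCPresented p m n 1 i j x y c)
    (hN : IsNormalized p m n 1 i j) (h2 : ¬(p = 2 ∧ m = 1)) :
    AugmentationPowMem p F c m 2 ↔ i = 0 := by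
  obtain ⟨hnm, h0⟩ := hN
  have hn := h.n_pos hp.out
  have hk := dvd_choose_two_of hp.out (by omega : 0 < m) h2
  rcases h0 with ⟨_, _⟩ | ⟨-, -, ⟨rfl, rfl⟩ | ⟨rfl, rfl, -⟩ | ⟨rfl, rfl, hl⟩ | ⟨rfl, rfl, -⟩⟩
  · omega
  · exact iff_of_true (h.augmentationPowMem_two le_rfl (by omega) hnm (.inl rfl) hk) rfl
  · exact iff_of_false h.not_augmentationPowMem_two one_ne_zero
  · exact iff_of_true (h.augmentationPowMem_two le_rfl (by omega) hnm (.inr hl) hk) rfl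
  · exact iff_of_false h.not_augmentationPowMem_two one_ne_zero

theorem IsPCPresented.powMemImpDerivationZero_iff (h : IsPCPresented p m n 1 i j x y c)
    (hN : IsNormalized p m n 1 i j) (hi : i = 0 ∨ (p = 2 ∧ m = 1)) :
    PowMemImpDerivationZero p F c n ↔ j = 1 := by
  obtain ⟨hnm, h0⟩ := hN
  have hn := h.n_pos hp.out
  rcases h0 with ⟨_, _⟩ | ⟨-, -, ⟨rfl, rfl⟩ | ⟨rfl, rfl, h2⟩ | ⟨rfl, rfl, hl⟩ |
    ⟨rfl, rfl, rfl, rfl, rfl⟩⟩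
  · omega
  · exact iff_of_false h.not_powMemImpDerivationZero zero_ne_one
  · omega
  · refine iff_of_true ?_ rfl
    by_cases h2 : p = 2 ∧ n = 1
    · obtain ⟨rfl, rfl⟩ := h2
      exact h.powMemImpDerivationZero_two hl
    · exact h.powMemImpDerivationZero_of_dvd hl (dvd_choose_two_of hp.out hn h2)
  · exact iff_of_true h.powMemImpDerivationZero_quaternion rfl

theorem IsPCPresented.nonempty_mulEquiv_of_algEquiv (h : IsPCPresented p m n e i j x y c)
    (hnm : n ≤ m) (he : e ≤ 1) (h' : IsPCPresented p m' n' e' i' j' x' y' c') (hnm' : n' ≤ m')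
    (he' : e' ≤ 1) (φ : MonoidAlgebra F Γ ≃ₐ[F] MonoidAlgebra F Δ) : Nonempty (Γ ≃* Δ) := by
  have := h.finite hp.out.pos
  have := h'.finite hp.out.pos
  obtain rfl : m = m' := le_antisymm (h'.le_of_algEquiv hnm' h φ.symm) (h.le_of_algEquiv hnm h' φ)
  obtain rfl : e = e' := le_antisymm (h'.le_exponent_of_algEquiv h he φ.symm)
    (h.le_exponent_of_algEquiv h' he' φ)
  obtain rfl : n = n' := by
    have := card_eq_of_algEquiv φ
    rw [h.card, h'.card] at this
    have := Nat.pow_right_injective hp.out.two_le this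
    omega
  obtain ⟨i, j, x, y, c, hN, h⟩ := h.exists_isNormalized hp.out hnm he
  obtain ⟨i', j', x', y', c', hN', h'⟩ := h'.exists_isNormalized hp.out hnm he
  suffices i = i' ∧ j = j' by
    obtain ⟨rfl, rfl⟩ := this
    exact h.nonempty_mulEquiv hp.out.pos h'
  rcases (by omega : e = 0 ∨ e = 1) with rfl | rfl
  · have h1 := hN.2
    have h2 := hN'.2
    omega
  have h1 := hN.2
  have h2 := hN'.2
  by_cases hm : p = 2 ∧ m = 1
  · have hj := h.powMemImpDerivationZero_iff (F := F) hN (.inr hm)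
    have hj' := h'.powMemImpDerivationZero_iff (F := F) hN' (.inr hm)
    have : j = 1 ↔ j' = 1 :=
      hj.symm.trans (⟨(·.map h h' φ), (·.map h' h φ.symm)⟩ : _ ↔ _) |>.trans hj'
    omega
  · have hi := h.augmentationPowMem_two_iff (F := F) hN hm
    have hi' := h'.augmentationPowMem_two_iff (F := F) hN' hm
    have hii : i = 0 ↔ i' = 0 :=
      hi.symm.trans (⟨(·.map h h' φ), (·.map h' h φ.symm)⟩ : _ ↔ _) |>.trans hi'
    by_cases h0 : i = 0
    · have hj := h.powMemImpDerivationZero_iff (F := F) hN (.inl h0)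
      have hj' := h'.powMemImpDerivationZero_iff (F := F) hN' (.inl (hii.1 h0))
      have : j = 1 ↔ j' = 1 :=
        hj.symm.trans (⟨(·.map h h' φ), (·.map h' h φ.symm)⟩ : _ ↔ _) |>.trans hj'
      omega
    · omega

end Transport

section GroupTheory

theorem pow_mem_agemo {p : ℕ} {G : Type*} [Group G] {P : Subgroup G} {g : G} (hg : g ∈ P) :
    g ^ p ∈ agemo p P :=
  Subgroup.subset_closure ⟨g, hg, rfl⟩

variable {p : ℕ} [hp : Fact p.Prime]

theorem card_eq_prime_of_isCoatom {P : Type*} [Group P] [Finite P] (hP : IsPGroup p P)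
    {M : Subgroup P} [M.Normal] (hM : IsCoatom M) : Nat.card (P ⧸ M) = p := by
  have hQ : IsPGroup p (P ⧸ M) := hP.to_quotient M
  obtain ⟨k, hk⟩ := IsPGroup.iff_card.1 hQ
  have hk0 : k ≠ 0 := by
    rintro rfl
    rw [pow_zero, ← Subgroup.index, Subgroup.index_eq_one] at hk
    exact hM.1 hk
  obtain ⟨q, hq⟩ := exists_prime_orderOf_dvd_card' (G := P ⧸ M) p (hk ▸ dvd_pow_self p hk0)
  have htop : (Subgroup.zpowers q).comap (QuotientGroup.mk' M) = ⊤ := by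
    refine hM.2 _ (lt_of_le_of_ne ?_ ?_)
    · intro z hz
      rw [Subgroup.mem_comap, QuotientGroup.mk'_apply, (QuotientGroup.eq_one_iff z).2 hz]
      exact one_mem _
    · intro h
      obtain ⟨z, rfl⟩ := QuotientGroup.mk'_surjective M q
      have : z ∈ M := h ▸ Subgroup.mem_comap.2 (Subgroup.mem_zpowers _)
      rw [QuotientGroup.mk'_apply, (QuotientGroup.eq_one_iff z).2 this, orderOf_one] at hq
      exact hp.out.ne_one hq.symm
  have htop' : Subgroup.zpowers q = ⊤ := by
    rw [← Subgroup.map_comap_eq_self_of_surjective (QuotientGroup.mk'_surjective M)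
      (Subgroup.zpowers q), htop, Subgroup.map_top_of_surjective _
      (QuotientGroup.mk'_surjective M)]
  rw [← hq, ← Nat.card_zpowers, htop', Subgroup.card_top]

/-- In a finite `p`-group, a subset on which no nontrivial homomorphism to a field of
characteristic `p` vanishes is a generating set. -/
theorem closure_eq_top_of_forall_hom (F : Type*) [Field F] [CharP F p] {P : Type*} [Group P]
    [Finite P] (hP : IsPGroup p P) {S : Set P}
    (h : ∀ f : P →* Multiplicative F, (∀ s ∈ S, f s = 1) → f = 1) : Subgroup.closure S = ⊤ := by
  by_contra hS
  obtain ⟨M, hM, hSM⟩ := (eq_top_or_exists_le_coatom (Subgroup.closure S)).resolve_left hS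
  have := hP.isNilpotent
  have := Subgroup.NormalizerCondition.normal_of_coatom M
    Group.normalizerCondition_of_isNilpotent hM
  let e : P ⧸ M ≃* Multiplicative (ZMod p) :=
    mulEquivOfPrimeCardEq (card_eq_prime_of_isCoatom hP hM) (by simp)
  let ι : Multiplicative (ZMod p) →* Multiplicative F :=
    AddMonoidHom.toMultiplicative (ZMod.castHom dvd_rfl F : ZMod p →+* F).toAddMonoidHom
  have hι : Function.Injective ι := (ZMod.castHom dvd_rfl F : ZMod p →+* F).injective
  have hf := h ((ι.comp e.toMonoidHom).comp (QuotientGroup.mk' M)) fun s hs ↦ by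
    simp [(QuotientGroup.eq_one_iff s).2 (hSM (Subgroup.subset_closure hs))]
  refine hM.1 (Subgroup.eq_top_iff' M |>.2 fun z ↦ (QuotientGroup.eq_one_iff z).1 ?_)
  have hz : ι (e z) = 1 := DFunLike.congr_fun hf z
  exact e.injective (hι (hz.trans (by simp)))

theorem conj_mul_inv_mem_agemo {G : Type*} [Group G] [Finite G] (hG : IsPGroup p G)
    (hG' : IsCyclic (commutator G)) {k : G} (hk : k ∈ commutator G) (g : G) :
    g * k * g⁻¹ * k⁻¹ ∈ agemo p (commutator G) := by
  obtain ⟨⟨c, hc⟩, hgen⟩ := hG'.exists_generator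
  have hgen' : ∀ k ∈ commutator G, ∃ t : ℤ, c ^ t = k := fun k hk ↦ by
    obtain ⟨t, ht⟩ := Subgroup.mem_zpowers_iff.1 (hgen ⟨k, hk⟩)
    exact ⟨t, by simpa using congrArg Subtype.val ht⟩
  obtain ⟨t, rfl⟩ := hgen' k hk
  by_cases hc1 : c = 1
  · simp [hc1]
  obtain ⟨i, hi⟩ := hgen' _ (Subgroup.Normal.conj_mem inferInstance c hc g)
  have hiter : ∀ s : ℕ, c ^ i ^ s = g ^ s * c * (g ^ s)⁻¹ := by
    intro s
    induction s with
    | zero => simp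
    | succ s ih =>
      rw [pow_succ, zpow_mul, ih, conj_zpow, hi, pow_succ]
      group
  obtain ⟨s, hs⟩ := hG g
  have h1 : c ^ (i ^ p ^ s - 1) = 1 := by
    rw [zpow_sub, hiter, hs]
    group
  have h2 : (p : ℤ) ∣ i ^ p ^ s - 1 := by
    refine dvd_trans ?_ (orderOf_dvd_iff_zpow_eq_one.2 h1)
    obtain ⟨r, hr⟩ := IsPGroup.iff_orderOf.1 hG c
    have : r ≠ 0 := by
      rintro rfl
      exact hc1 (orderOf_eq_one_iff.1 (by simpa using hr))
    rw [hr]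
    exact_mod_cast dvd_pow_self p this
  have h3 : (p : ℤ) ∣ i - 1 := by
    rw [← ZMod.intCast_zmod_eq_zero_iff_dvd] at h2 ⊢
    push_cast at h2 ⊢
    rwa [ZMod.pow_card_pow] at h2
  obtain ⟨l, hl⟩ := h3
  have h4 : g * c ^ t * g⁻¹ * (c ^ t)⁻¹ = (c ^ (l * t)) ^ p := by
    rw [← conj_zpow, ← hi, ← zpow_mul, ← zpow_neg, ← zpow_add, ← zpow_natCast, ← zpow_mul]
    congr 1
    linear_combination t * hl
  rw [h4]
  exact pow_mem_agemo (Subgroup.zpow_mem _ hc _)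

end GroupTheory

section Generators

variable {F : Type*} [Field F] {Γ Δ : Type*} [Group Γ] [Group Δ]

theorem functional_hom_mul (f : Γ →* Multiplicative F) (a b : MonoidAlgebra F Γ) :
    functional (fun g ↦ (f g).toAdd) (a * b) = augmentation F Γ a *
      functional (fun g ↦ (f g).toAdd) b + functional (fun g ↦ (f g).toAdd) a *
      augmentation F Γ b := by
  induction a using MonoidAlgebra.induction_linear with
  | zero => simp
  | add a a' h h' => simp only [add_mul, map_add, h, h']; ring
  | single g r =>
    induction b using MonoidAlgebra.induction_linear with
    | zero => simp
    | add b b' h h' => simp only [mul_add, map_add, h, h']; ring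
    | single g' r' =>
      simp only [MonoidAlgebra.single_mul_single, functional_single, augmentation_single, map_mul,
        toAdd_mul]
      ring

theorem eq_zero_of_augmentation_derivation {S : Set Γ} (hS : Subgroup.closure S = ⊤)
    (D : MonoidAlgebra F Γ →ₗ[F] F)
    (hD : ∀ a b, D (a * b) = augmentation F Γ a * D b + D a * augmentation F Γ b)
    (h : ∀ s ∈ S, D (MonoidAlgebra.single s 1) = 0) : D = 0 := by
  have hmul (g g' : Γ) : D (MonoidAlgebra.single (g * g') 1) =
      D (MonoidAlgebra.single g' 1) + D (MonoidAlgebra.single g 1) := by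
    have := hD (MonoidAlgebra.single g 1) (MonoidAlgebra.single g' 1)
    simpa [MonoidAlgebra.single_mul_single] using this
  have hone : D (MonoidAlgebra.single 1 1) = 0 := by
    simpa using hmul 1 1
  have key (g : Γ) : D (MonoidAlgebra.single g 1) = 0 := by
    have hg : g ∈ Subgroup.closure S := hS ▸ Subgroup.mem_top g
    induction hg using Subgroup.closure_induction with
    | mem s hs => exact h s hs
    | one => exact hone
    | mul a b _ _ ha hb => rw [hmul, ha, hb, add_zero]
    | inv a _ ha =>
      have := hmul a a⁻¹
      rwa [mul_inv_cancel, hone, ha, add_zero, eq_comm] at this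
  ext g
  simpa using key g

/-- The group algebra of a finite `p`-group over a field of characteristic `p` detects
two-generation. -/
theorem exists_closure_pair_of_algEquiv {p : ℕ} [Fact p.Prime] [CharP F p] [Finite Δ]
    (hΓ : IsPGroup p Γ) (hΔ : IsPGroup p Δ) (φ : MonoidAlgebra F Γ ≃ₐ[F] MonoidAlgebra F Δ)
    (hgen : ∃ x y : Γ, Subgroup.closure {x, y} = ⊤) :
    ∃ x y : Δ, Subgroup.closure {x, y} = ⊤ := by
  obtain ⟨x, y, hxy⟩ := hgen
  by_contra! hcon
  have key (u v : Δ) : ∃ f : Δ →* Multiplicative F, (∀ s ∈ ({u, v} : Set Δ), f s = 1) ∧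
      ∃ w, f w ≠ 1 := by
    by_contra! hno
    refine hcon u v (closure_eq_top_of_forall_hom F hΔ fun f hf ↦ ?_)
    ext w
    exact congrArg _ (hno f hf w)
  obtain ⟨f₁, -, h₁, hf₁⟩ := key 1 1
  obtain ⟨f₂, hf₂, h₂, hf₂'⟩ := key h₁ h₁
  obtain ⟨f₃, hf₃, h₃, hf₃'⟩ := key h₁ h₂
  have e21 : f₂ h₁ = 1 := hf₂ _ (by simp)
  have e31 : f₃ h₁ = 1 := hf₃ _ (by simp)
  have e32 : f₃ h₂ = 1 := hf₃ _ (by simp)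
  let f : Fin 3 → Δ →* Multiplicative F := ![f₁, f₂, f₃]
  let W : Fin 3 → MonoidAlgebra F Γ →ₗ[F] F := fun i ↦
    functional (fun g ↦ (f i g).toAdd) ∘ₗ φ.toLinearMap
  let T : (Fin 3 → F) →ₗ[F] (Fin 2 → F) := LinearMap.pi fun j ↦
    ∑ i, (W i (MonoidAlgebra.single (![x, y] j) 1)) • LinearMap.proj i
  have hker := LinearMap.ker_ne_bot_of_finrank_lt (f := T) (by simp)
  obtain ⟨a, ha, ha0⟩ := Submodule.exists_mem_ne_zero_of_ne_bot hker
  have hD : ∑ i, a i • W i = 0 := by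
    refine eq_zero_of_augmentation_derivation hxy _ (fun b b' ↦ ?_) ?_
    · simp only [LinearMap.sum_apply, LinearMap.smul_apply, W, LinearMap.comp_apply,
        AlgEquiv.toLinearMap_apply, map_mul, functional_hom_mul, augmentation_algEquiv hΓ,
        Finset.mul_sum, Finset.sum_mul, ← Finset.sum_add_distrib, smul_eq_mul]
      exact Finset.sum_congr rfl fun i _ ↦ by ring
    · have hT (j : Fin 2) : ∑ i, a i * W i (MonoidAlgebra.single (![x, y] j) 1) = 0 := by
        simpa [T, mul_comm] using congrFun (LinearMap.mem_ker.1 ha) j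
      rintro s (rfl | rfl)
      · simpa using hT 0
      · simpa using hT 1
  have hval (h : Δ) : a 0 * (f₁ h).toAdd + a 1 * (f₂ h).toAdd + a 2 * (f₃ h).toAdd = 0 := by
    have := DFunLike.congr_fun hD (φ.symm (MonoidAlgebra.single h 1))
    simpa [W, f, Fin.sum_univ_three] using this
  have a0 : a 0 = 0 := by
    have := hval h₁
    rw [e21, e31] at this
    simpa [hf₁] using this
  have a1 : a 1 = 0 := by
    have := hval h₂
    rw [e32, a0] at this
    simpa [hf₂'] using this
  have a2 : a 2 = 0 := by
    have := hval h₃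
    rw [a0, a1] at this
    simpa [hf₃'] using this
  refine ha0 (funext fun i ↦ ?_)
  fin_cases i <;> assumption

end Generators

section CommutatorIdeal

open scoped commutatorElement

variable (F : Type*) [Field F]

/-- The linear span of the products `a * (b * c - c * b) * d`, that is, the two-sided ideal
generated by the commutators. -/
def commutatorIdeal (A : Type*) [Ring A] [Algebra F A] : Submodule F A :=
  Submodule.span F {z | ∃ a b c d : A, z = a * (b * c - c * b) * d}

variable {F} {A B : Type*} [Ring A] [Algebra F A] [Ring B] [Algebra F B]

theorem sub_mem_commutatorIdeal (a b : A) : a * b - b * a ∈ commutatorIdeal F A :=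
  Submodule.subset_span ⟨1, a, b, 1, by simp⟩

theorem mul_mem_commutatorIdeal {z : A} (hz : z ∈ commutatorIdeal F A) (a : A) :
    z * a ∈ commutatorIdeal F A := by
  induction hz using Submodule.span_induction with
  | mem z h =>
    obtain ⟨b, c, d, e, rfl⟩ := h
    exact Submodule.subset_span ⟨b, c, d, e * a, by simp only [mul_assoc]⟩
  | zero => simp
  | add x y _ _ hx hy => rw [add_mul]; exact add_mem hx hy
  | smul r x _ hx => rw [smul_mul_assoc]; exact Submodule.smul_mem _ _ hx

theorem mul_mem_commutatorIdeal_sq {z : A} (hz : z ∈ commutatorIdeal F A * commutatorIdeal F A)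
    (a : A) : z * a ∈ commutatorIdeal F A * commutatorIdeal F A := by
  induction hz using Submodule.mul_induction_on' with
  | mem_mul_mem m hm n hn =>
    rw [mul_assoc]
    exact Submodule.mul_mem_mul hm (mul_mem_commutatorIdeal hn a)
  | add x _ y _ hx hy => rw [add_mul]; exact add_mem hx hy

theorem map_commutatorIdeal_le (φ : A →ₐ[F] B) :
    (commutatorIdeal F A).map φ.toLinearMap ≤ commutatorIdeal F B := by
  rw [commutatorIdeal, Submodule.map_span_le]
  rintro _ ⟨a, b, c, d, rfl⟩
  exact Submodule.subset_span ⟨φ a, φ b, φ c, φ d, by simp⟩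

theorem map_mem_commutatorIdeal_sq (φ : A →ₐ[F] B) {z : A}
    (hz : z ∈ commutatorIdeal F A * commutatorIdeal F A) :
    φ z ∈ commutatorIdeal F B * commutatorIdeal F B := by
  have h := Submodule.mem_map_of_mem (f := φ.toLinearMap) hz
  rw [Submodule.map_mul] at h
  exact mul_le_mul' (map_commutatorIdeal_le φ) (map_commutatorIdeal_le φ) h

variable {Γ Δ : Type*} [Group Γ] [Group Δ]

theorem subOne_mul (k l : Γ) :
    subOne F (k * l) = subOne F k * MonoidAlgebra.single l 1 + subOne F l := by
  simp [subOne, sub_mul, MonoidAlgebra.single_mul_single]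

theorem subOne_mem_of_mem_closure {I : AddSubgroup (MonoidAlgebra F Γ)}
    (hI : ∀ z ∈ I, ∀ a, z * a ∈ I) {S : Set Γ} (hS : ∀ s ∈ S, subOne F s ∈ I) {g : Γ}
    (hg : g ∈ Subgroup.closure S) : subOne F g ∈ I := by
  induction hg using Subgroup.closure_induction with
  | mem s hs => exact hS s hs
  | one => rw [subOne_one]; exact zero_mem _
  | mul k l _ _ hk hl => rw [subOne_mul]; exact add_mem (hI _ hk _) hl
  | inv k _ hk =>
    have h := subOne_mul (F := F) k k⁻¹
    rw [mul_inv_cancel, subOne_one, eq_comm, add_comm] at h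
    rw [eq_neg_of_add_eq_zero_left h]
    exact neg_mem (hI _ hk _)

theorem single_mul_sub_single_mul (g h : Γ) :
    MonoidAlgebra.single (g * h) (1 : F) - MonoidAlgebra.single (h * g) 1 =
      subOne F ⁅g, h⁆ * MonoidAlgebra.single (h * g) 1 := by
  rw [subOne, sub_mul, one_mul, MonoidAlgebra.single_mul_single, mul_one]
  congr 2
  rw [commutatorElement_def]
  group

theorem single_mul_subOne (g k : Γ) : MonoidAlgebra.single g (1 : F) * subOne F k =
    subOne F (g * k * g⁻¹) * MonoidAlgebra.single g 1 := by
  simp [subOne, mul_sub, sub_mul, MonoidAlgebra.single_mul_single]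

theorem subOne_mem_commutatorIdeal {k : Γ} (hk : k ∈ commutator Γ) :
    subOne F k ∈ commutatorIdeal F (MonoidAlgebra F Γ) := by
  rw [commutator_eq_closure] at hk
  refine subOne_mem_of_mem_closure (I := (commutatorIdeal F (MonoidAlgebra F Γ)).toAddSubgroup)
    (fun z hz a ↦ mul_mem_commutatorIdeal hz a) ?_ hk
  rintro _ ⟨g, h, rfl⟩
  have e : subOne F ⁅g, h⁆ = (MonoidAlgebra.single g 1 * MonoidAlgebra.single h 1 -
      MonoidAlgebra.single h 1 * MonoidAlgebra.single g 1) * MonoidAlgebra.single (h * g)⁻¹ 1 := by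
    rw [MonoidAlgebra.single_mul_single, MonoidAlgebra.single_mul_single, mul_one,
      single_mul_sub_single_mul, mul_assoc, MonoidAlgebra.single_mul_single, mul_inv_cancel, mul_one,
      ← MonoidAlgebra.one_def, mul_one]
  rw [e]
  exact mul_mem_commutatorIdeal (sub_mem_commutatorIdeal _ _) _

theorem commutatorIdeal_le_span : commutatorIdeal F (MonoidAlgebra F Γ) ≤
    Submodule.span F {z | ∃ k ∈ commutator Γ, ∃ g, z = subOne F k * MonoidAlgebra.single g 1} := by
  set K := Submodule.span F
    {z | ∃ k ∈ commutator Γ, ∃ g : Γ, z = subOne F k * MonoidAlgebra.single g 1}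
  have single_eq (g : Γ) (r : F) : MonoidAlgebra.single g r = r • MonoidAlgebra.single g 1 := by
    simp
  have hr (z : MonoidAlgebra F Γ) (hz : z ∈ K) (a : MonoidAlgebra F Γ) : z * a ∈ K := by
    induction a using MonoidAlgebra.induction_linear with
    | zero => simp
    | add a b ha hb => rw [mul_add]; exact add_mem ha hb
    | single h r =>
      rw [single_eq, mul_smul_comm]
      refine Submodule.smul_mem _ _ ?_
      induction hz using Submodule.span_induction with
      | mem z hz =>
        obtain ⟨k, hk, g, rfl⟩ := hz
        rw [mul_assoc, MonoidAlgebra.single_mul_single, mul_one]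
        exact Submodule.subset_span ⟨k, hk, g * h, rfl⟩
      | zero => simp
      | add x y _ _ hx hy => rw [add_mul]; exact add_mem hx hy
      | smul r x _ hx => rw [smul_mul_assoc]; exact Submodule.smul_mem _ _ hx
  have hl (z : MonoidAlgebra F Γ) (hz : z ∈ K) (a : MonoidAlgebra F Γ) : a * z ∈ K := by
    induction a using MonoidAlgebra.induction_linear with
    | zero => simp
    | add a b ha hb => rw [add_mul]; exact add_mem ha hb
    | single h r =>
      rw [single_eq, smul_mul_assoc]
      refine Submodule.smul_mem _ _ ?_
      induction hz using Submodule.span_induction with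
      | mem z hz =>
        obtain ⟨k, hk, g, rfl⟩ := hz
        rw [← mul_assoc, single_mul_subOne, mul_assoc, MonoidAlgebra.single_mul_single, mul_one]
        exact Submodule.subset_span
          ⟨_, Subgroup.Normal.conj_mem inferInstance k hk h, h * g, rfl⟩
      | zero => simp
      | add x y _ _ hx hy => rw [mul_add]; exact add_mem hx hy
      | smul r x _ hx => rw [mul_smul_comm]; exact Submodule.smul_mem _ _ hx
  refine Submodule.span_le.2 ?_
  rintro _ ⟨a, b, c, d, rfl⟩
  refine hr _ (hl _ ?_ _) _
  induction b using MonoidAlgebra.induction_linear with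
  | zero => simp
  | add b b' hb hb' => rw [add_mul, mul_add, add_sub_add_comm]; exact add_mem hb hb'
  | single g r =>
    induction c using MonoidAlgebra.induction_linear with
    | zero => simp
    | add b b' hb hb' => rw [add_mul, mul_add, add_sub_add_comm]; exact add_mem hb hb'
    | single h s =>
      rw [single_eq g, single_eq h, smul_mul_smul_comm, smul_mul_smul_comm, mul_comm s r, ← smul_sub,
        MonoidAlgebra.single_mul_single, MonoidAlgebra.single_mul_single, mul_one,
        single_mul_sub_single_mul]
      exact Submodule.smul_mem _ _ (Submodule.subset_span
        ⟨_, Subgroup.commutator_mem_commutator (Subgroup.mem_top g) (Subgroup.mem_top h), _, rfl⟩)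

theorem subOne_mem_commutatorIdeal_sq {p : ℕ} [hp : Fact p.Prime] [CharP F p] {w : Γ}
    (hw : w ∈ agemo p (commutator Γ)) : subOne F w ∈
      commutatorIdeal F (MonoidAlgebra F Γ) * commutatorIdeal F (MonoidAlgebra F Γ) := by
  refine subOne_mem_of_mem_closure
    (I := (commutatorIdeal F (MonoidAlgebra F Γ) *
      commutatorIdeal F (MonoidAlgebra F Γ)).toAddSubgroup)
    (fun z hz a ↦ mul_mem_commutatorIdeal_sq hz a) ?_ hw
  rintro _ ⟨k, hk, rfl⟩
  have hpow := subOne_pow (F := F) (c := k) p 1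
  rw [pow_one, ← Nat.add_sub_cancel' hp.out.two_le, pow_add, pow_two] at hpow
  rw [← Nat.add_sub_cancel' hp.out.two_le, ← hpow]
  have hkI := subOne_mem_commutatorIdeal (F := F) hk
  exact mul_mem_commutatorIdeal_sq (Submodule.mul_mem_mul hkI hkI) _

/-- In the group algebra of a finite `p`-group with cyclic derived subgroup, the commutator ideal
is central modulo its square. -/
theorem sub_mem_commutatorIdeal_sq {p : ℕ} [Fact p.Prime] [CharP F p] [Finite Γ]
    (hΓ : IsPGroup p Γ) (hΓ' : IsCyclic (commutator Γ)) {a : MonoidAlgebra F Γ}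
    (ha : a ∈ commutatorIdeal F (MonoidAlgebra F Γ)) (b : MonoidAlgebra F Γ) :
    a * b - b * a ∈
      commutatorIdeal F (MonoidAlgebra F Γ) * commutatorIdeal F (MonoidAlgebra F Γ) := by
  have ha' := commutatorIdeal_le_span ha
  clear ha
  induction ha' using Submodule.span_induction with
  | zero => simp
  | add x y _ _ hx hy => rw [add_mul, mul_add, add_sub_add_comm]; exact add_mem hx hy
  | smul r x _ hx =>
    rw [smul_mul_assoc, mul_smul_comm, ← smul_sub]; exact Submodule.smul_mem _ _ hx
  | mem z hz =>
    obtain ⟨k, hk, g, rfl⟩ := hz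
    induction b using MonoidAlgebra.induction_linear with
    | zero => simp
    | add b b' hb hb' => rw [mul_add, add_mul, add_sub_add_comm]; exact add_mem hb hb'
    | single h r =>
      set b := MonoidAlgebra.single h r
      have h1 : b * subOne F k = subOne F (h * k * h⁻¹) * b := by
        simp [b, subOne, mul_sub, sub_mul, MonoidAlgebra.single_mul_single]
      have h2 : subOne F (h * k * h⁻¹) =
          subOne F (h * k * h⁻¹ * k⁻¹) * MonoidAlgebra.single k 1 + subOne F k := by
        rw [← subOne_mul, inv_mul_cancel_right]
      have h3 : subOne F k * MonoidAlgebra.single g 1 * b - b * (subOne F k *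
          MonoidAlgebra.single g 1) = subOne F k * (MonoidAlgebra.single g 1 * b -
          b * MonoidAlgebra.single g 1) - subOne F (h * k * h⁻¹ * k⁻¹) * (MonoidAlgebra.single k 1 *
          (b * MonoidAlgebra.single g 1)) := by
        rw [← mul_assoc b, h1, h2]
        noncomm_ring
      rw [h3]
      exact sub_mem (Submodule.mul_mem_mul (subOne_mem_commutatorIdeal hk)
        (sub_mem_commutatorIdeal _ _)) (mul_mem_commutatorIdeal_sq
          (subOne_mem_commutatorIdeal_sq (conj_mul_inv_mem_agemo hΓ hΓ' hk h)) _)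

end CommutatorIdeal

section DerivedSubgroup

open scoped commutatorElement

variable {Γ Δ : Type*} [Group Γ] [Group Δ]

theorem mul_inv_out_mem_commutator (g : Γ) :
    g * ((g : Γ ⧸ commutator Γ).out)⁻¹ ∈ commutator Γ := by
  rw [← QuotientGroup.eq_one_iff, QuotientGroup.mk_mul, QuotientGroup.mk_inv,
    QuotientGroup.out_eq', mul_inv_cancel]

/-- The factor in `Γ'` of an element of `Γ`, relative to the chosen transversal. -/
noncomputable def commutatorPart (g : Γ) : commutator Γ := ⟨_, mul_inv_out_mem_commutator g⟩

theorem commutatorPart_mul (k : commutator Γ) (g : Γ) :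
    commutatorPart (k * g : Γ) = k * commutatorPart g := by
  have h : ((k * g : Γ) : Γ ⧸ commutator Γ) = g := by
    rw [QuotientGroup.mk_mul, (QuotientGroup.eq_one_iff (k : Γ)).2 k.2, one_mul]
  ext
  simp only [commutatorPart, Subgroup.coe_mul, h, mul_assoc]

variable {F : Type*} [Field F]

theorem functional_commutatorPart_eq_zero (f : commutator Γ →* Multiplicative F)
    {z : MonoidAlgebra F Γ}
    (hz : z ∈ commutatorIdeal F (MonoidAlgebra F Γ) * commutatorIdeal F (MonoidAlgebra F Γ)) :
    functional (fun g ↦ (f (commutatorPart g)).toAdd) z = 0 := by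
  have hz' := mul_le_mul' commutatorIdeal_le_span commutatorIdeal_le_span hz
  rw [Submodule.span_mul_span] at hz'
  refine (Submodule.span_le (p := LinearMap.ker _)).2 ?_ hz'
  rintro _ ⟨_, ⟨k, hk, g, rfl⟩, _, ⟨l, hl, h, rfl⟩, rfl⟩
  have hl' : g * l * g⁻¹ ∈ commutator Γ := Subgroup.Normal.conj_mem inferInstance l hl g
  have e : subOne F k * MonoidAlgebra.single g 1 * (subOne F l * MonoidAlgebra.single h 1) =
      subOne F k * (subOne F (g * l * g⁻¹) * MonoidAlgebra.single (g * h) 1) := by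
    rw [mul_assoc (subOne F k), ← mul_assoc (MonoidAlgebra.single g 1), single_mul_subOne, mul_assoc,
      MonoidAlgebra.single_mul_single, mul_one]
  have h1 := commutatorPart_mul ⟨k, hk⟩ (g * h)
  have h2 := commutatorPart_mul ⟨_, hl'⟩ (g * h)
  have h3 := commutatorPart_mul ⟨k, hk⟩ (g * l * g⁻¹ * (g * h))
  simp only [SetLike.mem_coe, LinearMap.mem_ker, e]
  simp only [subOne, sub_mul, mul_sub, one_mul, MonoidAlgebra.single_mul_single, map_sub,
    functional_single, h1, h2, h3, map_mul, toAdd_mul]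
  ring

theorem hom_conjNormal_eq (f : commutator Γ →* Multiplicative F)
    (hcomm : ∀ a ∈ commutatorIdeal F (MonoidAlgebra F Γ), ∀ b, a * b - b * a ∈
      commutatorIdeal F (MonoidAlgebra F Γ) * commutatorIdeal F (MonoidAlgebra F Γ))
    (g : Γ) (k : commutator Γ) : f (MulAut.conjNormal g k) = f k := by
  have h := functional_commutatorPart_eq_zero f
    (hcomm _ (subOne_mem_commutatorIdeal k.2) (MonoidAlgebra.single g 1))
  rw [single_mul_subOne, ← sub_mul] at h
  have h1 := commutatorPart_mul k g
  have h2 := commutatorPart_mul (MulAut.conjNormal g k) g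
  rw [MulAut.conjNormal_apply] at h2
  simp only [subOne, sub_mul, map_sub, MonoidAlgebra.single_mul_single, functional_single, h1, h2,
    map_mul, toAdd_mul, one_mul] at h
  exact Multiplicative.toAdd.injective (by linear_combination -h)

theorem isCyclic_commutator_of_hom_conjNormal_eq {p : ℕ} [Fact p.Prime] [CharP F p] [Finite Γ]
    (hΓ : IsPGroup p Γ) (hgen : ∃ x y : Γ, Subgroup.closure {x, y} = ⊤)
    (hconj : ∀ (f : commutator Γ →* Multiplicative F) (g : Γ) (k : commutator Γ),
      f (MulAut.conjNormal g k) = f k) : IsCyclic (commutator Γ) := by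
  obtain ⟨x, y, hxy⟩ := hgen
  have hc : ⁅x, y⁆ ∈ commutator Γ :=
    Subgroup.commutator_mem_commutator (Subgroup.mem_top x) (Subgroup.mem_top y)
  have htop : Subgroup.closure {(⟨_, hc⟩ : commutator Γ)} = ⊤ := by
    refine closure_eq_top_of_forall_hom F (hΓ.to_subgroup _) fun f hf ↦ ?_
    have hfc := hf _ rfl
    let N : Subgroup Γ := f.ker.map (commutator Γ).subtype
    have hN : N.Normal := by
      refine ⟨?_⟩
      rintro _ ⟨k, hk, rfl⟩ g
      exact ⟨MulAut.conjNormal g k, (hconj f g k).trans hk, MulAut.conjNormal_apply g k⟩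
    have hcl : Subgroup.closure {(x : Γ ⧸ N), (y : Γ ⧸ N)} = ⊤ := by
      have := congrArg (Subgroup.map (QuotientGroup.mk' N)) hxy
      rwa [MonoidHom.map_closure, Set.image_pair,
        Subgroup.map_top_of_surjective _ (QuotientGroup.mk'_surjective N)] at this
    have hxy' : Commute (x : Γ ⧸ N) (y : Γ ⧸ N) := by
      rw [← commutatorElement_eq_one_iff_commute]
      exact (QuotientGroup.eq_one_iff (N := N) ⁅x, y⁆).2 ⟨⟨_, hc⟩, hfc, rfl⟩
    have hle : commutator Γ ≤ N := by
      rw [← Subgroup.Normal.quotient_commutative_iff_commutator_le]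
      have hx := commute_of_closure_pair hcl (Commute.refl _) hxy'
      have hy := commute_of_closure_pair hcl hxy'.symm (Commute.refl _)
      exact ⟨⟨fun a b ↦ commute_of_closure_pair hcl (hx a).symm (hy a).symm b⟩⟩
    ext k
    obtain ⟨k', hk', hkk⟩ := hle k.2
    obtain rfl : k' = k := Subtype.ext hkk
    exact congrArg _ hk'
  rw [isCyclic_iff_exists_zpowers_eq_top]
  exact ⟨_, by rwa [Subgroup.zpowers_eq_closure]⟩

/-- For two-generated finite `p`-groups, cyclicity of the derived subgroup is determined by the
group algebra over a field of characteristic `p`. -/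
theorem isCyclic_commutator_of_algEquiv {p : ℕ} [Fact p.Prime] [CharP F p] [Finite Γ] [Finite Δ]
    (hΓ : IsPGroup p Γ) (hΓ' : IsCyclic (commutator Γ)) (hΔ : IsPGroup p Δ)
    (hgen : ∃ x y : Δ, Subgroup.closure {x, y} = ⊤)
    (φ : MonoidAlgebra F Γ ≃ₐ[F] MonoidAlgebra F Δ) : IsCyclic (commutator Δ) := by
  refine isCyclic_commutator_of_hom_conjNormal_eq (F := F) hΔ hgen fun f ↦
    hom_conjNormal_eq f fun a ha b ↦ ?_
  have ha' := map_commutatorIdeal_le φ.symm.toAlgHom (Submodule.mem_map_of_mem ha)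
  have h := map_mem_commutatorIdeal_sq φ.toAlgHom
    (sub_mem_commutatorIdeal_sq hΓ hΓ' ha' (φ.symm b))
  simpa using h

theorem exists_isPCPresented_quotient {p : ℕ} [Fact p.Prime] [Finite Γ] (hΓ : IsPGroup p Γ)
    (hΓ' : IsCyclic (commutator Γ)) (hgen : ∃ x y : Γ, Subgroup.closure {x, y} = ⊤) :
    ∃ (m n e i j : ℕ) (x y c : Γ ⧸ agemo p (commutator Γ)),
      n ≤ m ∧ e ≤ 1 ∧ IsPCPresented p m n e i j x y c := by
  obtain ⟨x, y, hxy⟩ := hgen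
  have hc : ⁅x⁻¹, y⁻¹⁆ ∈ commutator Γ :=
    Subgroup.commutator_mem_commutator (Subgroup.mem_top _) (Subgroup.mem_top _)
  have hcomm (g : Γ) : Commute ((⁅x⁻¹, y⁻¹⁆ : Γ) : Γ ⧸ agemo p (commutator Γ)) g := by
    have := (QuotientGroup.eq_one_iff _).2 (conj_mul_inv_mem_agemo hΓ hΓ' hc g)
    simp only [QuotientGroup.mk_mul, QuotientGroup.mk_inv] at this
    exact ((mul_inv_eq_iff_eq_mul.1 (mul_inv_eq_one.1 this)).symm)
  refine exists_isPCPresented (hΓ.to_quotient _) (u := (x : Γ ⧸ agemo p (commutator Γ)))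
    (v := (y : Γ ⧸ agemo p (commutator Γ))) ?_ ?_ (hcomm x) (hcomm y) ?_
  · have := congrArg (Subgroup.map (QuotientGroup.mk' (agemo p (commutator Γ)))) hxy
    rwa [MonoidHom.map_closure, Set.image_pair,
      Subgroup.map_top_of_surjective _ (QuotientGroup.mk'_surjective _)] at this
  · rw [← QuotientGroup.mk_mul, ← QuotientGroup.mk_mul, ← QuotientGroup.mk_mul, commutatorElement_def]
    congr 1
    group
  · exact (QuotientGroup.eq_one_iff _).2 (pow_mem_agemo hc)

end DerivedSubgroup

section Quotient

variable {p : ℕ} [hp : Fact p.Prime] {F : Type*} [Field F] {Γ Δ Λ : Type*}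
  [Group Γ] [Group Δ] [Group Λ] {m n e i j : ℕ} {x y c : Λ}

theorem IsPCPresented.exists_eq_mul_subOne (h : IsPCPresented p m n e i j x y c)
    {z : MonoidAlgebra F Λ} (hz : z ∈ commutatorIdeal F (MonoidAlgebra F Λ)) :
    ∃ d, z = d * subOne F c := by
  have hle : commutatorIdeal F (MonoidAlgebra F Λ) ≤
      (Ideal.span {subOne F c}).restrictScalars F := by
    refine Submodule.span_le.2 ?_
    rintro _ ⟨a, b, b', d, rfl⟩
    obtain ⟨r, hr⟩ := h.exists_sub_eq b b'
    refine Ideal.mem_span_singleton'.2 ⟨a * r * d, ?_⟩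
    rw [hr, (subOne_commute h.commute_c r).eq, mul_assoc _ d, ← (subOne_commute h.commute_c d).eq]
    simp only [mul_assoc]
  obtain ⟨d, hd⟩ := Ideal.mem_span_singleton'.1 (hle hz)
  exact ⟨d, hd.symm⟩

variable [CharP F p]

theorem IsPCPresented.map_subOne_eq_zero (h : IsPCPresented p m n e i j x y c) (he : e ≤ 1)
    (f : MonoidAlgebra F Γ →ₐ[F] MonoidAlgebra F Λ) {w : Γ} (hw : w ∈ agemo p (commutator Γ)) :
    f (subOne F w) = 0 := by
  refine subOne_mem_of_mem_closure (I := f.toLinearMap.ker.toAddSubgroup)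
    (fun z hz a ↦ ?_) ?_ hw
  · have hz' : f z = 0 := hz
    exact (map_mul f z a).trans (by rw [hz', zero_mul])
  · rintro _ ⟨k, hk, rfl⟩
    obtain ⟨d, hd⟩ := h.exists_eq_mul_subOne (map_commutatorIdeal_le f
      (Submodule.mem_map_of_mem (subOne_mem_commutatorIdeal (F := F) hk)))
    have hd' : f (subOne F k) = d * subOne F c := hd
    have hk' := subOne_pow (F := F) (c := k) p 1
    have hc' := subOne_pow (F := F) (c := c) p 1
    rw [pow_one] at hk' hc'
    have : f (subOne F (k ^ p)) = 0 := by
      rw [← hk', map_pow, hd', (subOne_commute h.commute_c d).symm.mul_pow, hc', h.c_pow_p he,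
        subOne_one, mul_zero]
    exact this

theorem IsPCPresented.exists_algHom_quotient (h : IsPCPresented p m n e i j x y c) (he : e ≤ 1)
    (f : MonoidAlgebra F Γ →ₐ[F] MonoidAlgebra F Λ) :
    ∃ ψ : MonoidAlgebra F (Γ ⧸ agemo p (commutator Γ)) →ₐ[F] MonoidAlgebra F Λ,
      ψ.comp (MonoidAlgebra.mapDomainAlgHom F F (QuotientGroup.mk' (agemo p (commutator Γ)))) =
        f := by
  let g : Γ →* MonoidAlgebra F Λ := (f : MonoidAlgebra F Γ →* MonoidAlgebra F Λ).comp
    (MonoidAlgebra.of F Γ)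
  have hg : agemo p (commutator Γ) ≤ g.ker := fun w hw ↦ by
    have := h.map_subOne_eq_zero he f hw
    rw [subOne, map_sub, map_one, sub_eq_zero] at this
    exact this
  refine ⟨MonoidAlgebra.lift F _ _ (QuotientGroup.lift _ g hg), ?_⟩
  refine MonoidAlgebra.algHom_ext (fun w ↦ ?_) (by ext)
  simp [g]

theorem algHom_quotient_ext {N : Subgroup Γ} [N.Normal] {A : Type*} [Ring A] [Algebra F A]
    {ψ ψ' : MonoidAlgebra F (Γ ⧸ N) →ₐ[F] A}
    (h : ψ.comp (MonoidAlgebra.mapDomainAlgHom F F (QuotientGroup.mk' N)) =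
      ψ'.comp (MonoidAlgebra.mapDomainAlgHom F F (QuotientGroup.mk' N))) : ψ = ψ' := by
  refine MonoidAlgebra.algHom_ext (fun q ↦ ?_) (by ext)
  obtain ⟨w, rfl⟩ := QuotientGroup.mk'_surjective N q
  simpa using DFunLike.congr_fun h (MonoidAlgebra.single w 1)

theorem nonempty_algEquiv_quotient {m' n' e' i' j' : ℕ}
    {x y c : Γ ⧸ agemo p (commutator Γ)} {x' y' c' : Δ ⧸ agemo p (commutator Δ)}
    (h : IsPCPresented p m n e i j x y c) (he : e ≤ 1)
    (h' : IsPCPresented p m' n' e' i' j' x' y' c') (he' : e' ≤ 1)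
    (φ : MonoidAlgebra F Γ ≃ₐ[F] MonoidAlgebra F Δ) :
    Nonempty (MonoidAlgebra F (Γ ⧸ agemo p (commutator Γ)) ≃ₐ[F]
      MonoidAlgebra F (Δ ⧸ agemo p (commutator Δ))) := by
  set πΓ := MonoidAlgebra.mapDomainAlgHom F F (QuotientGroup.mk' (agemo p (commutator Γ)))
  set πΔ := MonoidAlgebra.mapDomainAlgHom F F (QuotientGroup.mk' (agemo p (commutator Δ)))
  obtain ⟨ψ, hψ⟩ := h'.exists_algHom_quotient he' (πΔ.comp φ.toAlgHom)
  obtain ⟨χ, hχ⟩ := h.exists_algHom_quotient he (πΓ.comp φ.symm.toAlgHom)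
  have hψ' (a) : ψ (πΓ a) = πΔ (φ a) := DFunLike.congr_fun hψ a
  have hχ' (a) : χ (πΔ a) = πΓ (φ.symm a) := DFunLike.congr_fun hχ a
  exact ⟨AlgEquiv.ofAlgHom ψ χ
    (algHom_quotient_ext (AlgHom.ext fun a ↦ by
      change ψ (χ (πΔ a)) = πΔ a
      rw [hχ', hψ', φ.apply_symm_apply]))
    (algHom_quotient_ext (AlgHom.ext fun a ↦ by
      change χ (ψ (πΓ a)) = πΓ a
      rw [hψ', hχ', φ.symm_apply_apply]))⟩

end Quotient

/-- If `G` is a finite two-generated `p`-group with cyclic derived subgroup and `F[G] ≅ F[H]`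
over a field `F` of characteristic `p`, then `G/℧(G') ≅ H/℧(H')`. -/
theorem quotient_agemo_commutator_invariant (p : ℕ) [Fact p.Prime]
    (F : Type*) [Field F] [CharP F p]
    (G H : Type*) [Group G] [Finite G] [Group H] [Finite H]
    (hG : IsPGroup p G) (hG' : IsCyclic (commutator G))
    (hgen : ∃ x y : G, Subgroup.closure {x, y} = ⊤)
    (hiso : Nonempty (MonoidAlgebra F G ≃ₐ[F] MonoidAlgebra F H)) :
    Nonempty ((G ⧸ agemo p (commutator G)) ≃* (H ⧸ agemo p (commutator H))) := by
  obtain ⟨φ⟩ := hiso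
  obtain ⟨k, hk⟩ := IsPGroup.iff_card.1 hG
  have hH : IsPGroup p H := IsPGroup.of_card ((card_eq_of_algEquiv φ).symm.trans hk)
  have hgenH := exists_closure_pair_of_algEquiv hG hH φ hgen
  have hH' := isCyclic_commutator_of_algEquiv hG hG' hH hgenH φ
  obtain ⟨m, n, e, i, j, x, y, c, hnm, he, h⟩ := exists_isPCPresented_quotient hG hG' hgen
  obtain ⟨m', n', e', i', j', x', y', c', hnm', he', h'⟩ :=
    exists_isPCPresented_quotient hH hH' hgenH
  obtain ⟨ψ⟩ := nonempty_algEquiv_quotient h he h' he' φ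
  exact h.nonempty_mulEquiv_of_algEquiv hnm he h' hnm' he' ψ
end

section
/- For every integer n ≥ 4, the group G = T1(n) of order 3^n satisfies S(G) = 16 + 2·3^{n−2}, where S(G) = Σ_C log₃ |C_G(g_C)/Frat(C_G(g_C))|, the sum running over the conjugacy classes C of G with g_C ∈ C an arbitrary representative (the summand does not depend on the choice of representative). -/
/-- The commutator `[x,y] = x⁻¹y⁻¹xy`. -/
def gpComm {G : Type*} [Group G] (x y : G) : G := x⁻¹ * y⁻¹ * x * y

namespace MaxClass3

/-- The free generators `a`, `b`, `c`, `d`. -/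
abbrev a : FreeGroup (Fin 4) := FreeGroup.of 0
abbrev b : FreeGroup (Fin 4) := FreeGroup.of 1
abbrev c : FreeGroup (Fin 4) := FreeGroup.of 2
abbrev d : FreeGroup (Fin 4) := FreeGroup.of 3

/-- The word representing the central element `z`. -/
def zWord (n : ℕ) : FreeGroup (Fin 4) :=
  if Even n then d ^ ((-3 : ℤ) ^ ((n - 4) / 2)) else c ^ ((-3 : ℤ) ^ ((n - 3) / 2))

/-- Relators of the group `𝒦(n)`: `c = [b,a]`, `d = [c,a]`, `[d,a] = c⁻³d⁻³`,
`[d,b] = [d,c] = 1`, together with the exponent relations depending on the parity of `n`. -/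
def Krels (n : ℕ) : Set (FreeGroup (Fin 4)) :=
  {c⁻¹ * gpComm b a, d⁻¹ * gpComm c a, gpComm d a * d ^ 3 * c ^ 3, gpComm d b, gpComm d c} ∪
    (if Even n then {c ^ 3 ^ ((n - 2) / 2), d ^ 3 ^ ((n - 2) / 2)}
     else {c ^ 3 ^ ((n - 1) / 2), d ^ 3 ^ ((n - 3) / 2)})

/-- Relators of `T1(n)`: those of `𝒦(n)` together with `a³ = 1`, `b³ = c⁻³d⁻¹`, `[c,b] = 1`. -/
def T1rels (n : ℕ) : Set (FreeGroup (Fin 4)) :=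
  Krels n ∪ {a ^ 3, b ^ 3 * d * c ^ 3, gpComm c b}

/-- The group `T1(n)`. -/
abbrev T1 (n : ℕ) : Type := PresentedGroup (T1rels n)

end MaxClass3

/-- `S(G) = Σ_C log₃ |C_G(g_C)/Frat(C_G(g_C))|`, the sum over the conjugacy classes `C` of `G`
of the `3`-logarithm of the order of the Frattini quotient of the centralizer of a
representative of `C`. -/
noncomputable def SInvariant (G : Type*) [Group G] : ℕ :=
  ∑ᶠ C : ConjClasses G,
    Nat.log 3 (Nat.card
      (↥(Subgroup.centralizer {(ConjClasses.exists_rep C).choose}) ⧸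
        frattini ↥(Subgroup.centralizer {(ConjClasses.exists_rep C).choose})))

theorem IsPGroup.index_of_isCoatom {p : ℕ} [Fact p.Prime] {P : Type*} [Group P] [Finite P]
    (hP : IsPGroup p P) {K : Subgroup P} (hK : IsCoatom K) : K.index = p := by
  obtain ⟨k, hk⟩ := IsPGroup.iff_card.mp (hP.to_subgroup K)
  obtain ⟨m, hm⟩ := hP.index K
  have hm0 : m ≠ 0 := by
    rintro rfl
    exact hK.1 (Subgroup.index_eq_one.mp (by simpa using hm))
  have hcard := K.card_mul_index
  rw [hk, hm] at hcard
  have hdvd : p ^ (k + 1) ∣ Nat.card P := by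
    rw [← hcard, ← pow_add]
    exact pow_dvd_pow _ (by omega)
  obtain ⟨L, hL, hKL⟩ := Sylow.exists_subgroup_card_pow_succ hdvd hk
  have hp : p.Prime := Fact.out
  have hne : K ≠ L := by
    rintro rfl
    have := Nat.pow_right_injective hp.two_le (hk.symm.trans hL)
    omega
  have hLt : L = ⊤ := hK.2 L (lt_of_le_of_ne hKL hne)
  rw [hLt, Subgroup.card_top, ← hcard, pow_succ] at hL
  rw [hm]
  exact Nat.eq_of_mul_eq_mul_left (pow_pos hp.pos k) hL

theorem IsPGroup.normal_of_isCoatom {p : ℕ} [Fact p.Prime] {P : Type*} [Group P] [Finite P]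
    (hP : IsPGroup p P) {K : Subgroup P} (hK : IsCoatom K) : K.Normal := by
  have := hP.isNilpotent
  exact Subgroup.NormalizerCondition.normal_of_coatom K Group.normalizerCondition_of_isNilpotent hK

theorem IsPGroup.commutator_mem_frattini {p : ℕ} [Fact p.Prime] {P : Type*} [Group P] [Finite P]
    (hP : IsPGroup p P) (x y : P) : x * y * x⁻¹ * y⁻¹ ∈ frattini P := by
  simp only [frattini, Order.radical, Subgroup.mem_iInf]
  intro K hK
  have := hP.normal_of_isCoatom hK
  have hcyc : IsCyclic (P ⧸ K) := isCyclic_of_prime_card (hP.index_of_isCoatom hK)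
  rw [← QuotientGroup.eq_one_iff]
  have hcomm : (x : P ⧸ K) * y = y * x := mul_comm' _ _
  rw [QuotientGroup.mk_mul, QuotientGroup.mk_mul, QuotientGroup.mk_mul, hcomm]
  simp

theorem IsPGroup.pow_mem_frattini {p : ℕ} [Fact p.Prime] {P : Type*} [Group P] [Finite P]
    (hP : IsPGroup p P) (x : P) : x ^ p ∈ frattini P := by
  simp only [frattini, Order.radical, Subgroup.mem_iInf]
  intro K hK
  have := hP.normal_of_isCoatom hK
  have h := K.pow_index_mem x
  rwa [hP.index_of_isCoatom hK] at h

theorem IsPGroup.card_quotient_frattini {p : ℕ} [Fact p.Prime] {P : Type*} [Group P] [Finite P]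
    (hP : IsPGroup p P) {x y : P} (hxy : Subgroup.closure {x, y} = ⊤) (hnc : ¬ IsCyclic P) :
    Nat.card (P ⧸ frattini P) = p ^ 2 := by
  have hp : p.Prime := Fact.out
  obtain ⟨k, hk⟩ := IsPGroup.iff_card.mp (hP.to_quotient (frattini P))
  have hlower : 2 ≤ k := by
    by_contra! hlt
    have hcyc : IsCyclic (P ⧸ frattini P) := by
      interval_cases k
      · have : Subsingleton (P ⧸ frattini P) := (Nat.card_eq_one_iff_unique.mp (by simpa using hk)).1
        infer_instance
      · exact isCyclic_of_prime_card (by simpa using hk)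
    obtain ⟨g, hg⟩ := hcyc.exists_generator
    obtain ⟨g, rfl⟩ := QuotientGroup.mk_surjective g
    refine hnc ⟨g, fun w => ?_⟩
    have htop : Subgroup.zpowers g = ⊤ := by
      apply frattini_nongenerating
      rw [eq_top_iff]
      intro w _
      obtain ⟨m, hm⟩ := hg w
      have hmem : (g ^ m)⁻¹ * w ∈ frattini P := QuotientGroup.eq.mp (by simpa using hm)
      have := Subgroup.mul_mem_sup (Subgroup.zpow_mem_zpowers g m) hmem
      simpa using this
    have hw : w ∈ Subgroup.zpowers g := htop ▸ Subgroup.mem_top w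
    exact hw
  have hupper : Nat.card (P ⧸ frattini P) ≤ p ^ 2 := by
    let _ : CommGroup (P ⧸ frattini P) :=
      { (inferInstance : Group (P ⧸ frattini P)) with
        mul_comm := by
          intro u v
          obtain ⟨u, rfl⟩ := QuotientGroup.mk_surjective u
          obtain ⟨v, rfl⟩ := QuotientGroup.mk_surjective v
          have := (QuotientGroup.eq_one_iff _).mpr (hP.commutator_mem_frattini u v)
          rw [QuotientGroup.mk_mul, QuotientGroup.mk_mul, QuotientGroup.mk_mul,
            QuotientGroup.mk_inv, QuotientGroup.mk_inv, mul_inv_eq_one, mul_inv_eq_iff_eq_mul] at this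
          exact this }
    have hpow (u : P ⧸ frattini P) : u ^ (p : ℤ) = 1 := by
      obtain ⟨u, rfl⟩ := QuotientGroup.mk_surjective u
      rw [zpow_natCast]
      exact (QuotientGroup.eq_one_iff _).mpr (hP.pow_mem_frattini u)
    have hmod (u : P ⧸ frattini P) (m : ℤ) : u ^ (m % p) = u ^ m := by
      conv_rhs => rw [← Int.emod_add_mul_ediv m p, zpow_add, zpow_mul, hpow, one_zpow, mul_one]
    have hpz : (p : ℤ) ≠ 0 := by exact_mod_cast hp.ne_zero
    have hsurj : Function.Surjective fun ij : Fin p × Fin p =>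
        (x : P ⧸ frattini P) ^ (ij.1 : ℕ) * (y : P ⧸ frattini P) ^ (ij.2 : ℕ) := by
      intro w
      have hw : w ∈ Subgroup.closure {(x : P ⧸ frattini P), (y : P ⧸ frattini P)} := by
        obtain ⟨w, rfl⟩ := QuotientGroup.mk_surjective w
        have := Subgroup.mem_map_of_mem (QuotientGroup.mk' (frattini P))
          (show w ∈ Subgroup.closure {x, y} by rw [hxy]; trivial)
        rw [MonoidHom.map_closure, Set.image_pair] at this
        exact this
      obtain ⟨i, j, rfl⟩ := Subgroup.mem_closure_pair.mp hw
      have key (m : ℤ) : ∃ l : Fin p, ((l : ℕ) : ℤ) = m % p :=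
        ⟨⟨(m % p).toNat, by
            have := Int.emod_lt_of_pos m (b := p) (by positivity)
            have := Int.emod_nonneg m hpz
            omega⟩,
          by simpa using Int.emod_nonneg m hpz⟩
      obtain ⟨i', hi⟩ := key i
      obtain ⟨j', hj⟩ := key j
      refine ⟨(i', j'), ?_⟩
      simp only
      rw [← zpow_natCast, ← zpow_natCast, hi, hj, hmod, hmod]
    refine (Nat.card_le_card_of_surjective _ hsurj).trans ?_
    simp [sq]
  rw [hk] at hupper ⊢
  have := (Nat.pow_le_pow_iff_right hp.one_lt).mp hupper
  congr 1
  omega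

theorem card_quotient_frattini_congr {G H : Type*} [Group G] [Group H] (e : G ≃* H) :
    Nat.card (G ⧸ frattini G) = Nat.card (H ⧸ frattini H) := by
  refine Nat.card_congr (QuotientGroup.congr _ _ e ?_).toEquiv
  refine le_antisymm ?_ ?_
  · rw [Subgroup.map_le_iff_le_comap]
    exact frattini_le_comap_frattini_of_surjective (φ := e.toMonoidHom) e.surjective
  · rw [Subgroup.map_equiv_eq_comap_symm]
    exact frattini_le_comap_frattini_of_surjective (φ := e.symm.toMonoidHom) e.symm.surjective

/-- The restriction of an isomorphism to the centralizers of corresponding elements. -/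
def MulEquiv.centralizerCongr {G H : Type*} [Group G] [Group H] (e : G ≃* H) (g : G) :
    Subgroup.centralizer {g} ≃* Subgroup.centralizer {e g} where
  toEquiv := e.toEquiv.subtypeEquiv fun h => by
    simp [Subgroup.mem_centralizer_singleton_iff, ← map_mul]
  map_mul' _ _ := Subtype.ext (map_mul e _ _)

theorem SInvariant_eq_mul_card_conjClasses {G : Type*} [Group G] [Finite G] {k : ℕ}
    (h : ∀ g : G, Nat.card (Subgroup.centralizer {g} ⧸ frattini (Subgroup.centralizer {g})) =
      3 ^ k) :
    SInvariant G = k * Nat.card (ConjClasses G) := by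
  have := Fintype.ofFinite (ConjClasses G)
  simp [SInvariant, h, Nat.log_pow, finsum_eq_sum_of_fintype, mul_comm]

theorem not_isCyclic_of_pow_eq_one {G : Type*} [Group G] [Finite G] {u v : G}
    (hu : u ^ 3 = 1) (hv : v ^ 3 = 1) (hu1 : u ≠ 1) (hvu : v ∉ Subgroup.zpowers u) :
    ¬ IsCyclic G := by
  intro hG
  classical
  have := Fintype.ofFinite G
  have hord : orderOf u = 3 := orderOf_eq_prime hu hu1
  have hle : Nat.card (Subgroup.zpowers u) = 3 := by rw [Nat.card_zpowers, hord]
  have hfin : ((Subgroup.zpowers u : Set G).toFinset).card = 3 := by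
    rw [Set.toFinset_card, ← Nat.card_eq_fintype_card]; exact hle
  have hsub : insert v (Subgroup.zpowers u : Set G).toFinset ⊆ ({x | x ^ 3 = 1} : Finset G) := by
    intro w hw
    simp only [Finset.mem_insert, Set.mem_toFinset, SetLike.mem_coe] at hw
    simp only [Finset.mem_filter, Finset.mem_univ, true_and]
    rcases hw with rfl | ⟨m, rfl⟩
    · exact hv
    · simp only
      rw [← zpow_natCast, ← zpow_mul, mul_comm, zpow_mul, zpow_natCast, hu, one_zpow]
  have h1 := Finset.card_le_card hsub
  rw [Finset.card_insert_of_notMem (by simpa using hvu), hfin] at h1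
  have h2 := IsCyclic.card_pow_eq_one_le (α := G) (n := 3) (by norm_num)
  omega

theorem card_conjClasses_congr {G H : Type*} [Group G] [Group H] (e : G ≃* H) :
    Nat.card (ConjClasses G) = Nat.card (ConjClasses H) :=
  Nat.card_congr (Quotient.congr e.toEquiv fun x y => by
    change IsConj x y ↔ IsConj (e x) (e y)
    exact ⟨fun h => e.toMonoidHom.map_isConj h, fun h => by
      simpa using e.symm.toMonoidHom.map_isConj h⟩)

namespace MaxClass3

/-- The additive group of `ℤ[ω]/(ω - 1)^(n-1)` with `ω` a primitive cube root of unity, in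
coordinates with respect to the basis `1`, `ω - 1`. -/
abbrev Lattice (n : ℕ) : Type := ZMod (3 ^ (n / 2)) × ZMod (3 ^ ((n - 1) / 2))

theorem Lattice.exists_intCast {n : ℕ} (r : Lattice n) :
    ∃ x y : ℤ, r = ((x : ZMod (3 ^ (n / 2))), (y : ZMod (3 ^ ((n - 1) / 2)))) := by
  obtain ⟨x, hx⟩ := ZMod.intCast_surjective r.1
  obtain ⟨y, hy⟩ := ZMod.intCast_surjective r.2
  exact ⟨x, y, Prod.ext hx.symm hy.symm⟩

/-- Multiplication by `3` as a map between the two factors of `Lattice n`. -/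
def triple (n : ℕ) : ZMod (3 ^ ((n - 1) / 2)) →+ ZMod (3 ^ (n / 2)) :=
  ZMod.lift _ ⟨zmultiplesHom _ 3, by
    have h : ((3 ^ ((n - 1) / 2) * 3 : ℕ) : ZMod (3 ^ (n / 2))) = 0 := by
      rw [ZMod.natCast_eq_zero_iff, ← pow_succ]
      exact pow_dvd_pow _ (by omega)
    simpa using h⟩

theorem triple_intCast (n : ℕ) (y : ℤ) : triple n y = ((3 * y : ℤ) : ZMod (3 ^ (n / 2))) := by
  simp [triple, mul_comm]

/-- Multiplication by `ω - 1` on `ℤ[ω]/(ω - 1)^(n-1)`. -/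
def shift (n : ℕ) : AddMonoid.End (Lattice n) where
  toFun r := (-triple n r.2,
    ZMod.castHom (pow_dvd_pow 3 (by omega : (n - 1) / 2 ≤ n / 2)) (ZMod (3 ^ ((n - 1) / 2))) r.1 -
      3 * r.2)
  map_zero' := by simp
  map_add' r s := by
    refine Prod.ext ?_ ?_
    · simp only [Prod.snd_add, Prod.mk_add_mk, map_add]
      abel
    · simp only [Prod.snd_add, Prod.fst_add, Prod.mk_add_mk, map_add]
      ring

theorem shift_intCast (n : ℕ) (x y : ℤ) :
    shift n ((x : ZMod (3 ^ (n / 2))), (y : ZMod (3 ^ ((n - 1) / 2)))) =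
      (((-3 * y : ℤ) : ZMod (3 ^ (n / 2))), ((x - 3 * y : ℤ) : ZMod (3 ^ ((n - 1) / 2)))) := by
  refine Prod.ext ?_ ?_
  · have : (shift n (x, y)).1 = -triple n y := rfl
    rw [this, triple_intCast]
    push_cast
    ring
  · have : (shift n (x, y)).2 = ZMod.castHom (pow_dvd_pow 3 (by omega : (n - 1) / 2 ≤ n / 2))
      (ZMod (3 ^ ((n - 1) / 2))) x - 3 * y := rfl
    rw [this, map_intCast]
    push_cast
    ring

/-- Multiplication by `ω` on `ℤ[ω]/(ω - 1)^(n-1)`. -/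
def rot (n : ℕ) : AddMonoid.End (Lattice n) := 1 + shift n

theorem rot_intCast (n : ℕ) (x y : ℤ) :
    rot n ((x : ZMod (3 ^ (n / 2))), (y : ZMod (3 ^ ((n - 1) / 2)))) =
      (((x - 3 * y : ℤ) : ZMod (3 ^ (n / 2))), ((x - 2 * y : ℤ) : ZMod (3 ^ ((n - 1) / 2)))) := by
  have : rot n ((x : ZMod (3 ^ (n / 2))), (y : ZMod (3 ^ ((n - 1) / 2)))) =
    ((x : ZMod (3 ^ (n / 2))), (y : ZMod (3 ^ ((n - 1) / 2)))) + shift n (x, y) := rfl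
  rw [this, shift_intCast, Prod.mk_add_mk]
  push_cast
  ring_nf

theorem rot_apply (n : ℕ) (r : Lattice n) : rot n r = r + shift n r := rfl

theorem rot_rot_apply (n : ℕ) (r : Lattice n) : rot n (rot n r) = -r - rot n r := by
  obtain ⟨x, y, rfl⟩ := r.exists_intCast
  rw [rot_intCast, rot_intCast, Prod.neg_mk, Prod.mk_sub_mk]
  refine Prod.ext ?_ ?_ <;> push_cast <;> ring

theorem rot_pow_three (n : ℕ) : rot n ^ 3 = 1 := by
  refine AddMonoidHom.ext fun r => ?_
  have : (rot n ^ 3 : AddMonoid.End (Lattice n)) r = rot n (rot n (rot n r)) := by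
    rw [pow_succ, sq]; rfl
  refine this.trans ?_
  rw [rot_rot_apply, rot_rot_apply]
  exact (by abel : -rot n r - (-r - rot n r) = r)

/-- The action of `ℤ/3` on `ℤ[ω]/(ω - 1)^(n-1)` by powers of `ω`. -/
def act (n : ℕ) (i : ZMod 3) : AddMonoid.End (Lattice n) := rot n ^ i.val

theorem act_zero (n : ℕ) : act n 0 = 1 := by simp [act]

theorem act_one (n : ℕ) : act n 1 = rot n := by simp [act, ZMod.val_one]

theorem act_add (n : ℕ) (i j : ZMod 3) : act n (i + j) = act n i * act n j := by
  rw [act, act, act, ← pow_add, ZMod.val_add]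
  exact (pow_eq_pow_mod _ (rot_pow_three n)).symm


theorem act_add_apply (n : ℕ) (i j : ZMod 3) (r : Lattice n) :
    act n (i + j) r = act n i (act n j r) := by
  rw [act_add]; rfl

@[simp]
theorem act_zero_apply (n : ℕ) (r : Lattice n) : act n 0 r = r := by
  rw [act_zero]; rfl

theorem act_one_apply (n : ℕ) (r : Lattice n) : act n 1 r = rot n r := by
  rw [act_one]

theorem act_two_apply (n : ℕ) (r : Lattice n) : act n 2 r = -r - rot n r := by
  rw [show (2 : ZMod 3) = 1 + 1 from rfl, act_add_apply, act_one_apply, act_one_apply, rot_rot_apply]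

theorem zmod_three_eq_zero_or_one_or_two (i : ZMod 3) : i = 0 ∨ i = 1 ∨ i = 2 := by
  revert i; decide

theorem exists_shift_eq_act_sub (n : ℕ) (i : ZMod 3) (r : Lattice n) :
    ∃ s, shift n s = act n i r - r := by
  rcases zmod_three_eq_zero_or_one_or_two i with rfl | rfl | rfl
  · exact ⟨0, by simp⟩
  · exact ⟨r, by rw [act_one_apply, rot_apply]; abel⟩
  · refine ⟨-act n 2 r, ?_⟩
    have h : rot n (act n 2 r) = r := by
      rw [← act_one_apply, ← act_add_apply]
      exact act_zero_apply n r
    rw [rot_apply, ← eq_sub_iff_add_eq'] at h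
    rw [map_neg, h]
    abel

theorem exists_act_sub_eq_shift (n : ℕ) {i : ZMod 3} (hi : i ≠ 0) (s : Lattice n) :
    ∃ r, act n i r - r = shift n s := by
  rcases zmod_three_eq_zero_or_one_or_two i with rfl | rfl | rfl
  · exact absurd rfl hi
  · exact ⟨s, by rw [act_one_apply, rot_apply]; abel⟩
  · refine ⟨-rot n s, ?_⟩
    have h : act n 2 (rot n s) = s := by
      rw [← act_one_apply, ← act_add_apply]
      exact act_zero_apply n s
    rw [map_neg, h, rot_apply]
    abel

/-- `shift n` as a homomorphism. -/
def shiftHom (n : ℕ) : Lattice n →+ Lattice n := shift n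

/-- The reduction of `ℤ[ω]/(ω - 1)^(n-1)` modulo `ω - 1`. -/
def residue {n : ℕ} (hn : 2 ≤ n) : Lattice n →+ ZMod 3 :=
  (ZMod.castHom (dvd_pow_self 3 (by omega : n / 2 ≠ 0)) (ZMod 3)).toAddMonoidHom.comp
    (AddMonoidHom.fst _ _)

theorem residue_intCast {n : ℕ} (hn : 2 ≤ n) (x : ℤ) (y : ZMod (3 ^ ((n - 1) / 2))) :
    residue hn ((x : ZMod (3 ^ (n / 2))), y) = x :=
  map_intCast (ZMod.castHom (dvd_pow_self 3 (by omega : n / 2 ≠ 0)) (ZMod 3)) x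

theorem range_shiftHom {n : ℕ} (hn : 2 ≤ n) : (shiftHom n).range = (residue hn).ker := by
  ext r
  rw [AddMonoidHom.mem_ker, AddMonoidHom.mem_range]
  constructor
  · rintro ⟨s, rfl⟩
    obtain ⟨x, y, rfl⟩ := s.exists_intCast
    change residue hn (shift n _) = 0
    rw [shift_intCast, residue_intCast, ZMod.intCast_zmod_eq_zero_iff_dvd]
    exact ⟨-y, by push_cast; ring⟩
  · intro h
    obtain ⟨x, y, rfl⟩ := r.exists_intCast
    rw [residue_intCast, ZMod.intCast_zmod_eq_zero_iff_dvd] at h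
    obtain ⟨k, rfl⟩ := h
    refine ⟨(((y - 3 * k : ℤ) : ZMod (3 ^ (n / 2))), ((-k : ℤ) : ZMod (3 ^ ((n - 1) / 2)))), ?_⟩
    refine (shift_intCast n _ _).trans ?_
    refine Prod.ext ?_ ?_ <;> push_cast <;> ring

theorem card_range_shiftHom {n : ℕ} (hn : 2 ≤ n) :
    Nat.card (shiftHom n).range * 3 = Nat.card (Lattice n) := by
  have hsurj : Function.Surjective (residue hn) := fun i => by
    obtain ⟨x, rfl⟩ := ZMod.intCast_surjective i
    exact ⟨((x : ZMod (3 ^ (n / 2))), 0), residue_intCast hn x 0⟩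
  have h := (residue hn).ker.card_mul_index
  rwa [AddSubgroup.index_ker, AddMonoidHom.range_eq_top.mpr hsurj, AddSubgroup.card_top,
    Nat.card_zmod, ← range_shiftHom hn] at h

theorem card_ker_shiftHom {n : ℕ} (hn : 2 ≤ n) : Nat.card (shiftHom n).ker = 3 := by
  have h := (shiftHom n).ker.card_mul_index
  rw [AddSubgroup.index_ker, ← card_range_shiftHom hn, mul_comm] at h
  exact Nat.eq_of_mul_eq_mul_left Nat.card_pos h

/-- The obstruction to commuting of two elements of `Model n` with rotations `i` and `j`. -/
def commHom (n : ℕ) (i j : ZMod 3) : Lattice n × Lattice n →+ Lattice n where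
  toFun p := (act n j p.1 - p.1) - (act n i p.2 - p.2)
  map_zero' := by simp
  map_add' p q := by
    simp only [Prod.fst_add, Prod.snd_add, map_add]
    abel

theorem range_commHom (n : ℕ) {i j : ZMod 3} (hij : (i, j) ≠ 0) :
    (commHom n i j).range = (shiftHom n).range := by
  apply le_antisymm
  · rintro _ ⟨⟨r, s⟩, rfl⟩
    obtain ⟨u, hu⟩ := exists_shift_eq_act_sub n j r
    obtain ⟨v, hv⟩ := exists_shift_eq_act_sub n i s
    refine ⟨u - v, (map_sub (shift n) u v).trans ?_⟩
    rw [hu, hv]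
    rfl
  · rintro _ ⟨s, rfl⟩
    by_cases hj : j = 0
    · have hi : i ≠ 0 := fun hi => hij (by rw [hi, hj]; rfl)
      obtain ⟨r, hr⟩ := exists_act_sub_eq_shift n hi (-s)
      refine ⟨(0, r), ?_⟩
      change (act n j 0 - 0) - (act n i r - r) = shift n s
      rw [hr, map_zero, map_neg]
      abel
    · obtain ⟨r, hr⟩ := exists_act_sub_eq_shift n hj s
      refine ⟨(r, 0), ?_⟩
      change (act n j r - r) - (act n i 0 - 0) = shift n s
      rw [hr, map_zero]
      abel

theorem card_ker_commHom {n : ℕ} (hn : 2 ≤ n) {i j : ZMod 3} (hij : (i, j) ≠ 0) :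
    Nat.card (commHom n i j).ker = 3 * Nat.card (Lattice n) := by
  have h := (commHom n i j).ker.card_mul_index
  rw [AddSubgroup.index_ker, range_commHom n hij, Nat.card_prod] at h
  have hr := card_range_shiftHom hn
  refine Nat.eq_of_mul_eq_mul_right (Nat.card_pos (α := (shiftHom n).range)) ?_
  rw [h, ← hr]
  ring

theorem card_ker_commHom_zero (n : ℕ) :
    Nat.card (commHom n 0 0).ker = Nat.card (Lattice n) ^ 2 := by
  have : commHom n 0 0 = 0 := by
    ext1 p
    change (act n 0 p.1 - p.1) - (act n 0 p.2 - p.2) = 0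
    simp
  rw [this, AddMonoidHom.ker_zero, AddSubgroup.card_top, Nat.card_prod, sq]

/-- The split extension of `ℤ[ω]/(ω - 1)^(n-1)` by the cyclic group of order `3` generated by `ω`;
the pair `(r, i)` represents `ω^i` times `r`. -/
@[ext]
structure Model (n : ℕ) where
  /-- The component in the abelian normal subgroup. -/
  vec : Lattice n
  /-- The exponent of `ω`. -/
  rotation : ZMod 3

namespace Model

variable {n : ℕ}

instance : Mul (Model n) := ⟨fun x y => ⟨act n y.rotation x.vec + y.vec, x.rotation + y.rotation⟩⟩

instance : One (Model n) := ⟨⟨0, 0⟩⟩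

instance : Inv (Model n) := ⟨fun x => ⟨-act n (-x.rotation) x.vec, -x.rotation⟩⟩

@[simp] theorem vec_mul (x y : Model n) : (x * y).vec = act n y.rotation x.vec + y.vec := rfl

@[simp] theorem rotation_mul (x y : Model n) : (x * y).rotation = x.rotation + y.rotation := rfl

@[simp] theorem vec_one : (1 : Model n).vec = 0 := rfl

@[simp] theorem rotation_one : (1 : Model n).rotation = 0 := rfl

@[simp] theorem vec_inv (x : Model n) : x⁻¹.vec = -act n (-x.rotation) x.vec := rfl

@[simp] theorem rotation_inv (x : Model n) : x⁻¹.rotation = -x.rotation := rfl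

instance : Group (Model n) := Group.ofLeftAxioms
  (fun x y z => by
    ext1
    · simp only [vec_mul, rotation_mul, map_add, ← act_add_apply, add_assoc]
      rw [add_comm z.rotation]
    · simp [add_assoc])
  (fun x => by ext1 <;> simp)
  (fun x => by
    ext1
    · simp [← act_add_apply]
    · simp)

/-- The coordinates of an element. -/
def coords (n : ℕ) : Model n ≃ Lattice n × ZMod 3 where
  toFun x := (x.vec, x.rotation)
  invFun p := ⟨p.1, p.2⟩

instance : Finite (Model n) := Finite.of_equiv _ (coords n).symm

theorem card_lattice (hn : 1 ≤ n) : Nat.card (Lattice n) = 3 ^ (n - 1) := by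
  rw [Nat.card_prod, Nat.card_zmod, Nat.card_zmod, ← pow_add]
  congr 1
  omega

theorem card_model (hn : 1 ≤ n) : Nat.card (Model n) = 3 ^ n := by
  rw [Nat.card_congr (coords n), Nat.card_prod, card_lattice hn, Nat.card_zmod, ← pow_succ]
  congr 1
  omega

/-- The projection onto the group of rotations. -/
def rotationHom (n : ℕ) : Model n →* Multiplicative (ZMod 3) where
  toFun x := Multiplicative.ofAdd x.rotation
  map_one' := rfl
  map_mul' _ _ := rfl

theorem rotation_zpow (x : Model n) (k : ℤ) : (x ^ k).rotation = k * x.rotation := by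
  have := congrArg Multiplicative.toAdd (map_zpow (rotationHom n) x k)
  simpa [rotationHom] using this

/-- The inclusion of the abelian normal subgroup. -/
def translation (n : ℕ) : Multiplicative (Lattice n) →* Model n where
  toFun r := ⟨r.toAdd, 0⟩
  map_one' := rfl
  map_mul' r s := by ext1 <;> simp

theorem mk_zero_zpow (r : Lattice n) (k : ℤ) : (⟨r, 0⟩ : Model n) ^ k = ⟨k • r, 0⟩ :=
  (map_zpow (translation n) (Multiplicative.ofAdd r) k).symm

theorem mk_zero_pow (r : Lattice n) (k : ℕ) : (⟨r, 0⟩ : Model n) ^ k = ⟨k • r, 0⟩ :=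
  (map_pow (translation n) (Multiplicative.ofAdd r) k).symm

theorem pow_three_of_rotation_ne_zero (x : Model n) (hx : x.rotation ≠ 0) : x ^ 3 = 1 := by
  obtain ⟨r, i⟩ := x
  have hsum : act n i (act n i r) + act n i r + r = 0 := by
    rcases zmod_three_eq_zero_or_one_or_two i with rfl | rfl | rfl
    · exact absurd rfl hx
    · rw [act_one_apply, act_one_apply, rot_rot_apply]
      abel
    · rw [act_two_apply, act_two_apply, map_sub, map_neg, rot_rot_apply]
      abel
  ext1
  · simp [pow_succ, hsum]
  · have : ∀ i : ZMod 3, i + i + i = 0 := by decide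
    simp [pow_succ, this]

theorem commute_iff (x y : Model n) :
    Commute x y ↔ (x.vec, y.vec) ∈ (commHom n x.rotation y.rotation).ker := by
  rw [commute_iff_eq, Model.ext_iff, AddMonoidHom.mem_ker]
  change act n y.rotation x.vec + y.vec = act n x.rotation y.vec + x.vec ∧ _ ↔
    act n y.rotation x.vec - x.vec - (act n x.rotation y.vec - y.vec) = 0
  rw [rotation_mul, rotation_mul, add_comm y.rotation, and_iff_left rfl, ← sub_eq_zero]
  congr! 1
  abel

/-- Commuting pairs, sorted by their rotations. -/
def commutingPairsEquiv (n : ℕ) :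
    {p : Model n × Model n // Commute p.1 p.2} ≃
      Σ ij : ZMod 3 × ZMod 3, (commHom n ij.1 ij.2).ker where
  toFun p := ⟨(p.1.1.rotation, p.1.2.rotation), ⟨(p.1.1.vec, p.1.2.vec), (commute_iff _ _).mp p.2⟩⟩
  invFun q := ⟨(⟨q.2.1.1, q.1.1⟩, ⟨q.2.1.2, q.1.2⟩), (commute_iff _ _).mpr q.2.2⟩

theorem card_commutingPairs (hn : 2 ≤ n) :
    Nat.card {p : Model n × Model n // Commute p.1 p.2} =
      Nat.card (Lattice n) * (Nat.card (Lattice n) + 24) := by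
  rw [Nat.card_congr (commutingPairsEquiv n), Nat.card_sigma,
    ← Finset.add_sum_erase _ _ (Finset.mem_univ (0 : ZMod 3 × ZMod 3)),
    Finset.sum_congr rfl fun ij h => card_ker_commHom hn (Finset.ne_of_mem_erase h)]
  rw [Finset.sum_const, Finset.card_erase_of_mem (Finset.mem_univ _)]
  simp only [Prod.fst_zero, Prod.snd_zero, card_ker_commHom_zero, Finset.card_univ,
    Fintype.card_prod, ZMod.card, smul_eq_mul]
  ring

theorem card_conjClasses (hn : 2 ≤ n) : Nat.card (ConjClasses (Model n)) = 8 + 3 ^ (n - 2) := by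
  have h := card_comm_eq_card_conjClasses_mul_card (Model n)
  rw [card_commutingPairs hn, card_lattice (by omega), card_model (by omega)] at h
  obtain ⟨k, rfl⟩ := Nat.exists_eq_add_of_le' hn
  simp only [Nat.add_sub_cancel, show k + 2 - 1 = k + 1 by omega] at h ⊢
  refine Nat.eq_of_mul_eq_mul_right (pow_pos (by norm_num : 0 < 3) (k + 2)) ?_
  rw [← h]
  ring

theorem mk_zero_mul_mk (i : ZMod 3) (r : Lattice n) : (⟨0, i⟩ * ⟨r, 0⟩ : Model n) = ⟨r, i⟩ := by
  ext1 <;> simp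

theorem act_eq_self_of_shift_eq_zero {r : Lattice n} (hr : shift n r = 0) (i : ZMod 3) :
    act n i r = r := by
  have h1 : rot n r = r := by rw [rot_apply, hr, add_zero]
  have h2 (k : ℕ) : (rot n ^ k : AddMonoid.End (Lattice n)) r = r := by
    induction k with
    | zero => rfl
    | succ k ih =>
      rw [pow_succ]
      change (rot n ^ k : AddMonoid.End (Lattice n)) (rot n r) = r
      rw [h1, ih]
  exact h2 _

theorem shift_eq_zero_of_act_eq_self {r : Lattice n} {i : ZMod 3} (hi : i ≠ 0)
    (hr : act n i r = r) : shift n r = 0 := by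
  suffices h : rot n r = r by simpa [rot_apply] using h
  rcases zmod_three_eq_zero_or_one_or_two i with rfl | rfl | rfl
  · exact absurd rfl hi
  · rwa [act_one_apply] at hr
  · rw [← act_one_apply, show (1 : ZMod 3) = 2 + 2 from rfl, act_add_apply, hr, hr]

theorem exists_fixed_vec (hn : 2 ≤ n) : ∃ z : Lattice n, z ≠ 0 ∧ shift n z = 0 ∧
    ∀ r, shift n r = 0 → ∃ k : ℤ, r = k • z := by
  have hcard := card_ker_shiftHom hn
  have hfact : Fact (Nat.Prime 3) := ⟨Nat.prime_three⟩
  have : Nontrivial (shiftHom n).ker := Finite.one_lt_card_iff_nontrivial.mp (by omega)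
  obtain ⟨z, hz⟩ := exists_ne (0 : (shiftHom n).ker)
  refine ⟨z, fun h => hz (Subtype.ext h), z.2, fun r hr => ?_⟩
  obtain ⟨k, hk⟩ := mem_zmultiples_of_prime_card hcard hz (g' := ⟨r, hr⟩)
  exact ⟨k, (congrArg Subtype.val hk).symm⟩

theorem smul_eq_zero_of_shift_eq_zero {r : Lattice n} (hr : shift n r = 0) : 3 • r = 0 := by
  have h := rot_rot_apply n r
  rw [rot_apply n r, hr, add_zero, rot_apply, hr, add_zero] at h
  have : 3 • r = r - (-r - r) := by abel
  rw [this, ← h, sub_self]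

theorem mem_centralizer_iff_commute {G : Type*} [Group G] {g h : G} :
    h ∈ Subgroup.centralizer {g} ↔ Commute g h := by
  rw [Subgroup.mem_centralizer_singleton_iff, commute_iff_eq, eq_comm]

theorem commute_mk_zero_iff (x : Model n) (s : Lattice n) :
    Commute x ⟨s, 0⟩ ↔ act n x.rotation s = s := by
  rw [commute_iff, AddMonoidHom.mem_ker]
  change act n 0 x.vec - x.vec - (act n x.rotation s - s) = 0 ↔ _
  rw [act_zero_apply, sub_self, zero_sub, neg_eq_zero, sub_eq_zero]

variable (n) in
/-- The image of the generator `a`. -/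
def genA : Model n := ⟨0, 1⟩

variable (n) in
/-- The image of the generator `b`. -/
def genB : Model n := ⟨(1, 0), 0⟩

variable (n) in
/-- The image of the generator `c`. -/
def genC : Model n := ⟨(0, 1), 0⟩

variable (n) in
/-- The image of the generator `d`. -/
def genD : Model n := ⟨(-3, -3), 0⟩

theorem genA_rotation_ne_zero : (genA n).rotation ≠ 0 := (by decide : (1 : ZMod 3) ≠ 0)

theorem genA_zpow (i : ℤ) : genA n ^ i = ⟨0, i⟩ := by
  have h : Commute (genA n) ⟨0, 0⟩ := (commute_mk_zero_iff _ _).mpr (map_zero _)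
  have h0 : ∀ k : ℕ, genA n ^ k = ⟨0, k⟩ := by
    intro k
    induction k with
    | zero => ext1 <;> simp
    | succ k ih => rw [pow_succ, ih]; ext1 <;> simp [genA]
  rcases i with k | k
  · simpa using h0 k
  · rw [zpow_negSucc, h0]; ext1 <;> simp

theorem genB_zpow_mul_genC_zpow (x y : ℤ) : genB n ^ x * genC n ^ y = ⟨(x, y), 0⟩ := by
  rw [genB, genC, mk_zero_zpow, mk_zero_zpow]
  ext1
  · simp
  · simp

theorem normal_form (i x y : ℤ) : genA n ^ i * genB n ^ x * genC n ^ y = ⟨(x, y), i⟩ := by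
  rw [mul_assoc, genB_zpow_mul_genC_zpow, genA_zpow, mk_zero_mul_mk]

theorem exists_normal_form (g : Model n) :
    ∃ i x y : ℤ, g = genA n ^ i * genB n ^ x * genC n ^ y := by
  obtain ⟨r, i⟩ := g
  obtain ⟨x, y, rfl⟩ := r.exists_intCast
  obtain ⟨i, rfl⟩ := ZMod.intCast_surjective i
  exact ⟨i, x, y, (normal_form i x y).symm⟩

theorem gpComm_genA (r : Lattice n) : gpComm ⟨r, 0⟩ (genA n) = ⟨shift n r, 0⟩ := by
  rw [gpComm, mul_assoc, ← mul_inv_rev, inv_mul_eq_iff_eq_mul]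
  ext1 <;> simp [genA, act_one_apply, rot_apply]

theorem gpComm_eq_one_iff {G : Type*} [Group G] {x y : G} : gpComm x y = 1 ↔ Commute x y := by
  rw [gpComm, mul_assoc, ← mul_inv_rev, inv_mul_eq_one, commute_iff_eq, eq_comm]

theorem gpComm_mk_zero (r s : Lattice n) : gpComm (⟨r, 0⟩ : Model n) ⟨s, 0⟩ = 1 :=
  gpComm_eq_one_iff.mpr ((commute_mk_zero_iff _ _).mpr (act_zero_apply n s))

theorem shift_one_zero : shift n (1, 0) = (0, 1) := by
  simpa using shift_intCast n 1 0

theorem shift_zero_one : shift n (0, 1) = (-3, -3) := by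
  simpa using shift_intCast n 0 1

theorem closure_genA_genB : Subgroup.closure {genA n, genB n} = ⊤ := by
  rw [eq_top_iff]
  intro g _
  have hA : genA n ∈ Subgroup.closure {genA n, genB n} := Subgroup.subset_closure (by simp)
  have hB : genB n ∈ Subgroup.closure {genA n, genB n} := Subgroup.subset_closure (by simp)
  have hC : genC n ∈ Subgroup.closure {genA n, genB n} := by
    have : genC n = gpComm (genB n) (genA n) := by
      rw [genB, gpComm_genA, shift_one_zero, genC]
    rw [this, gpComm]
    exact mul_mem (mul_mem (mul_mem (inv_mem hB) (inv_mem hA)) hB) hA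
  obtain ⟨i, x, y, rfl⟩ := exists_normal_form g
  exact mul_mem (mul_mem (zpow_mem hA i) (zpow_mem hB x)) (zpow_mem hC y)

theorem card_quotient_frattini_of_closure_eq {G : Type*} [Group G] [Finite G] (hG : IsPGroup 3 G)
    {K : Subgroup G} {x y u v : G} (hK : Subgroup.closure {x, y} = K) (hu : u ∈ K) (hv : v ∈ K)
    (hu3 : u ^ 3 = 1) (hv3 : v ^ 3 = 1) (hu1 : u ≠ 1) (hvu : v ∉ Subgroup.zpowers u) :
    Nat.card (K ⧸ frattini K) = 3 ^ 2 := by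
  have hfact : Fact (Nat.Prime 3) := ⟨Nat.prime_three⟩
  subst hK
  have hx : x ∈ Subgroup.closure {x, y} := Subgroup.subset_closure (by simp)
  have hy : y ∈ Subgroup.closure {x, y} := Subgroup.subset_closure (by simp)
  refine (hG.to_subgroup _).card_quotient_frattini (x := ⟨x, hx⟩) (y := ⟨y, hy⟩) ?_ ?_
  · rw [← Subgroup.closure_closure_coe_preimage]
    congr 1
    ext w
    simp [Subtype.ext_iff]
  · refine not_isCyclic_of_pow_eq_one (u := ⟨u, hu⟩) (v := ⟨v, hv⟩) (Subtype.ext hu3)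
      (Subtype.ext hv3) (fun h => hu1 (congrArg Subtype.val h)) ?_
    rintro ⟨k, hk⟩
    exact hvu ⟨k, congrArg Subtype.val hk⟩

theorem mk_notMem_zpowers {r : Lattice n} {g : Model n} (hg : g.rotation ≠ 0) :
    g ∉ Subgroup.zpowers (⟨r, 0⟩ : Model n) := by
  rintro ⟨k, rfl⟩
  exact hg (by simp [rotation_zpow])

theorem mk_zero_pow_three {r : Lattice n} (hr : shift n r = 0) : (⟨r, 0⟩ : Model n) ^ 3 = 1 := by
  rw [mk_zero_pow, smul_eq_zero_of_shift_eq_zero hr]; rfl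

theorem isPGroup (hn : 1 ≤ n) : IsPGroup 3 (Model n) := IsPGroup.of_card (card_model hn)

theorem closure_eq_centralizer_of_rotation_ne_zero {g : Model n} (hg : g.rotation ≠ 0)
    {z : Lattice n} (hz : shift n z = 0) (hgen : ∀ r, shift n r = 0 → ∃ k : ℤ, r = k • z) :
    Subgroup.closure {g, ⟨z, 0⟩} = Subgroup.centralizer {g} := by
  have hgz : Commute g ⟨z, 0⟩ := (commute_mk_zero_iff _ _).mpr (act_eq_self_of_shift_eq_zero hz _)
  apply le_antisymm
  · rw [Subgroup.closure_le]
    rintro _ (rfl | rfl)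
    · exact mem_centralizer_iff_commute.mpr (Commute.refl _)
    · exact mem_centralizer_iff_commute.mpr hgz
  · intro h hh
    rw [mem_centralizer_iff_commute] at hh
    obtain ⟨k, hk⟩ : ∃ k : ℤ, (k : ZMod 3) * g.rotation = h.rotation := by
      obtain ⟨k, hk⟩ := ZMod.intCast_surjective (h.rotation * g.rotation)
      refine ⟨k, ?_⟩
      have : ∀ i j : ZMod 3, i ≠ 0 → j * i * i = j := by decide
      rw [hk, this _ _ hg]
    have hrot : (g ^ (-k) * h).rotation = 0 := by
      rw [rotation_mul, rotation_zpow, ← hk]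
      push_cast
      ring
    have hcomm : Commute g (g ^ (-k) * h) := ((Commute.refl g).zpow_right _).mul_right hh
    obtain ⟨s, hs⟩ : ∃ s, g ^ (-k) * h = ⟨s, 0⟩ := ⟨_, Model.ext rfl hrot⟩
    rw [hs, commute_mk_zero_iff] at hcomm
    obtain ⟨l, rfl⟩ := hgen s (shift_eq_zero_of_act_eq_self hg hcomm)
    have heq : h = g ^ k * ⟨z, 0⟩ ^ l := by
      rw [mk_zero_zpow, ← hs, zpow_neg, mul_inv_cancel_left]
    rw [heq]
    exact mul_mem (zpow_mem (Subgroup.subset_closure (by simp)) k)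
      (zpow_mem (Subgroup.subset_closure (by simp)) l)

theorem centralizer_eq_top {g : Model n} (hg : g.rotation = 0) (hs : shift n g.vec = 0) :
    Subgroup.centralizer {g} = ⊤ := by
  rw [eq_top_iff]
  intro h _
  obtain ⟨r, i⟩ := g
  obtain rfl : i = 0 := hg
  rw [mem_centralizer_iff_commute]
  exact ((commute_mk_zero_iff _ _).mpr (act_eq_self_of_shift_eq_zero hs _)).symm

theorem closure_genB_genC_eq_centralizer {g : Model n} (hg : g.rotation = 0)
    (hs : shift n g.vec ≠ 0) :
    Subgroup.closure {genB n, genC n} = Subgroup.centralizer {g} := by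
  obtain ⟨r, i⟩ := g
  obtain rfl : i = 0 := hg
  apply le_antisymm
  · rw [Subgroup.closure_le]
    rintro _ (rfl | rfl) <;>
      exact mem_centralizer_iff_commute.mpr ((commute_mk_zero_iff _ _).mpr (act_zero_apply n _))
  · intro h hh
    rw [mem_centralizer_iff_commute] at hh
    have hrot : h.rotation = 0 := by
      by_contra hne
      exact hs (shift_eq_zero_of_act_eq_self hne ((commute_mk_zero_iff _ _).mp hh.symm))
    obtain ⟨s, j⟩ := h
    obtain rfl : j = 0 := hrot
    obtain ⟨x, y, rfl⟩ := s.exists_intCast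
    rw [← genB_zpow_mul_genC_zpow]
    exact mul_mem (zpow_mem (Subgroup.subset_closure (by simp)) x)
      (zpow_mem (Subgroup.subset_closure (by simp)) y)

theorem zmod_pow_ne_zero {k : ℕ} (hk : k ≠ 0) : (3 ^ (k - 1) : ZMod (3 ^ k)) ≠ 0 := by
  intro h
  have h' : ((3 ^ (k - 1) : ℕ) : ZMod (3 ^ k)) = 0 := by exact_mod_cast h
  rw [ZMod.natCast_eq_zero_iff, Nat.pow_dvd_pow_iff_le_right (by norm_num)] at h'
  omega

theorem zmod_three_mul_pow {k : ℕ} (hk : k ≠ 0) : 3 * (3 ^ (k - 1) : ZMod (3 ^ k)) = 0 := by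
  rw [← pow_succ', Nat.sub_add_cancel (by omega)]
  exact_mod_cast ZMod.natCast_self (3 ^ k)

theorem card_quotient_frattini_centralizer (hn : 3 ≤ n) (g : Model n) :
    Nat.card (Subgroup.centralizer {g} ⧸ frattini (Subgroup.centralizer {g})) = 3 ^ 2 := by
  obtain ⟨z, hz0, hz, hgen⟩ := exists_fixed_vec (n := n) (by omega)
  have hP := isPGroup (n := n) (by omega)
  have hz1 : (⟨z, 0⟩ : Model n) ≠ 1 := fun h => hz0 (congrArg Model.vec h)
  by_cases hg : g.rotation = 0
  · by_cases hs : shift n g.vec = 0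
    · refine card_quotient_frattini_of_closure_eq hP (u := ⟨z, 0⟩) (v := genA n)
        (closure_genA_genB.trans (centralizer_eq_top hg hs).symm) ?_ ?_ (mk_zero_pow_three hz)
        (pow_three_of_rotation_ne_zero _ genA_rotation_ne_zero) hz1
        (mk_notMem_zpowers genA_rotation_ne_zero)
      all_goals rw [centralizer_eq_top hg hs]; trivial
    · have hmem (r : Lattice n) : (⟨r, 0⟩ : Model n) ∈ Subgroup.centralizer {g} := by
        rw [mem_centralizer_iff_commute, commute_mk_zero_iff, hg, act_zero_apply]
      have hp : n / 2 ≠ 0 := by omega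
      have hq : (n - 1) / 2 ≠ 0 := by omega
      refine card_quotient_frattini_of_closure_eq hP (closure_genB_genC_eq_centralizer hg hs)
        (hmem (3 ^ (n / 2 - 1), 0)) (hmem (0, 3 ^ ((n - 1) / 2 - 1))) ?_ ?_ ?_ ?_
      · rw [mk_zero_pow, nsmul_eq_mul]
        exact Model.ext (Prod.ext (zmod_three_mul_pow hp) (mul_zero _)) rfl
      · rw [mk_zero_pow, nsmul_eq_mul]
        exact Model.ext (Prod.ext (mul_zero _) (zmod_three_mul_pow hq)) rfl
      · exact fun h => zmod_pow_ne_zero hp (congrArg (fun x => x.vec.1) h)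
      · rintro ⟨k, hk⟩
        refine zmod_pow_ne_zero hq ((congrArg (fun x => x.vec.2) hk).symm.trans ?_)
        simp [mk_zero_zpow]
  · refine card_quotient_frattini_of_closure_eq hP
      (closure_eq_centralizer_of_rotation_ne_zero hg hz hgen) (u := ⟨z, 0⟩) (v := g) ?_ ?_
      (mk_zero_pow_three hz) (pow_three_of_rotation_ne_zero _ hg) hz1 (mk_notMem_zpowers hg)
    · rw [mem_centralizer_iff_commute, commute_mk_zero_iff]
      exact act_eq_self_of_shift_eq_zero hz _
    · exact mem_centralizer_iff_commute.mpr (Commute.refl _)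

end Model

theorem T1rels_eq {n : ℕ} (hn : 3 ≤ n) : T1rels n =
    {c⁻¹ * gpComm b a, d⁻¹ * gpComm c a, gpComm d a * d ^ 3 * c ^ 3, gpComm d b, gpComm d c,
      c ^ 3 ^ ((n - 1) / 2), d ^ 3 ^ (n / 2 - 1), a ^ 3, b ^ 3 * d * c ^ 3, gpComm c b} := by
  rw [T1rels, Krels]
  by_cases h : Even n
  · obtain ⟨k, rfl⟩ := h
    rw [if_pos ⟨k, rfl⟩, show (k + k - 2) / 2 = (k + k - 1) / 2 by omega,
      show (k + k) / 2 - 1 = (k + k - 1) / 2 by omega]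
    ext
    simp only [Set.mem_union, Set.mem_insert_iff, Set.mem_singleton_iff, or_assoc]
  · have h' := Nat.not_even_iff_odd.mp h
    obtain ⟨k, rfl⟩ := h'
    rw [if_neg h, show (2 * k + 1 - 3) / 2 = (2 * k + 1) / 2 - 1 by omega]
    ext
    simp only [Set.mem_union, Set.mem_insert_iff, Set.mem_singleton_iff, or_assoc]

theorem intCast_eq_zero_of_pow_dvd {k : ℕ} {m : ℤ} (h : (3 : ℤ) ^ k ∣ m) : (m : ZMod (3 ^ k)) = 0 := by
  rw [ZMod.intCast_zmod_eq_zero_iff_dvd]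
  exact_mod_cast h

open Model in
theorem lift_gen_eq_one {n : ℕ} (hn : 3 ≤ n) (r : FreeGroup (Fin 4)) (hr : r ∈ T1rels n) :
    FreeGroup.lift ![genA n, genB n, genC n, genD n] r = 1 := by
  have hgp (f : FreeGroup (Fin 4) →* Model n) (x y) : f (gpComm x y) = gpComm (f x) (f y) := by
    simp [gpComm]
  have hba : gpComm (genB n) (genA n) = genC n := by rw [genB, gpComm_genA, shift_one_zero, genC]
  have hca : gpComm (genC n) (genA n) = genD n := by rw [genC, gpComm_genA, shift_zero_one, genD]
  rw [T1rels_eq hn] at hr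
  simp only [Set.mem_insert_iff, Set.mem_singleton_iff] at hr
  rcases hr with rfl | rfl | rfl | rfl | rfl | rfl | rfl | rfl | rfl | rfl <;>
    simp only [map_mul, map_inv, map_pow, hgp, FreeGroup.lift_apply_of, Matrix.cons_val]
  · rw [hba, inv_mul_cancel]
  · rw [hca, inv_mul_cancel]
  · have h := shift_intCast n (-3) (-3)
    push_cast at h
    rw [genD, gpComm_genA, h, genC, mk_zero_pow, mk_zero_pow]
    ext1
    · refine Prod.ext ?_ ?_ <;> simp <;> ring
    · simp
  · exact gpComm_mk_zero _ _
  · exact gpComm_mk_zero _ _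
  · rw [genC, mk_zero_pow]
    exact Model.ext (Prod.ext (by simp) (by simp)) rfl
  · have h1 : ((3 ^ (n / 2 - 1) * -3 : ℤ) : ZMod (3 ^ (n / 2))) = 0 :=
      intCast_eq_zero_of_pow_dvd ⟨-1, by
        rw [show n / 2 = n / 2 - 1 + 1 by omega, pow_succ]; simp⟩
    have h2 : ((3 ^ (n / 2 - 1) * -3 : ℤ) : ZMod (3 ^ ((n - 1) / 2))) = 0 :=
      intCast_eq_zero_of_pow_dvd (by
        rw [mul_neg, dvd_neg, ← pow_succ]
        exact pow_dvd_pow _ (by omega))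
    push_cast at h1 h2
    rw [genD, mk_zero_pow]
    exact Model.ext (Prod.ext (by simpa using h1) (by simpa using h2)) rfl
  · exact pow_three_of_rotation_ne_zero _ genA_rotation_ne_zero
  · rw [genB, genC, genD, mk_zero_pow, mk_zero_pow]
    ext1
    · refine Prod.ext ?_ ?_ <;> simp
    · simp
  · exact gpComm_mk_zero _ _

/-- The canonical map from `T1 n` to its concrete model. -/
def toModel {n : ℕ} (hn : 3 ≤ n) : T1 n →* Model n :=
  PresentedGroup.toGroup (lift_gen_eq_one hn)

/-- In a group whose elements `a`, `b`, `c`, `d` satisfy the main relations of `T1 n`, the words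
`a^i b^x c^y` exhaust the subgroup generated by `a`, `b`, `c`, `d`. -/
theorem exists_eq_zpow_mul_zpow_mul_zpow {G : Type*} [Group G] {f : Fin 4 → G}
    (hba : gpComm (f 1) (f 0) = f 2) (hca : gpComm (f 2) (f 0) = f 3) (hcb : Commute (f 2) (f 1))
    (ha : f 0 ^ 3 = 1) (hb : f 1 ^ 3 * f 3 * f 2 ^ 3 = 1) {g : G}
    (hg : g ∈ Subgroup.closure (Set.range f)) :
    ∃ i x y : ℤ, g = f 0 ^ i * f 1 ^ x * f 2 ^ y := by
  have hd : f 3 = f 1 ^ (-3 : ℤ) * f 2 ^ (-3 : ℤ) := by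
    have h3 : (3 : ℤ) = (3 : ℕ) := rfl
    rw [mul_eq_one_iff_eq_inv, ← eq_inv_mul_iff_mul_eq] at hb
    rw [zpow_neg, zpow_neg, h3, zpow_natCast, zpow_natCast, hb]
  have hA (i x y : ℤ) : f 0 ^ i * f 1 ^ x * f 2 ^ y * f 0 =
      f 0 ^ (i + 1) * f 1 ^ (x - 3 * y) * f 2 ^ (x - 2 * y) := by
    have h1 : SemiconjBy (f 0) (f 1 * f 2) (f 1) := by
      rw [← hba, gpComm, SemiconjBy]; group
    have h2 : SemiconjBy (f 0) (f 2 * f 3) (f 2) := by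
      rw [← hca, gpComm, SemiconjBy]; group
    have h3 : f 2 * f 3 = f 1 ^ (-3 : ℤ) * f 2 ^ (-2 : ℤ) := by
      rw [hd, ← mul_assoc, (hcb.zpow_right (-3)).eq, mul_assoc, ← zpow_one_add]
      rfl
    rw [h3] at h2
    have h4 := ((h1.zpow_right x).mul_right (h2.zpow_right y)).eq
    rw [mul_assoc, mul_assoc, ← mul_assoc (f 1 ^ x), ← h4, hcb.symm.mul_zpow,
      ((hcb.symm.zpow_zpow (-3) (-2))).mul_zpow, ← zpow_mul, ← zpow_mul, zpow_add_one]
    simp only [mul_assoc]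
    rw [← mul_assoc (f 2 ^ x), (hcb.zpow_zpow x (-3 * y)).eq]
    simp only [mul_assoc, ← zpow_add]
    simp only [← mul_assoc]
    rw [mul_assoc _ (f 1 ^ x), ← zpow_add]
    congr 3 <;> ring
  have hmul (i x y k l : ℤ) : f 0 ^ i * f 1 ^ x * f 2 ^ y * (f 1 ^ k * f 2 ^ l) =
      f 0 ^ i * f 1 ^ (x + k) * f 2 ^ (y + l) := by
    rw [← mul_assoc, mul_assoc _ (f 2 ^ y), (hcb.zpow_zpow y k).eq, zpow_add, zpow_add]
    simp only [mul_assoc]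
  have hbcd (j : Fin 4) (hj : j ≠ 0) : ∃ k l : ℤ, f j = f 1 ^ k * f 2 ^ l := by
    fin_cases j
    · exact absurd rfl hj
    · exact ⟨1, 0, by simp⟩
    · exact ⟨0, 1, by simp⟩
    · exact ⟨-3, -3, hd⟩
  induction hg using Subgroup.closure_induction_right with
  | one => exact ⟨0, 0, 0, by simp⟩
  | mul_right g _ _ hj ih =>
    obtain ⟨j, rfl⟩ := hj
    obtain ⟨i, x, y, rfl⟩ := ih
    by_cases h : j = 0
    · rw [h]
      exact ⟨_, _, _, hA i x y⟩
    · obtain ⟨k, l, hkl⟩ := hbcd j h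
      exact ⟨_, _, _, hkl ▸ hmul i x y k l⟩
  | mul_inv_cancel g _ _ hj ih =>
    obtain ⟨j, rfl⟩ := hj
    obtain ⟨i, x, y, rfl⟩ := ih
    by_cases h : j = 0
    · have hinv : (f 0)⁻¹ = f 0 * f 0 := by
        rwa [inv_eq_iff_mul_eq_one, ← mul_assoc, ← sq, ← pow_succ]
      rw [h, hinv, ← mul_assoc, hA, hA]
      exact ⟨_, _, _, rfl⟩
    · obtain ⟨k, l, hkl⟩ := hbcd j h
      rw [hkl, mul_inv_rev, ← zpow_neg, ← zpow_neg, (hcb.zpow_zpow _ _).eq]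
      exact ⟨_, _, _, hmul i x y _ _⟩

theorem toModel_injective {n : ℕ} (hn : 3 ≤ n) : Function.Injective (toModel hn) := by
  let f : Fin 4 → T1 n := PresentedGroup.of
  have hrel (r : FreeGroup (Fin 4)) (hr : r ∈ T1rels n) : FreeGroup.lift f r = 1 := by
    have : FreeGroup.lift f = PresentedGroup.mk (T1rels n) := by ext; simp [f]; rfl
    rw [this]
    exact PresentedGroup.one_of_mem hr
  have hgp (x y) : FreeGroup.lift f (gpComm x y) =
      gpComm (FreeGroup.lift f x) (FreeGroup.lift f y) := by simp [gpComm]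
  simp only [T1rels_eq hn, Set.mem_insert_iff, Set.mem_singleton_iff, forall_eq_or_imp, forall_eq,
    map_mul, map_inv, map_pow, hgp, FreeGroup.lift_apply_of] at hrel
  obtain ⟨hba, hca, -, -, hdc, hcn, hdn, ha, hb, hcb⟩ := hrel
  have hcb' := Model.gpComm_eq_one_iff.mp hcb
  have hdc' := Model.gpComm_eq_one_iff.mp hdc
  have hbn : f 1 ^ 3 ^ (n / 2) = 1 := by
    have h3 : f 1 ^ 3 = (f 3 * f 2 ^ 3)⁻¹ := by rwa [mul_assoc, mul_eq_one_iff_eq_inv] at hb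
    have hcn' : f 2 ^ 3 ^ (n / 2) = 1 :=
      orderOf_dvd_iff_pow_eq_one.mp ((orderOf_dvd_of_pow_eq_one hcn).trans
        (pow_dvd_pow _ (by omega)))
    rw [show n / 2 = n / 2 - 1 + 1 by omega, pow_succ'] at hcn' ⊢
    rw [pow_mul] at hcn' ⊢
    rw [h3, inv_pow, (hdc'.pow_right 3).mul_pow, hdn, hcn', one_mul, inv_one]
  rw [injective_iff_map_eq_one]
  intro g hg
  have hmem : g ∈ Subgroup.closure (Set.range f) := by
    rw [PresentedGroup.closure_range_of]; trivial
  obtain ⟨i, x, y, rfl⟩ := exists_eq_zpow_mul_zpow_mul_zpow (inv_mul_eq_one.mp hba).symm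
    (inv_mul_eq_one.mp hca).symm hcb' ha hb hmem
  have hf (j : Fin 4) : toModel hn (f j) =
      ![Model.genA n, Model.genB n, Model.genC n, Model.genD n] j :=
    PresentedGroup.toGroup.of _
  simp only [map_mul, map_zpow, hf, Matrix.cons_val] at hg
  rw [Model.normal_form, Model.ext_iff, Prod.ext_iff] at hg
  obtain ⟨⟨hx, hy⟩, hi⟩ := hg
  have key {u : T1 n} {m : ℕ} {k : ℤ} (hu : u ^ m = 1) (hk : (k : ZMod m) = 0) : u ^ k = 1 := by
    obtain ⟨l, rfl⟩ := (ZMod.intCast_zmod_eq_zero_iff_dvd k m).mp hk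
    rw [zpow_mul, zpow_natCast, hu, one_zpow]
  rw [key ha hi, key hbn hx, key hcn hy, one_mul, one_mul]

theorem toModel_surjective {n : ℕ} (hn : 3 ≤ n) : Function.Surjective (toModel hn) := by
  intro g
  obtain ⟨i, x, y, rfl⟩ := g.exists_normal_form
  refine ⟨PresentedGroup.of 0 ^ i * PresentedGroup.of 1 ^ x * PresentedGroup.of 2 ^ y, ?_⟩
  simp [toModel]

/-- The group `T1 n` is isomorphic to its concrete model. -/
noncomputable def equivModel {n : ℕ} (hn : 3 ≤ n) : T1 n ≃* Model n :=
  MulEquiv.ofBijective (toModel hn) ⟨toModel_injective hn, toModel_surjective hn⟩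

end MaxClass3

open MaxClass3 in
/-- For `n ≥ 4`, the group `T1(n)` satisfies `S(T1(n)) = 16 + 2·3^{n-2}`. -/
theorem SInvariant_T1 (n : ℕ) (hn : 4 ≤ n) :
    SInvariant (T1 n) = 16 + 2 * 3 ^ (n - 2) := by
  have e := equivModel (n := n) (by omega)
  have : Finite (T1 n) := Finite.of_equiv _ e.symm.toEquiv
  rw [SInvariant_eq_mul_card_conjClasses (k := 2) fun g => by
      rw [card_quotient_frattini_congr (e.centralizerCongr g),
        Model.card_quotient_frattini_centralizer (by omega)],
    card_conjClasses_congr e, Model.card_conjClasses (by omega)]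
  ring
end
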